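/- Let μ be a finite ℝ²-valued Borel measure on ℝ² with div μ = 0 in the sense of distributions. Then there exists a σ-finite non-negative Borel measure η on the space Γ of Lipschitz curves γ : [0,1] → ℝ² such that μ = ∫_Γ μ_γ dη(γ) and |μ| = ∫_Γ |μ_γ| dη(γ); moreover η can be taken so that for η-a.e. γ ∈ Γ there exists a Lipschitz curve γ̃ : [0,1] → ℝ², injective on [0,1) with γ̃(0) = γ̃(1), such that μ_γ = μ_γ̃. -/

import Mathlib

open MeasureTheory Filter
open scoped ENNReal NNReal RealInnerProductSpace

noncomputable section

abbrev Ed (d : ℕ) : Type := EuclideanSpace ℝ (Fin d)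

/-- A (Lipschitz) curve is a Lipschitz map `ℝ → ℝ^d`; only its restriction to `[0,1]` matters. -/
def IsLip {d : ℕ} (γ : ℝ → Ed d) : Prop := ∃ K : ℝ≥0, LipschitzWith K γ

/-- The space `Γ` of Lipschitz curves. -/
def Curve (d : ℕ) : Type := {γ : ℝ → Ed d // IsLip γ}

/-- Restriction of a curve to `[0,1]` as a continuous map; it induces the sup-norm topology
on the space of curves. -/
def curveRestrict {d : ℕ} (γ : Curve d) : C(Set.Icc (0:ℝ) 1, Ed d) :=
  ⟨fun t => γ.1 t, by
    obtain ⟨K, hK⟩ := γ.2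
    exact hK.continuous.comp continuous_subtype_val⟩

instance {d : ℕ} : TopologicalSpace (Curve d) :=
  TopologicalSpace.induced curveRestrict inferInstance

instance {d : ℕ} : MeasurableSpace (Curve d) := borel (Curve d)

/-- The pairing `⟨μ_γ, Φ⟩ = ∫₀¹ Φ(γ(t))·γ'(t) dt` of the vector measure induced by the curve
`γ` with a test vector field `Φ`. -/
def curvePair {d : ℕ} (γ : ℝ → Ed d) (Φ : Ed d → Ed d) : ℝ :=
  ∫ t in (0:ℝ)..1, ⟪Φ (γ t), deriv γ t⟫

/-- The pairing `⟨|μ_γ|, f⟩ = ∫₀¹ f(γ(t)) ‖γ'(t)‖ dt` of the total variation of the measure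
induced by the curve `γ` with a test function `f`. -/
def curveMass {d : ℕ} (γ : ℝ → Ed d) (f : Ed d → ℝ) : ℝ :=
  ∫ t in (0:ℝ)..1, f (γ t) * ‖deriv γ t‖

/-! ### Lipschitz curves and Riemann sums -/

section RiemannSums

variable {c : ℝ → Ed 2} {G : ℝ → Ed 2} {K : ℝ≥0}

lemma intervalIntegrable_inner_deriv (hc : LipschitzWith K c) (hG : Continuous G) (a b : ℝ) :
    IntervalIntegrable (fun t => ⟪G t, deriv c t⟫) volume a b := by
  have h1 : IntervalIntegrable (fun t => K * ‖G t‖) volume a b :=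
    (continuous_const.mul hG.norm).intervalIntegrable a b
  refine h1.mono_fun' ?_ ?_
  · exact ((hG.measurable.inner (measurable_deriv c))).aestronglyMeasurable
  · refine Eventually.of_forall fun t => ?_
    calc ‖⟪G t, deriv c t⟫‖ ≤ ‖G t‖ * ‖deriv c t‖ := norm_inner_le_norm _ _
      _ ≤ ‖G t‖ * K := by gcongr; exact norm_deriv_le_of_lipschitz hc
      _ = _ := mul_comm _ _

lemma integral_inner_deriv_const (hc : LipschitzWith K c) (Z : Ed 2) (a b : ℝ) :
    ∫ t in a..b, ⟪Z, deriv c t⟫ = ⟪Z, c b - c a⟫ := by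
  have hL : LipschitzWith (‖innerSL ℝ Z‖₊ * K) (fun t => ⟪Z, c t⟫) :=
    (innerSL ℝ Z).lipschitz.comp hc
  have h := (hL.lipschitzOnWith (s := Set.uIcc a b)).absolutelyContinuousOnInterval
    |>.integral_deriv_eq_sub
  rw [inner_sub_right, ← h]
  refine intervalIntegral.integral_congr_ae ?_
  filter_upwards [hc.ae_differentiableAt_real] with t ht _
  have := ((innerSL ℝ Z).hasFDerivAt (x := c t)).comp_hasDerivAt t ht.hasDerivAt
  exact this.deriv.symm

lemma abs_integral_inner_deriv_sub_le (hc : LipschitzWith K c) (hG : Continuous G) {a b ω : ℝ}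
    (hab : a ≤ b) (Z : Ed 2) (hZ : ∀ t ∈ Set.Icc a b, ‖G t - Z‖ ≤ ω) :
    |(∫ t in a..b, ⟪G t, deriv c t⟫) - ⟪Z, c b - c a⟫| ≤ ω * K * (b - a) := by
  rw [← integral_inner_deriv_const hc Z a b, ← intervalIntegral.integral_sub
    (intervalIntegrable_inner_deriv hc hG a b)
    (intervalIntegrable_inner_deriv hc continuous_const a b), ← Real.norm_eq_abs,
    ← abs_of_nonneg (sub_nonneg.2 hab)]
  refine intervalIntegral.norm_integral_le_of_norm_le_const fun t ht => ?_
  rw [Set.uIoc_of_le hab] at ht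
  rw [← inner_sub_left]
  have h0 := hZ t ⟨ht.1.le, ht.2⟩
  calc ‖⟪G t - Z, deriv c t⟫‖ ≤ ‖G t - Z‖ * ‖deriv c t‖ := norm_inner_le_norm _ _
    _ ≤ ω * K := mul_le_mul h0 (norm_deriv_le_of_lipschitz hc) (norm_nonneg _)
        ((norm_nonneg _).trans h0)

lemma abs_integral_inner_deriv_sub_sum_le (hc : LipschitzWith K c) (hG : Continuous G) {ω : ℝ}
    (s : ℕ → ℝ) (hs : Monotone s) (Z : ℕ → Ed 2) (n : ℕ)
    (hZ : ∀ i < n, ∀ t ∈ Set.Icc (s i) (s (i + 1)), ‖G t - Z i‖ ≤ ω) :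
    |(∫ t in (s 0)..(s n), ⟪G t, deriv c t⟫)
      - ∑ i ∈ Finset.range n, ⟪Z i, c (s (i + 1)) - c (s i)⟫| ≤ ω * K * (s n - s 0) := by
  induction n with
  | zero => simp
  | succ n ih =>
    have h1 := ih fun i hi => hZ i (by omega)
    have h2 := abs_integral_inner_deriv_sub_le hc hG (hs n.le_succ) (Z n) (hZ n (by omega))
    rw [Finset.sum_range_succ, ← intervalIntegral.integral_add_adjacent_intervals
      (intervalIntegrable_inner_deriv hc hG (s 0) (s n))
      (intervalIntegrable_inner_deriv hc hG (s n) (s (n + 1)))]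
    rw [abs_le] at *
    constructor <;> linarith [h1.1, h1.2, h2.1, h2.2]

end RiemannSums

/-! ### The space of loops -/

/-- Parameters `(L, x, c)` of a loop `t ↦ x + L • c t`. -/
abbrev LoopData : Type := ℝ × Ed 2 × C(Set.Icc (0:ℝ) 1, Ed 2)

/-- Extension of a path on `[0,1]` to the real line by constants. -/
def hat (c : C(Set.Icc (0:ℝ) 1, Ed 2)) : ℝ → Ed 2 :=
  fun t => c (Set.projIcc 0 1 zero_le_one t)

def loopCurve (q : LoopData) (t : ℝ) : Ed 2 := q.2.1 + q.1 • hat q.2.2 t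

/-- The normalised pairing of a loop with a vector field. -/
def loopPair (q : LoopData) (Φ : Ed 2 → Ed 2) : ℝ :=
  ∫ t in (0:ℝ)..1, ⟪Φ (loopCurve q t), deriv (hat q.2.2) t⟫

/-- Closed loops of length at most `N` staying in the ball of radius `2 * N`. -/
def loopSet (N : ℝ) : Set LoopData :=
  {q | 0 ≤ q.1 ∧ q.1 ≤ N ∧ LipschitzWith 1 q.2.2 ∧ q.2.2 0 = 0 ∧ q.2.2 1 = 0 ∧
    ∀ t, ‖q.2.1 + q.1 • q.2.2 t‖ ≤ 2 * N}

lemma hat_coe (c : C(Set.Icc (0:ℝ) 1, Ed 2)) (t : Set.Icc (0:ℝ) 1) : hat c t = c t := by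
  simp [hat, Set.projIcc_val]

lemma hat_zero (c : C(Set.Icc (0:ℝ) 1, Ed 2)) : hat c 0 = c 0 := hat_coe c 0

lemma hat_one (c : C(Set.Icc (0:ℝ) 1, Ed 2)) : hat c 1 = c 1 := hat_coe c 1

lemma continuous_hat (c : C(Set.Icc (0:ℝ) 1, Ed 2)) : Continuous (hat c) :=
  c.continuous.comp continuous_projIcc

lemma lipschitz_hat {c : C(Set.Icc (0:ℝ) 1, Ed 2)} (hc : LipschitzWith 1 c) :
    LipschitzWith 1 (hat c) := by
  have := hc.comp (LipschitzWith.projIcc (zero_le_one (α := ℝ)))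
  rw [one_mul] at this
  exact this

lemma continuous_loopCurve (q : LoopData) : Continuous (loopCurve q) :=
  continuous_const.add ((continuous_hat q.2.2).const_smul q.1)

lemma loopSet_mono {M N : ℝ} (h : M ≤ N) : loopSet M ⊆ loopSet N := fun _ hq =>
  ⟨hq.1, hq.2.1.trans h, hq.2.2.1, hq.2.2.2.1, hq.2.2.2.2.1, fun t =>
    (hq.2.2.2.2.2 t).trans (by linarith)⟩

lemma zero_mem_loopSet {N : ℝ} (hN : 0 ≤ N) : (0 : LoopData) ∈ loopSet N :=
  ⟨le_rfl, hN, LipschitzWith.const' 0, rfl, rfl, fun t => by simpa using hN⟩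

lemma loopPair_zero (Φ : Ed 2 → Ed 2) : loopPair 0 Φ = 0 := by
  have : deriv (hat (0 : LoopData).2.2) = fun _ => 0 := by
    have : hat (0 : LoopData).2.2 = fun _ => 0 := rfl
    rw [this]; simp
  rw [loopPair, this]; simp

section

variable {N : ℝ} {q : LoopData} {Φ Ψ : Ed 2 → Ed 2}

lemma intervalIntegrable_loopPair (hq : q ∈ loopSet N) (hΦ : Continuous Φ) :
    IntervalIntegrable (fun t => ⟪Φ (loopCurve q t), deriv (hat q.2.2) t⟫) volume 0 1 :=
  intervalIntegrable_inner_deriv (lipschitz_hat hq.2.2.1)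
    (hΦ.comp (continuous_loopCurve q)) 0 1

lemma loopPair_add (hq : q ∈ loopSet N) (hΦ : Continuous Φ) (hΨ : Continuous Ψ) :
    loopPair q (Φ + Ψ) = loopPair q Φ + loopPair q Ψ := by
  rw [loopPair, loopPair, loopPair, ← intervalIntegral.integral_add
    (intervalIntegrable_loopPair hq hΦ) (intervalIntegrable_loopPair hq hΨ)]
  simp [inner_add_left]

lemma loopPair_smul (a : ℝ) : loopPair q (a • Φ) = a * loopPair q Φ := by
  rw [loopPair, loopPair, ← intervalIntegral.integral_const_mul]
  simp [inner_smul_left]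

lemma abs_loopPair_le (hq : q ∈ loopSet N) {B : ℝ} (hB : ∀ x, ‖Φ x‖ ≤ B) :
    |loopPair q Φ| ≤ B := by
  have h := intervalIntegral.norm_integral_le_of_norm_le_const (a := 0) (b := 1) (C := B)
    (f := fun t => ⟪Φ (loopCurve q t), deriv (hat q.2.2) t⟫) (fun t _ => by
      calc _ ≤ ‖Φ (loopCurve q t)‖ * ‖deriv (hat q.2.2) t‖ := norm_inner_le_norm _ _
        _ ≤ B * 1 := mul_le_mul (hB _) (by
            simpa using norm_deriv_le_of_lipschitz (lipschitz_hat hq.2.2.1) (x₀ := t))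
            (norm_nonneg _) ((norm_nonneg _).trans (hB (loopCurve q t)))
        _ = B := mul_one _)
  simpa [loopPair] using h

lemma loopPair_eq_zero_of_fst_eq_zero (hq : q ∈ loopSet N) (h0 : q.1 = 0) :
    loopPair q Φ = 0 := by
  have h : ∀ t, loopCurve q t = q.2.1 := fun t => by simp [loopCurve, h0]
  simp only [loopPair, h]
  rw [integral_inner_deriv_const (lipschitz_hat hq.2.2.1), hat_zero, hat_one, hq.2.2.2.1,
    hq.2.2.2.2.1]
  simp

end

lemma isCompact_pathSet : IsCompact {c : C(Set.Icc (0:ℝ) 1, Ed 2) |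
    LipschitzWith 1 c ∧ c 0 = 0 ∧ c 1 = 0} := by
  apply ArzelaAscoli.isCompact_of_equicontinuous
  · have hK : IsCompact (Set.univ.pi fun _ : Set.Icc (0:ℝ) 1 => Metric.closedBall (0 : Ed 2) 1) :=
      isCompact_univ_pi fun _ => isCompact_closedBall _ _
    have hC : IsClosed {f : Set.Icc (0:ℝ) 1 → Ed 2 | LipschitzWith 1 f ∧ f 0 = 0 ∧ f 1 = 0} := by
      refine IsClosed.inter ?_ (IsClosed.inter ?_ ?_)
      · have : {f : Set.Icc (0:ℝ) 1 → Ed 2 | LipschitzWith 1 f} =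
            ⋂ (s) (t), {f | dist (f s) (f t) ≤ (1 : ℝ≥0) * dist s t} := by
          ext f; simp only [Set.mem_iInter]; exact lipschitzWith_iff_dist_le_mul
        change IsClosed {f : Set.Icc (0:ℝ) 1 → Ed 2 | LipschitzWith 1 f}
        rw [this]
        refine isClosed_iInter fun x => isClosed_iInter fun y => ?_
        exact isClosed_le ((continuous_apply x).dist (continuous_apply y)) continuous_const
      · exact isClosed_eq (continuous_apply _) continuous_const
      · exact isClosed_eq (continuous_apply _) continuous_const
    convert! hK.of_isClosed_subset hC ?_
    · ext f
      constructor
      · rintro ⟨c, hc, rfl⟩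
        exact hc
      · rintro ⟨hf, h0, h1⟩
        exact ⟨⟨f, hf.continuous⟩, ⟨hf, h0, h1⟩, rfl⟩
    · rintro f ⟨hf, h0, -⟩ t -
      have := hf.dist_le_mul t 0
      rw [h0] at this
      rw [Metric.mem_closedBall]
      refine this.trans ?_
      rw [Subtype.dist_eq, Real.dist_eq]
      simp only [NNReal.coe_one, Set.Icc.coe_zero, sub_zero, one_mul]
      rw [abs_of_nonneg t.2.1]; exact t.2.2
  · refine (LipschitzWith.uniformEquicontinuous _ 1 fun c => ?_).equicontinuous
    exact c.2.1

lemma isCompact_loopSet (N : ℝ) : IsCompact (loopSet N) := by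
  have hK := (isCompact_Icc (a := (0:ℝ)) (b := N)).prod
    ((isCompact_closedBall (0 : Ed 2) (2 * N)).prod isCompact_pathSet)
  have hev : ∀ t : Set.Icc (0:ℝ) 1, Continuous fun q : LoopData => q.2.2 t := fun t =>
    (continuous_eval_const t).comp (continuous_snd.comp continuous_snd)
  refine hK.of_isClosed_subset ?_ ?_
  · refine IsClosed.inter (isClosed_le continuous_const continuous_fst) ?_
    refine IsClosed.inter (isClosed_le continuous_fst continuous_const) ?_
    refine IsClosed.inter ?_ ?_
    · have : {q : LoopData | LipschitzWith 1 q.2.2} =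
          ⋂ (s) (t), {q : LoopData | dist (q.2.2 s) (q.2.2 t) ≤ (1 : ℝ≥0) * dist s t} := by
        ext q; simp only [Set.mem_iInter]; exact lipschitzWith_iff_dist_le_mul
      change IsClosed {q : LoopData | LipschitzWith 1 q.2.2}
      rw [this]
      exact isClosed_iInter fun x => isClosed_iInter fun y =>
        isClosed_le ((hev x).dist (hev y)) continuous_const
    refine IsClosed.inter (isClosed_eq (hev _) continuous_const) ?_
    refine IsClosed.inter (isClosed_eq (hev _) continuous_const) ?_
    have : {q : LoopData | ∀ t, ‖q.2.1 + q.1 • q.2.2 t‖ ≤ 2 * N} =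
        ⋂ t, {q : LoopData | ‖q.2.1 + q.1 • q.2.2 t‖ ≤ 2 * N} := by ext; simp
    change IsClosed {q : LoopData | ∀ t, ‖q.2.1 + q.1 • q.2.2 t‖ ≤ 2 * N}
    rw [this]
    exact isClosed_iInter fun t => isClosed_le
      ((continuous_fst.comp continuous_snd).add (continuous_fst.smul (hev t))).norm
      continuous_const
  · rintro q ⟨h0, hN, hl, hc0, hc1, hb⟩
    refine ⟨⟨h0, hN⟩, ?_, hl, hc0, hc1⟩
    have := hb 0
    rw [hc0, smul_zero, add_zero] at this
    simpa using this

lemma continuousOn_loopPair (N : ℝ) {Φ : Ed 2 → Ed 2} (hΦ : Continuous Φ)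
    (hs : HasCompactSupport Φ) : ContinuousOn (fun q => loopPair q Φ) (loopSet N) := by
  refine continuousOn_of_uniform_approx_of_continuousOn fun u hu => ?_
  obtain ⟨ε, hε, hεu⟩ := Metric.mem_uniformity_dist.1 hu
  obtain ⟨δ, hδ, hδΦ⟩ := Metric.uniformContinuous_iff.1
    (hs.uniformContinuous_of_continuous hΦ) (ε / 2) (half_pos hε)
  obtain ⟨n, hn⟩ := exists_nat_gt (|N| / δ)
  have hn0 : (0:ℝ) < n := lt_of_le_of_lt (by positivity) hn
  have hnδ : |N| / n < δ := by
    rw [div_lt_iff₀ hδ] at hn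
    rw [div_lt_iff₀ hn0]; linarith
  let s : ℕ → ℝ := fun i => i / n
  have hs : Monotone s := fun i j hij => by simp only [s]; gcongr
  refine ⟨fun q => ∑ i ∈ Finset.range n, ⟪Φ (loopCurve q (s i)),
    hat q.2.2 (s (i + 1)) - hat q.2.2 (s i)⟫, ?_, fun q hq => hεu ?_⟩
  · have hev : ∀ t : ℝ, Continuous fun q : LoopData => hat q.2.2 t := fun t =>
      (continuous_eval_const _).comp (continuous_snd.comp continuous_snd)
    refine Continuous.continuousOn (continuous_finsetSum _ fun i _ => ?_)
    refine Continuous.inner (hΦ.comp ?_) ((hev _).sub (hev _))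
    exact (continuous_fst.comp continuous_snd).add (continuous_fst.smul (hev _))
  · have h := abs_integral_inner_deriv_sub_sum_le (lipschitz_hat hq.2.2.1)
      (hΦ.comp (continuous_loopCurve q)) (ω := ε / 2) s hs (fun i => Φ (loopCurve q (s i))) n
      (fun i _ t ht => by
        rw [← dist_eq_norm]
        refine (hδΦ ?_).le
        have h1 : dist (hat q.2.2 t) (hat q.2.2 (s i)) ≤ 1 / n := by
          have := (lipschitz_hat hq.2.2.1).dist_le_mul t (s i)
          rw [NNReal.coe_one, one_mul, Real.dist_eq, abs_of_nonneg (by linarith [ht.1])] at this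
          refine this.trans ?_
          have h2 : s (i + 1) = s i + 1 / n := by simp only [s]; push_cast; ring
          linarith [ht.2]
        calc dist (loopCurve q t) (loopCurve q (s i))
            = |q.1| * dist (hat q.2.2 t) (hat q.2.2 (s i)) := by
              simp only [loopCurve, dist_add_left, dist_smul₀, Real.norm_eq_abs]
          _ ≤ |N| * (1 / n) := by
              refine mul_le_mul ?_ h1 dist_nonneg (abs_nonneg _)
              rw [abs_of_nonneg hq.1]; exact hq.2.1.trans (le_abs_self _)
          _ = |N| / n := by ring
          _ < δ := hnδ)
    have e0 : s 0 = 0 := by simp [s]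
    have e1 : s n = 1 := by simp only [s]; exact div_self hn0.ne'
    rw [e0, e1] at h
    rw [Real.dist_eq]
    refine lt_of_le_of_lt h ?_
    simp only [NNReal.coe_one]; linarith

/-! ### Cutting and building loops -/

lemma integral_congr_on_Ioo {f g : ℝ → ℝ} {a b : ℝ} (hab : a ≤ b)
    (h : ∀ t ∈ Set.Ioo a b, f t = g t) : ∫ t in a..b, f t = ∫ t in a..b, g t := by
  rw [intervalIntegral.integral_of_le hab, intervalIntegral.integral_of_le hab,
    integral_Ioc_eq_integral_Ioo, integral_Ioc_eq_integral_Ioo]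
  exact setIntegral_congr_fun measurableSet_Ioo h

/-- The line integral of `Φ` along `g`. -/
def lineInt (g : ℝ → Ed 2) (Φ : Ed 2 → Ed 2) (a b : ℝ) : ℝ :=
  ∫ u in a..b, ⟪Φ (g u), deriv g u⟫

lemma lineInt_congr {f g : ℝ → Ed 2} {a b : ℝ} (hab : a ≤ b)
    (h : ∀ t ∈ Set.Ioo a b, f t = g t) (Φ : Ed 2 → Ed 2) :
    lineInt f Φ a b = lineInt g Φ a b := by
  refine integral_congr_on_Ioo hab fun t ht => ?_
  have : f =ᶠ[nhds t] g := by
    filter_upwards [isOpen_Ioo.mem_nhds ht] with u hu using h u hu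
  rw [h t ht, this.deriv_eq]

lemma lineInt_comp_add (g : ℝ → Ed 2) (Φ : Ed 2 → Ed 2) (a b d : ℝ) :
    lineInt (fun u => g (u + d)) Φ a b = lineInt g Φ (a + d) (b + d) := by
  simp only [lineInt, deriv_comp_add_const]
  exact intervalIntegral.integral_comp_add_right (fun u => ⟪Φ (g u), deriv g u⟫) d

lemma lineInt_add {g : ℝ → Ed 2} (hg : LipschitzWith 1 g) {Φ : Ed 2 → Ed 2} (hΦ : Continuous Φ)
    (a b c : ℝ) : lineInt g Φ a b + lineInt g Φ b c = lineInt g Φ a c :=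
  intervalIntegral.integral_add_adjacent_intervals
    (intervalIntegrable_inner_deriv hg (hΦ.comp hg.continuous) a b)
    (intervalIntegrable_inner_deriv hg (hΦ.comp hg.continuous) b c)

lemma lipschitzWith_glue {f g : ℝ → Ed 2} (hf : LipschitzWith 1 f) (hg : LipschitzWith 1 g)
    {a : ℝ} (h : f a = g a) : LipschitzWith 1 (fun t => if t ≤ a then f t else g t) := by
  have key : ∀ x y, x ≤ y → dist (if x ≤ a then f x else g x) (if y ≤ a then f y else g y)
      ≤ dist x y := by
    intro x y hxy
    have hf' := fun s t => hf.dist_le_mul s t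
    have hg' := fun s t => hg.dist_le_mul s t
    simp only [NNReal.coe_one, one_mul] at hf' hg'
    split_ifs with h1 h2 h2
    · exact hf' x y
    · calc dist (f x) (g y) ≤ dist (f x) (f a) + dist (f a) (g y) := dist_triangle _ _ _
        _ ≤ dist x a + dist a y := by
            refine add_le_add (hf' x a) ?_
            rw [h]; exact hg' a y
        _ = dist x y := by
            rw [Real.dist_eq, Real.dist_eq, Real.dist_eq, abs_of_nonpos (by linarith),
              abs_of_nonpos (by linarith), abs_of_nonpos (by linarith)]; ring
    · exact absurd (hxy.trans h2) h1
    · exact hg' x y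
  refine LipschitzWith.of_dist_le_mul fun x y => ?_
  rw [NNReal.coe_one, one_mul]
  rcases le_total x y with hxy | hxy
  · exact key x y hxy
  · rw [dist_comm, dist_comm x]; exact key y x hxy

/-- The loop which runs through `g` on `[0, L]`. -/
def mkLoop (g : ℝ → Ed 2) (hg : LipschitzWith 1 g) (L : ℝ) : LoopData :=
  (L, g 0, ⟨fun r => L⁻¹ • (g (L * r) - g 0), by
    have := hg.continuous
    fun_prop⟩)

section MkLoop

variable {g : ℝ → Ed 2} (hg : LipschitzWith 1 g) {L N : ℝ}

include hg in
lemma mkLoop_mem (hL : 0 < L) (hN : L ≤ N) (hgL : g L = g 0)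
    (hb : ∀ u ∈ Set.Icc 0 L, ‖g u‖ ≤ 2 * N) : mkLoop g hg L ∈ loopSet N := by
  refine ⟨hL.le, hN, ?_, ?_, ?_, fun t => ?_⟩
  · refine LipschitzWith.of_dist_le_mul fun x y => ?_
    have h := hg.dist_le_mul (L * x) (L * y)
    simp only [mkLoop, ContinuousMap.coe_mk, dist_smul₀, dist_sub_right] at h ⊢
    rw [Real.dist_eq, ← mul_sub, abs_mul, abs_of_pos hL, NNReal.coe_one, one_mul] at h
    rw [norm_inv, Real.norm_of_nonneg hL.le, NNReal.coe_one, one_mul, Subtype.dist_eq,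
      Real.dist_eq, inv_mul_le_iff₀ hL]
    exact h
  · simp [mkLoop]
  · simp [mkLoop, hgL]
  · have e : g 0 + L • L⁻¹ • (g (L * t) - g 0) = g (L * t) := by
      rw [smul_inv_smul₀ hL.ne']; abel
    simp only [mkLoop, ContinuousMap.coe_mk, e]
    exact hb _ ⟨mul_nonneg hL.le t.2.1, by nlinarith [t.2.2]⟩

lemma mul_loopPair_mkLoop (hL : 0 < L) (Φ : Ed 2 → Ed 2) :
    L * loopPair (mkLoop g hg L) Φ = lineInt g Φ 0 L := by
  have hhat : ∀ t ∈ Set.Icc (0:ℝ) 1, hat (mkLoop g hg L).2.2 t = L⁻¹ • (g (L * t) - g 0) :=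
    fun t ht => hat_coe _ ⟨t, ht⟩
  have h1 : loopPair (mkLoop g hg L) Φ = ∫ t in (0:ℝ)..1, ⟪Φ (g (L * t)), deriv g (L * t)⟫ := by
    refine integral_congr_on_Ioo zero_le_one fun t ht => ?_
    have e : loopCurve (mkLoop g hg L) t = g (L * t) := by
      rw [loopCurve, hhat t ⟨ht.1.le, ht.2.le⟩]
      simp only [mkLoop]
      rw [smul_inv_smul₀ hL.ne']; abel
    have e2 : hat (mkLoop g hg L).2.2 =ᶠ[nhds t] fun t => L⁻¹ • (g (L * t) - g 0) := by
      filter_upwards [isOpen_Ioo.mem_nhds ht] with u hu using hhat u ⟨hu.1.le, hu.2.le⟩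
    rw [e, e2.deriv_eq]
    congr 1
    have h3 : deriv (fun t => L⁻¹ • (g (L * t) - g 0)) t = L⁻¹ • deriv (fun t => g (L * t)) t := by
      rw [deriv_fun_const_smul_field, deriv_sub_const]
    rw [h3, deriv_comp_mul_left, inv_smul_smul₀ hL.ne']
  rw [h1, intervalIntegral.integral_comp_mul_left (fun u => ⟪Φ (g u), deriv g u⟫) hL.ne']
  simp only [mul_zero, mul_one, smul_eq_mul, lineInt]
  field_simp

end MkLoop

/-- Parametrisation of a loop over `[0, L]`. -/
def arcCurve (q : LoopData) (u : ℝ) : Ed 2 := loopCurve q (q.1⁻¹ * u)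

lemma lipschitz_arcCurve {N : ℝ} {q : LoopData} (hq : q ∈ loopSet N) (hL : 0 < q.1) :
    LipschitzWith 1 (arcCurve q) := by
  refine LipschitzWith.of_dist_le_mul fun x y => ?_
  have h := (lipschitz_hat hq.2.2.1).dist_le_mul (q.1⁻¹ * x) (q.1⁻¹ * y)
  simp only [arcCurve, loopCurve, dist_add_left, dist_smul₀] at h ⊢
  rw [Real.dist_eq (q.1⁻¹ * x), ← mul_sub, abs_mul, abs_of_pos (inv_pos.2 hL), NNReal.coe_one,
    one_mul] at h
  rw [Real.norm_of_nonneg hL.le, NNReal.coe_one, one_mul, Real.dist_eq]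
  calc _ ≤ q.1 * (q.1⁻¹ * |x - y|) := by gcongr
    _ = _ := by field_simp

lemma lineInt_arcCurve {q : LoopData} (hL : 0 < q.1)
    (Φ : Ed 2 → Ed 2) :
    lineInt (arcCurve q) Φ 0 q.1 = q.1 * loopPair q Φ := by
  have hd : ∀ u, deriv (arcCurve q) u = deriv (hat q.2.2) (q.1⁻¹ * u) := fun u => by
    have : arcCurve q = fun u => q.2.1 + q.1 • hat q.2.2 (q.1⁻¹ * u) := rfl
    rw [this, deriv_const_add, deriv_fun_const_smul_field, deriv_comp_mul_left,
      smul_inv_smul₀ hL.ne']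
  simp only [lineInt, hd, arcCurve]
  rw [intervalIntegral.integral_comp_mul_left
    (fun u => ⟪Φ (loopCurve q u), deriv (hat q.2.2) u⟫) (inv_ne_zero hL.ne')]
  rw [mul_zero, inv_mul_cancel₀ hL.ne', inv_inv, smul_eq_mul, loopPair]

lemma norm_loopCurve_le {N : ℝ} {q : LoopData} (hq : q ∈ loopSet N) (t : ℝ) :
    ‖loopCurve q t‖ ≤ 2 * N := hq.2.2.2.2.2 _

lemma exists_loop_split {N : ℝ} {q : LoopData} (hq : q ∈ loopSet N) (hL : 0 < q.1) {s t : ℝ}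
    (hs : 0 ≤ s) (hst : s < t) (ht : t ≤ 1) (hd : t - s < 1) (he : loopCurve q s = loopCurve q t) :
    ∃ q₁ ∈ loopSet N, ∃ q₂ ∈ loopSet N, q₁.1 = (t - s) * q.1 ∧ q₂.1 = (1 - (t - s)) * q.1 ∧
      ∀ Φ : Ed 2 → Ed 2, Continuous Φ →
        loopPair q Φ = (t - s) * loopPair q₁ Φ + (1 - (t - s)) * loopPair q₂ Φ := by
  set L := q.1 with hLdef
  have hg := lipschitz_arcCurve hq hL
  set g := arcCurve q with hgdef
  have hgb : ∀ u, ‖g u‖ ≤ 2 * N := fun u => norm_loopCurve_le hq _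
  have hgs : ∀ r, g (L * r) = loopCurve q r := fun r => by
    rw [hgdef, arcCurve, ← hLdef, inv_mul_cancel_left₀ hL.ne']
  have hg1 : LipschitzWith 1 (fun u => g (u + L * s)) :=
    LipschitzWith.of_dist_le_mul fun x y => by simpa using hg.dist_le_mul (x + L * s) (y + L * s)
  have hg2 : LipschitzWith 1 (fun u => g (u + L * (t - s))) :=
    LipschitzWith.of_dist_le_mul fun x y => by
      simpa using hg.dist_le_mul (x + L * (t - s)) (y + L * (t - s))
  have hglue := lipschitzWith_glue hg hg2 (a := L * s) (by
    rw [← mul_add, hgs, hgs, he]; congr 1; ring)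
  have hL1 : 0 < L * (t - s) := mul_pos hL (by linarith)
  have hL2 : 0 < L * (1 - (t - s)) := mul_pos hL (by linarith)
  refine ⟨mkLoop _ hg1 (L * (t - s)), mkLoop_mem _ hL1 ?_ ?_ fun u _ => hgb _,
    mkLoop _ hglue (L * (1 - (t - s))), mkLoop_mem _ hL2 ?_ ?_ fun u _ => ?_, ?_, ?_,
    fun Φ hΦ => ?_⟩
  · exact le_trans (by nlinarith) hq.2.1
  · simp only [zero_add, ← mul_add]
    rw [hgs, hgs, he]; congr 1; ring
  · exact le_trans (by nlinarith) hq.2.1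
  · have h01 : g (L * 0) = g (L * 1) := by
      rw [hgs, hgs, loopCurve, loopCurve, hat_zero, hat_one, hq.2.2.2.1, hq.2.2.2.2.1]
    simp only [← mul_add, sub_add_cancel]
    rw [if_pos (show (0:ℝ) ≤ L * s from mul_nonneg hL.le hs)]
    split_ifs with h
    · have hs0 : s = 1 - (t - s) := le_antisymm (by linarith) (by
        exact le_of_mul_le_mul_left h hL)
      have ht1 : t = 1 := by linarith
      rw [← hs0, hgs, he, ht1, ← hgs, ← h01, mul_zero]
    · rw [← mul_zero L, h01, mul_one]
  · split_ifs <;> exact hgb _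
  · exact mul_comm _ _
  · exact mul_comm _ _
  · have e1 := mul_loopPair_mkLoop hg1 hL1 Φ
    have e2 := mul_loopPair_mkLoop hglue hL2 Φ
    have e0 := lineInt_arcCurve hL Φ
    rw [← hLdef, ← hgdef] at e0
    have hle : L * s ≤ L * (1 - (t - s)) := by gcongr; linarith
    rw [lineInt_comp_add, zero_add] at e1
    rw [← lineInt_add hglue hΦ 0 (L * s), lineInt_congr (g := g) (by positivity) (fun u hu => by
      rw [if_pos hu.2.le]), lineInt_congr (g := fun u => g (u + L * (t - s))) hle (fun u hu => by
      rw [if_neg (not_le.2 hu.1)]), lineInt_comp_add] at e2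
    have a1 : L * (t - s) + L * s = L * t := by ring
    have a2 : L * s + L * (t - s) = L * t := by ring
    have a3 : L * (1 - (t - s)) + L * (t - s) = L := by ring
    rw [a1] at e1
    rw [a2, a3] at e2
    have e3 := lineInt_add hg hΦ 0 (L * s) (L * t)
    have e4 := lineInt_add hg hΦ 0 (L * t) L
    have : L * loopPair q Φ = L * ((t - s) * loopPair (mkLoop _ hg1 (L * (t - s))) Φ
      + (1 - (t - s)) * loopPair (mkLoop _ hglue (L * (1 - (t - s)))) Φ) := by linarith
    exact mul_left_cancel₀ hL.ne' this

lemma exists_lipschitz_through (p : ℕ → Ed 2) (n : ℕ) :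
    ∃ g : ℝ → Ed 2, LipschitzWith 1 g ∧
      ∀ i ≤ n, g (∑ j ∈ Finset.range i, ‖p (j + 1) - p j‖) = p i := by
  induction n with
  | zero =>
    exact ⟨fun _ => p 0, LipschitzWith.const' _, fun i hi => by simp [Nat.le_zero.1 hi]⟩
  | succ n ih =>
    obtain ⟨g, hg, hgp⟩ := ih
    set s : ℕ → ℝ := fun i => ∑ j ∈ Finset.range i, ‖p (j + 1) - p j‖ with hs
    have hsm : Monotone s := monotone_nat_of_le_succ fun i => by
      simp only [hs, Finset.sum_range_succ]; linarith [norm_nonneg (p (i + 1) - p i)]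
    set v := p (n + 1) - p n with hv
    have hlin : LipschitzWith 1 (fun t : ℝ => p n + (t - s n) • (‖v‖⁻¹ • v)) := by
      refine LipschitzWith.of_dist_le_mul fun x y => ?_
      rw [dist_add_left, dist_eq_norm, ← sub_smul, norm_smul, NNReal.coe_one, one_mul,
        sub_sub_sub_cancel_right, Real.dist_eq, Real.norm_eq_abs, norm_smul, norm_inv, norm_norm]
      exact mul_le_of_le_one_right (abs_nonneg _) (inv_mul_le_one)
    refine ⟨_, lipschitzWith_glue hg hlin (a := s n) (by rw [hgp n le_rfl]; simp), fun i hi => ?_⟩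
    change (if s i ≤ s n then g (s i) else p n + (s i - s n) • (‖v‖⁻¹ • v)) = p i
    rcases Nat.le_succ_iff.1 hi with h | rfl
    · rw [if_pos (hsm h), hgp i h]
    · have e : s (n + 1) = s n + ‖v‖ := by simp only [hs, Finset.sum_range_succ, hv]
      by_cases hv0 : v = 0
      · have : s (n + 1) ≤ s n := by rw [e, hv0]; simp
        rw [if_pos this]
        have h2 : s (n + 1) = s n := by rw [e, hv0]; simp
        rw [h2, hgp n le_rfl]
        exact (sub_eq_zero.1 (hv ▸ hv0)).symm
      · have hpos : 0 < ‖v‖ := norm_pos_iff.2 hv0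
        rw [if_neg (by rw [e]; linarith), e, add_sub_cancel_left, smul_inv_smul₀ hpos.ne', hv]
        abel

/-- A closed polygon of length at most `N` through the ball of radius `N` bounds the Riemann sums
of a vector field along it in terms of the pairings with the elements of `loopSet N`. -/
lemma sum_inner_le_of_closed_chain {Φ : Ed 2 → Ed 2} (hΦ : Continuous Φ) {N H ω : ℝ}
    (hH : ∀ q ∈ loopSet N, loopPair q Φ ≤ H) (p : ℕ → Ed 2) (Z : ℕ → Ed 2) (n : ℕ)
    (hp : p n = p 0) (hZ : ∀ i < n, ∀ y, ‖y - p i‖ ≤ ‖p (i + 1) - p i‖ → ‖Φ y - Z i‖ ≤ ω)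
    (hN : ∑ i ∈ Finset.range n, ‖p (i + 1) - p i‖ ≤ N) {k : ℕ} (hk : k ≤ n) (hpk : ‖p k‖ ≤ N) :
    ∑ i ∈ Finset.range n, ⟪Z i, p (i + 1) - p i⟫ ≤
      (H + ω) * ∑ i ∈ Finset.range n, ‖p (i + 1) - p i‖ := by
  obtain ⟨g, hg, hgp⟩ := exists_lipschitz_through p n
  set s : ℕ → ℝ := fun i => ∑ j ∈ Finset.range i, ‖p (j + 1) - p j‖ with hs
  have hsm : Monotone s := monotone_nat_of_le_succ fun i => by
    simp only [hs, Finset.sum_range_succ]; linarith [norm_nonneg (p (i + 1) - p i)]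
  have hs0 : s 0 = 0 := by simp [hs]
  have hsnn : 0 ≤ s n := hs0 ▸ hsm (Nat.zero_le n)
  change s n ≤ N at hN
  change _ ≤ (H + ω) * s n
  rcases hsnn.eq_or_lt with h0 | hpos
  · have : ∀ i ∈ Finset.range n, p (i + 1) - p i = 0 := fun i hi => by
      have h1 := (Finset.sum_eq_zero_iff_of_nonneg fun j _ => norm_nonneg (p (j + 1) - p j)).1
        h0.symm i hi
      exact norm_eq_zero.1 h1
    rw [Finset.sum_congr rfl fun i hi => by rw [this i hi, inner_zero_right], ← h0]
    simp
  have hg0 : g 0 = p 0 := by rw [← hs0]; exact hgp 0 (Nat.zero_le n)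
  have hgn : g (s n) = p n := hgp n le_rfl
  have hmem : mkLoop g hg (s n) ∈ loopSet N := by
    refine mkLoop_mem hg hpos hN (by rw [hgn, hg0, hp]) fun u hu => ?_
    have h1 := hg.dist_le_mul u (s k)
    rw [hgp k hk, NNReal.coe_one, one_mul, Real.dist_eq] at h1
    have h2 : |u - s k| ≤ s n := by
      have := hsm hk
      have h3 : 0 ≤ s k := hs0 ▸ hsm (Nat.zero_le k)
      rw [abs_le]; constructor <;> linarith [hu.1, hu.2]
    calc ‖g u‖ ≤ ‖g u - p k‖ + ‖p k‖ := by simpa using norm_add_le (g u - p k) (p k)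
      _ ≤ N + N := add_le_add (by rw [← dist_eq_norm]; linarith) hpk
      _ = 2 * N := by ring
  have h1 := mul_loopPair_mkLoop hg hpos Φ
  have h2 := mul_le_mul_of_nonneg_left (hH _ hmem) hsnn
  have h3 := abs_integral_inner_deriv_sub_sum_le hg (hΦ.comp hg.continuous) s hsm Z n
    (ω := ω) (fun i hi t ht => by
      refine hZ i hi _ ?_
      have h4 := hg.dist_le_mul t (s i)
      rw [hgp i hi.le, NNReal.coe_one, one_mul, Real.dist_eq,
        abs_of_nonneg (by linarith [ht.1]), dist_eq_norm] at h4
      refine h4.trans ?_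
      have : s (i + 1) = s i + ‖p (i + 1) - p i‖ := by simp only [hs, Finset.sum_range_succ]
      linarith [ht.2])
  rw [hs0] at h3
  simp only [Function.comp_apply] at h3
  change |lineInt g Φ 0 (s n) - _| ≤ _ at h3
  have e : ∑ i ∈ Finset.range n, ⟪Z i, g (s (i + 1)) - g (s i)⟫ =
      ∑ i ∈ Finset.range n, ⟪Z i, p (i + 1) - p i⟫ := by
    refine Finset.sum_congr rfl fun i hi => ?_
    have := Finset.mem_range.1 hi
    rw [hgp i this.le, hgp (i + 1) this]
  rw [e] at h3
  have := (abs_le.1 h3).1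
  simp only [NNReal.coe_one] at this
  nlinarith

/-! ### Level sets of a linear function on a triangle -/

/-- The fraction of an edge with end values `α` and `β` on which the linear interpolation
exceeds `t`. -/
def edgeFrac (α β t : ℝ) : ℝ :=
  if α = β then (if t < α then 1 else 0) else (max (β - t) 0 - max (α - t) 0) / (β - α)

lemma edgeFrac_comm (α β t : ℝ) : edgeFrac α β t = edgeFrac β α t := by
  unfold edgeFrac
  by_cases h : α = β
  · subst h; rfl
  · rw [if_neg h, if_neg (Ne.symm h), ← neg_sub β α, div_neg, ← neg_div]; ring

lemma edgeFrac_of_lt {α β t : ℝ} (h1 : t < α) (h2 : t < β) : edgeFrac α β t = 1 := by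
  unfold edgeFrac
  split_ifs with h
  · rfl
  · rw [max_eq_left (by linarith), max_eq_left (by linarith), sub_sub_sub_cancel_right,
      div_self (sub_ne_zero.2 (Ne.symm h))]

lemma edgeFrac_of_gt {α β t : ℝ} (h1 : α < t) (h2 : β < t) : edgeFrac α β t = 0 := by
  unfold edgeFrac
  split_ifs with h h3
  · linarith
  · rfl
  · rw [max_eq_right (by linarith), max_eq_right (by linarith)]; simp

lemma edgeFrac_of_up {α β t : ℝ} (h1 : α < t) (h2 : t < β) :
    edgeFrac α β t = (β - t) / (β - α) := by
  unfold edgeFrac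
  rw [if_neg (by linarith), max_eq_left (by linarith), max_eq_right (by linarith), sub_zero]

lemma edgeFrac_of_down {α β t : ℝ} (h1 : t < α) (h2 : β < t) :
    edgeFrac α β t = (α - t) / (α - β) := by
  rw [edgeFrac_comm, edgeFrac_of_up h2 h1]

lemma abs_edgeFrac_le {α β t : ℝ} (hα : α ≠ t) (hβ : β ≠ t) : |edgeFrac α β t| ≤ 1 := by
  rcases lt_or_gt_of_ne hα with h1 | h1 <;> rcases lt_or_gt_of_ne hβ with h2 | h2
  · simp [edgeFrac_of_gt h1 h2]
  · rw [edgeFrac_of_up h1 h2, abs_of_nonneg (div_nonneg (by linarith) (by linarith)),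
      div_le_one (by linarith)]
    linarith
  · rw [edgeFrac_of_down h1 h2, abs_of_nonneg (div_nonneg (by linarith) (by linarith)),
      div_le_one (by linarith)]
    linarith
  · simp [edgeFrac_of_lt h1 h2]

lemma measurable_edgeFrac (α β : ℝ) : Measurable (edgeFrac α β) := by
  unfold edgeFrac
  split_ifs
  · exact Measurable.ite measurableSet_Iio measurable_const measurable_const
  · fun_prop

lemma integral_max_sub {β M : ℝ} (h : |β| ≤ M) :
    ∫ t in (-M)..M, max (β - t) 0 = (β + M) ^ 2 / 2 := by
  obtain ⟨h1, h2⟩ := abs_le.1 h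
  have hi : ∀ a b, IntervalIntegrable (fun t : ℝ => max (β - t) 0) volume a b := fun a b =>
    Continuous.intervalIntegrable (by fun_prop) a b
  rw [← intervalIntegral.integral_add_adjacent_intervals (hi (-M) β) (hi β M)]
  have e1 : ∫ t in (-M)..β, max (β - t) 0 = ∫ t in (-M)..β, (β - t) := by
    refine integral_congr_on_Ioo h1 fun t ht => max_eq_left (by linarith [ht.2])
  have e2 : ∫ t in β..M, max (β - t) 0 = ∫ t in β..M, (0:ℝ) := by
    refine integral_congr_on_Ioo h2 fun t ht => max_eq_right (by linarith [ht.1])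
  rw [e1, e2, intervalIntegral.integral_sub (by simp) (by simp)]
  simp
  ring

lemma intervalIntegrable_edgeFrac (α β a b : ℝ) :
    IntervalIntegrable (edgeFrac α β) volume a b := by
  have h : IntervalIntegrable (fun _ => (1:ℝ)) volume a b := by simp
  refine h.mono_fun' (measurable_edgeFrac α β).aestronglyMeasurable ?_
  have h2 : ∀ᵐ t : ℝ, t ≠ α ∧ t ≠ β := by
    have : ({α, β} : Set ℝ).Countable := (Set.countable_singleton β).insert α
    filter_upwards [this.ae_notMem volume] with t ht
    simpa using ht
  refine ae_restrict_of_ae ?_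
  filter_upwards [h2] with t ht using abs_edgeFrac_le ht.1.symm ht.2.symm

lemma integral_edgeFrac {α β M : ℝ} (hα : |α| ≤ M) (hβ : |β| ≤ M) :
    ∫ t in (-M)..M, edgeFrac α β t = (α + β) / 2 + M := by
  by_cases h : α = β
  · subst h
    obtain ⟨h1, h2⟩ := abs_le.1 hα
    have hi := intervalIntegrable_edgeFrac α α
    rw [← intervalIntegral.integral_add_adjacent_intervals (hi (-M) α) (hi α M)]
    have e1 : ∫ t in (-M)..α, edgeFrac α α t = ∫ t in (-M)..α, (1:ℝ) :=
      integral_congr_on_Ioo h1 fun t ht => edgeFrac_of_lt ht.2 ht.2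
    have e2 : ∫ t in α..M, edgeFrac α α t = ∫ t in α..M, (0:ℝ) :=
      integral_congr_on_Ioo h2 fun t ht => edgeFrac_of_gt ht.1 ht.1
    rw [e1, e2]; simp
  · have e : ∀ t, edgeFrac α β t = (max (β - t) 0 - max (α - t) 0) / (β - α) := fun t => by
      rw [edgeFrac, if_neg h]
    simp only [e]
    rw [intervalIntegral.integral_div, intervalIntegral.integral_sub, integral_max_sub hα,
      integral_max_sub hβ, div_eq_iff (sub_ne_zero.2 (Ne.symm h))]
    · ring
    · exact Continuous.intervalIntegrable (by fun_prop) _ _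
    · exact Continuous.intervalIntegrable (by fun_prop) _ _

/-- The oriented segment cut out of a triangle with vertices `v` by the level set at height `t`
of the linear function with vertex values `u`. -/
def cutSeg (u : Fin 3 → ℝ) (v : Fin 3 → Ed 2) (t : ℝ) : Ed 2 :=
  ∑ i, edgeFrac (u i) (u (i + 1)) t • (v (i + 1) - v i)

/-- The rotated gradient of the linear function with vertex values `u`, times the area. -/
def rotGrad (u : Fin 3 → ℝ) (v : Fin 3 → Ed 2) : Ed 2 :=
  ∑ i, ((u i + u (i + 1)) / 2) • (v (i + 1) - v i)

lemma edgeFrac_proportional {a b c t : ℝ} (ha : a ≠ t) (hb : b ≠ t) (hc : c ≠ t) :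
    ∃ κ : ℝ, 0 ≤ κ ∧ edgeFrac a b t - edgeFrac c a t = κ * ((b - c) / 2) ∧
      edgeFrac b c t - edgeFrac c a t = κ * ((b - a) / 2) := by
  rcases lt_or_gt_of_ne ha with h1 | h1 <;> rcases lt_or_gt_of_ne hb with h2 | h2 <;>
    rcases lt_or_gt_of_ne hc with h3 | h3
  · exact ⟨0, le_rfl, by simp [edgeFrac_of_gt, *], by simp [edgeFrac_of_gt, *]⟩
  · have k1 : c - a ≠ 0 := by linarith
    have k2 : c - b ≠ 0 := by linarith
    have k3 : 0 < (c - a) * (c - b) := mul_pos (by linarith) (by linarith)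
    refine ⟨2 * (c - t) / ((c - a) * (c - b)), div_nonneg (by linarith) k3.le, ?_, ?_⟩
    · rw [edgeFrac_of_gt h1 h2, edgeFrac_of_down h3 h1]; field_simp; ring
    · rw [edgeFrac_of_up h2 h3, edgeFrac_of_down h3 h1]; field_simp; ring
  · have k1 : b - a ≠ 0 := by linarith
    have k2 : b - c ≠ 0 := by linarith
    have k3 : 0 < (b - a) * (b - c) := mul_pos (by linarith) (by linarith)
    refine ⟨2 * (b - t) / ((b - a) * (b - c)), div_nonneg (by linarith) k3.le, ?_, ?_⟩
    · rw [edgeFrac_of_up h1 h2, edgeFrac_of_gt h3 h1]; field_simp; ring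
    · rw [edgeFrac_of_down h2 h3, edgeFrac_of_gt h3 h1]; field_simp; ring
  · have k1 : b - a ≠ 0 := by linarith
    have k2 : c - a ≠ 0 := by linarith
    have k3 : 0 < (b - a) * (c - a) := mul_pos (by linarith) (by linarith)
    refine ⟨2 * (t - a) / ((b - a) * (c - a)), div_nonneg (by linarith) k3.le, ?_, ?_⟩
    · rw [edgeFrac_of_up h1 h2, edgeFrac_of_down h3 h1]; field_simp; ring
    · rw [edgeFrac_of_lt h2 h3, edgeFrac_of_down h3 h1]; field_simp; ring
  · have k1 : a - b ≠ 0 := by linarith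
    have k2 : a - c ≠ 0 := by linarith
    have k3 : 0 < (a - b) * (a - c) := mul_pos (by linarith) (by linarith)
    refine ⟨2 * (a - t) / ((a - b) * (a - c)), div_nonneg (by linarith) k3.le, ?_, ?_⟩
    · rw [edgeFrac_of_down h1 h2, edgeFrac_of_up h3 h1]; field_simp; ring
    · rw [edgeFrac_of_gt h2 h3, edgeFrac_of_up h3 h1]; field_simp; ring
  · have k1 : a - b ≠ 0 := by linarith
    have k2 : c - b ≠ 0 := by linarith
    have k3 : 0 < (a - b) * (c - b) := mul_pos (by linarith) (by linarith)
    refine ⟨2 * (t - b) / ((a - b) * (c - b)), div_nonneg (by linarith) k3.le, ?_, ?_⟩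
    · rw [edgeFrac_of_down h1 h2, edgeFrac_of_lt h3 h1]; field_simp; ring
    · rw [edgeFrac_of_up h2 h3, edgeFrac_of_lt h3 h1]; field_simp; ring
  · have k1 : a - c ≠ 0 := by linarith
    have k2 : b - c ≠ 0 := by linarith
    have k3 : 0 < (a - c) * (b - c) := mul_pos (by linarith) (by linarith)
    refine ⟨2 * (t - c) / ((a - c) * (b - c)), div_nonneg (by linarith) k3.le, ?_, ?_⟩
    · rw [edgeFrac_of_lt h1 h2, edgeFrac_of_up h3 h1]; field_simp; ring
    · rw [edgeFrac_of_down h2 h3, edgeFrac_of_up h3 h1]; field_simp; ring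
  · exact ⟨0, le_rfl, by simp [edgeFrac_of_lt, *], by simp [edgeFrac_of_lt, *]⟩

variable (u : Fin 3 → ℝ) (v : Fin 3 → Ed 2)

lemma cutSeg_eq_smul_rotGrad {t : ℝ} (ht : ∀ i, u i ≠ t) :
    ∃ κ : ℝ, 0 ≤ κ ∧ cutSeg u v t = κ • rotGrad u v := by
  obtain ⟨κ, hκ, h1, h2⟩ := edgeFrac_proportional (ht 0) (ht 1) (ht 2)
  refine ⟨κ, hκ, ?_⟩
  have h2' : (2:Fin 3) + 1 = 0 := rfl
  have h1' : (1:Fin 3) + 1 = 2 := rfl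
  simp only [cutSeg, rotGrad, Fin.sum_univ_three, zero_add, h1', h2']
  have e1 : edgeFrac (u 0) (u 1) t = edgeFrac (u 2) (u 0) t + κ * ((u 1 - u 2) / 2) := by linarith
  have e2 : edgeFrac (u 1) (u 2) t = edgeFrac (u 2) (u 0) t + κ * ((u 1 - u 0) / 2) := by linarith
  rw [e1, e2]
  module

lemma cutSeg_eq_zero_of_lt {t : ℝ} (ht : ∀ i, t < u i) : cutSeg u v t = 0 := by
  have : ∀ i, edgeFrac (u i) (u (i + 1)) t = 1 := fun i => edgeFrac_of_lt (ht _) (ht _)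
  have h2' : (2:Fin 3) + 1 = 0 := rfl
  have h1' : (1:Fin 3) + 1 = 2 := rfl
  simp only [cutSeg, this, Fin.sum_univ_three, zero_add, h1', h2']
  module

lemma cutSeg_eq_zero_of_gt {t : ℝ} (ht : ∀ i, u i < t) : cutSeg u v t = 0 := by
  have : ∀ i, edgeFrac (u i) (u (i + 1)) t = 0 := fun i => edgeFrac_of_gt (ht _) (ht _)
  simp [cutSeg, this]

lemma ae_forall_ne : ∀ᵐ t : ℝ, ∀ i, u i ≠ t := by
  have : (Set.range u).Countable := Set.countable_range u
  filter_upwards [this.ae_notMem volume] with t ht i h using ht ⟨i, h⟩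

lemma exists_bound_three : ∃ M : ℝ, 0 < M ∧ ∀ i, |u i| < M :=
  ⟨1 + ∑ i, |u i|, by positivity, fun i => by
    have := Finset.single_le_sum (f := fun i => |u i|) (fun i _ => abs_nonneg _)
      (Finset.mem_univ i)
    linarith⟩

lemma cutSeg_eq_indicator {M : ℝ} (hM : ∀ i, |u i| < M) :
    (Set.Ioc (-M) M).indicator (cutSeg u v) =ᵐ[volume] cutSeg u v := by
  filter_upwards [ae_forall_ne u] with t ht
  by_cases h : t ∈ Set.Ioc (-M) M
  · rw [Set.indicator_of_mem h]
  · rw [Set.indicator_of_notMem h]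
    rw [Set.mem_Ioc, not_and_or, not_lt, not_le] at h
    rcases h with h | h
    · exact (cutSeg_eq_zero_of_lt u v fun i => by linarith [(abs_lt.1 (hM i)).1]).symm
    · exact (cutSeg_eq_zero_of_gt u v fun i => by linarith [(abs_lt.1 (hM i)).2]).symm

lemma intervalIntegrable_cutSeg (a b : ℝ) : IntervalIntegrable (cutSeg u v) volume a b := by
  have : ∀ i, IntervalIntegrable
      (fun t => edgeFrac (u i) (u (i + 1)) t • (v (i + 1) - v i)) volume a b := fun i => by
    have h := intervalIntegrable_edgeFrac (u i) (u (i + 1)) a b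
    exact ⟨h.1.smul_const _, h.2.smul_const _⟩
  have h := IntervalIntegrable.sum Finset.univ fun i _ => this i
  have e : cutSeg u v = ∑ i, fun t => edgeFrac (u i) (u (i + 1)) t • (v (i + 1) - v i) := by
    ext1 t
    simp only [cutSeg, Finset.sum_apply]
  rw [e]
  exact h

lemma integrable_cutSeg : Integrable (cutSeg u v) := by
  obtain ⟨M, hM0, hM⟩ := exists_bound_three u
  refine Integrable.congr ?_ (cutSeg_eq_indicator u v hM)
  rw [integrable_indicator_iff measurableSet_Ioc]
  exact (intervalIntegrable_iff_integrableOn_Ioc_of_le (by linarith)).1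
    (intervalIntegrable_cutSeg u v _ _)

lemma integral_cutSeg : ∫ t, cutSeg u v t = rotGrad u v := by
  obtain ⟨M, hM0, hM⟩ := exists_bound_three u
  rw [← integral_congr_ae (cutSeg_eq_indicator u v hM), integral_indicator measurableSet_Ioc,
    ← intervalIntegral.integral_of_le (by linarith)]
  simp only [cutSeg]
  rw [intervalIntegral.integral_finsetSum]
  · have : ∀ i, ∫ t in (-M)..M, edgeFrac (u i) (u (i + 1)) t • (v (i + 1) - v i) =
        ((u i + u (i + 1)) / 2 + M) • (v (i + 1) - v i) := fun i => by
      rw [intervalIntegral.integral_smul_const, integral_edgeFrac (hM _).le (hM _).le]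
    simp only [this]
    have h2' : (2:Fin 3) + 1 = 0 := rfl
    have h1' : (1:Fin 3) + 1 = 2 := rfl
    simp only [rotGrad, Fin.sum_univ_three, zero_add, h1', h2']
    module
  · intro i _
    have h := intervalIntegrable_edgeFrac (u i) (u (i + 1)) (-M) M
    exact ⟨h.1.smul_const _, h.2.smul_const _⟩

lemma integral_norm_cutSeg : ∫ t, ‖cutSeg u v t‖ = ‖rotGrad u v‖ := by
  by_cases h0 : rotGrad u v = 0
  · have : (fun t => ‖cutSeg u v t‖) =ᵐ[volume] fun _ => 0 := by
      filter_upwards [ae_forall_ne u] with t ht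
      obtain ⟨κ, -, h⟩ := cutSeg_eq_smul_rotGrad u v ht
      rw [h, h0]; simp
    rw [integral_congr_ae this, h0]; simp
  · have hpos : 0 < ‖rotGrad u v‖ := norm_pos_iff.2 h0
    have : (fun t => ‖cutSeg u v t‖ * ‖rotGrad u v‖) =ᵐ[volume]
        fun t => ⟪rotGrad u v, cutSeg u v t⟫ := by
      filter_upwards [ae_forall_ne u] with t ht
      obtain ⟨κ, hκ, h⟩ := cutSeg_eq_smul_rotGrad u v ht
      rw [h, inner_smul_right, norm_smul, Real.norm_of_nonneg hκ, real_inner_self_eq_norm_sq]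
      ring
    have h2 := integral_congr_ae this
    rw [integral_mul_const, integral_inner (integrable_cutSeg u v), integral_cutSeg,
      real_inner_self_eq_norm_sq, sq] at h2
    exact mul_right_cancel₀ hpos.ne' h2

/-! ### Permutations and orbit sums -/

section Orbits

variable {S : Type*} (σ : Equiv.Perm S)

lemma sum_range_mul_iterate {f : S → ℝ} {x : S} {n : ℕ} (hn : σ^[n] x = x) (m : ℕ) :
    ∑ i ∈ Finset.range (n * m), f (σ^[i] x) = m * ∑ i ∈ Finset.range n, f (σ^[i] x) := by
  induction m with
  | zero => simp
  | succ m ih =>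
    have hper : σ^[n * m] x = x := by
      rw [Function.iterate_mul]; exact Function.iterate_fixed hn m
    rw [Nat.mul_succ, Finset.sum_range_add, ih]
    have : ∀ i, σ^[n * m + i] x = σ^[i] x := fun i => by
      rw [add_comm, Function.iterate_add_apply, hper]
    simp only [this]
    push_cast; ring

variable [Fintype S]

lemma sum_nonneg_of_orbit_sum_nonneg {f : S → ℝ}
    (h : ∀ x, 0 ≤ ∑ i ∈ Finset.range (Function.minimalPeriod σ x), f (σ^[i] x)) :
    0 ≤ ∑ x, f x := by
  have hM : 0 < orderOf σ := orderOf_pos σ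
  have hper : ∀ x, σ^[orderOf σ] x = x := fun x => by
    rw [← Equiv.Perm.coe_pow, pow_orderOf_eq_one]; rfl
  have h1 : ∀ x, 0 ≤ ∑ i ∈ Finset.range (orderOf σ), f (σ^[i] x) := fun x => by
    obtain ⟨m, hm⟩ := (show Function.IsPeriodicPt σ (orderOf σ) x from hper x).minimalPeriod_dvd
    rw [hm, sum_range_mul_iterate σ (Function.iterate_minimalPeriod)]
    exact mul_nonneg (Nat.cast_nonneg _) (h x)
  have h2 : ∑ x, ∑ i ∈ Finset.range (orderOf σ), f (σ^[i] x) = orderOf σ * ∑ x, f x := by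
    rw [Finset.sum_comm]
    have : ∀ i, ∑ x, f (σ^[i] x) = ∑ x, f x := fun i => by
      rw [← Equiv.Perm.coe_pow]; exact Equiv.sum_comp (σ ^ i) f
    simp [this]
  have h3 : 0 ≤ (orderOf σ : ℝ) * ∑ x, f x := h2 ▸ Finset.sum_nonneg fun x _ => h1 x
  exact nonneg_of_mul_nonneg_right h3 (by exact_mod_cast hM)

lemma orbit_sum_le_sum {g : S → ℝ} (hg : ∀ x, 0 ≤ g x) (x : S) :
    ∑ i ∈ Finset.range (Function.minimalPeriod σ x), g (σ^[i] x) ≤ ∑ y, g y := by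
  classical
  have hinj : Set.InjOn (fun i => σ^[i] x) (Finset.range (Function.minimalPeriod σ x)) := by
    have := Function.iterate_injOn_Iio_minimalPeriod (f := σ) (x := x)
    intro i hi j hj hij
    exact this (by simpa using hi) (by simpa using hj) hij
  rw [← Finset.sum_image (f := g) hinj]
  exact Finset.sum_le_sum_of_subset_of_nonneg (Finset.subset_univ _) fun y _ _ => hg y

end Orbits

lemma exists_finset_int_box {h : ℝ} (hh : 0 < h) {ρ : ℝ} (hρ : 0 ≤ ρ) (s : ℝ) :
    ∃ I : Finset ℤ, (∀ j : ℤ, |h * j - s| ≤ ρ → j ∈ I) ∧ (I.card : ℝ) ≤ 2 * ρ / h + 1 := by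
  refine ⟨Finset.Icc ⌈(s - ρ) / h⌉ ⌊(s + ρ) / h⌋, fun j hj => ?_, ?_⟩
  · obtain ⟨h1, h2⟩ := abs_le.1 hj
    rw [Finset.mem_Icc, Int.ceil_le, Int.le_floor, div_le_iff₀ hh, le_div_iff₀ hh]
    constructor <;> linarith
  · rw [Int.card_Icc]
    have h1 := Int.floor_le ((s + ρ) / h)
    have h2 := Int.le_ceil ((s - ρ) / h)
    have h3 : (s + ρ) / h - (s - ρ) / h = 2 * ρ / h := by ring
    have h4 : 0 ≤ 2 * ρ / h := by positivity
    rcases le_total 0 (⌊(s + ρ) / h⌋ + 1 - ⌈(s - ρ) / h⌉) with h5 | h5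
    · have : (((⌊(s + ρ) / h⌋ + 1 - ⌈(s - ρ) / h⌉).toNat : ℤ) : ℝ) =
        ((⌊(s + ρ) / h⌋ + 1 - ⌈(s - ρ) / h⌉ : ℤ) : ℝ) := by rw [Int.toNat_of_nonneg h5]
      rw [← Int.cast_natCast, this]; push_cast; linarith
    · rw [Int.toNat_of_nonpos h5]; push_cast; linarith

/-! ### The triangulated lattice -/

/-- Triangles of the standard triangulation: a cell and one of its two halves. -/
abbrev Tri : Type := (ℤ × ℤ) × Bool

def triVert : Tri → Fin 3 → ℤ × ℤ
  | (a, false) => ![a, a + (1, 0), a + (0, 1)]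
  | (a, true) => ![a + (1, 1), a + (0, 1), a + (1, 0)]

/-- The triangle on the other side of an edge. -/
def triFlip : Tri → Fin 3 → Tri
  | (a, false) => ![(a - (0, 1), true), (a, true), (a - (1, 0), true)]
  | (a, true) => ![(a + (0, 1), false), (a, false), (a + (1, 0), false)]

lemma triFlip_triFlip (T : Tri) (i : Fin 3) : triFlip (triFlip T i) i = T := by
  obtain ⟨a, b⟩ := T
  cases b <;> fin_cases i <;> simp [triFlip]

lemma triVert_triFlip (T : Tri) (i : Fin 3) : triVert (triFlip T i) i = triVert T (i + 1) := by
  obtain ⟨⟨a, a'⟩, b⟩ := T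
  cases b <;> fin_cases i <;> simp [triFlip, triVert]

lemma triVert_triFlip_succ (T : Tri) (i : Fin 3) :
    triVert (triFlip T i) (i + 1) = triVert T i := by
  obtain ⟨⟨a, a'⟩, b⟩ := T
  cases b <;> fin_cases i <;> simp [triFlip, triVert]

lemma triVert_bool_injective (i : Fin 3) :
    Function.Injective fun T : Tri => (triVert T i, T.2) := by
  rintro ⟨⟨a, a'⟩, b⟩ ⟨⟨c, c'⟩, d⟩ h
  obtain ⟨h1, h2⟩ := Prod.ext_iff.1 h
  simp only at h1 h2
  subst h2
  cases b <;> fin_cases i <;> simpa [triVert] using h1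

/-- The edge along which a sign pattern changes from `false` to `true`. -/
def upIdx (s : Fin 3 → Bool) : Fin 3 :=
  if s 0 = false ∧ s 1 = true then 0 else if s 1 = false ∧ s 2 = true then 1 else 2

/-- The edge along which a sign pattern changes from `true` to `false`. -/
def dnIdx (s : Fin 3 → Bool) : Fin 3 :=
  if s 0 = true ∧ s 1 = false then 0 else if s 1 = true ∧ s 2 = false then 1 else 2

lemma upIdx_spec : ∀ s : Fin 3 → Bool, ¬ (s 0 = s 1 ∧ s 1 = s 2) →
    s (upIdx s) = false ∧ s (upIdx s + 1) = true := by decide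

lemma dnIdx_spec : ∀ s : Fin 3 → Bool, ¬ (s 0 = s 1 ∧ s 1 = s 2) →
    s (dnIdx s) = true ∧ s (dnIdx s + 1) = false := by decide

lemma eq_upIdx : ∀ (s : Fin 3 → Bool) (i : Fin 3), s i = false → s (i + 1) = true →
    i = upIdx s := by decide

lemma eq_dnIdx : ∀ (s : Fin 3 → Bool) (i : Fin 3), s i = true → s (i + 1) = false →
    i = dnIdx s := by decide

lemma not_constant_of_ne : ∀ (s : Fin 3 → Bool) (i : Fin 3), s i ≠ s (i + 1) →
    ¬ (s 0 = s 1 ∧ s 1 = s 2) := by decide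

lemma const_of_eq : ∀ (s : Fin 3 → Bool), (s 0 = s 1 ∧ s 1 = s 2) → ∀ i, s i = s 0 := by decide

/-- The point at height `t` on an edge. -/
def crossPt (u : Fin 3 → ℝ) (v : Fin 3 → Ed 2) (t : ℝ) (i : Fin 3) : Ed 2 :=
  v i + ((t - u i) / (u (i + 1) - u i)) • (v (i + 1) - v i)

lemma cutSeg_eq_crossPt_sub {u : Fin 3 → ℝ} (v : Fin 3 → Ed 2) {t : ℝ} (ht : ∀ i, u i ≠ t)
    {i j : Fin 3} (hi : u i < t ∧ t < u (i + 1)) (hj : t < u j ∧ u (j + 1) < t) :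
    cutSeg u v t = crossPt u v t j - crossPt u v t i := by
  have hup : ∀ α β, α < t → t < β → edgeFrac α β t = 1 - (t - α) / (β - α) := fun α β h1 h2 => by
    have : β - α ≠ 0 := by linarith
    rw [edgeFrac_of_up h1 h2]; field_simp; ring
  have hdn : ∀ α β, t < α → β < t → edgeFrac α β t = (t - α) / (β - α) := fun α β h1 h2 => by
    rw [edgeFrac_of_down h1 h2, ← neg_sub t α, ← neg_sub β α, neg_div_neg_eq]
  have h2' : (2:Fin 3) + 1 = 0 := rfl
  have h1' : (1:Fin 3) + 1 = 2 := rfl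
  have h0 := ht 0
  have h1 := ht 1
  have h2 := ht 2
  fin_cases i <;> fin_cases j <;>
    simp only [Fin.zero_eta, Fin.mk_one, Fin.reduceFinMk, zero_add, h1', h2'] at hi hj <;>
    first
    | (exfalso; linarith [hi.1, hi.2, hj.1, hj.2])
    | skip
  all_goals
    simp only [cutSeg, crossPt, Fin.sum_univ_three, zero_add, h1', h2', Fin.zero_eta, Fin.mk_one,
      Fin.reduceFinMk]
    rw [hup _ _ hi.1 hi.2, hdn _ _ hj.1 hj.2]
    first
    | rw [edgeFrac_of_lt (by tauto) (by tauto)]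
    | rw [edgeFrac_of_gt (by tauto) (by tauto)]
    module

section Lattice

variable (h : ℝ) (u : ℤ × ℤ → ℝ) (t : ℝ)

def latPos (a : ℤ × ℤ) : Ed 2 := !₂[h * a.1, h * a.2]

def triSgn (T : Tri) (i : Fin 3) : Bool := decide (t < u (triVert T i))

def Crossed (T : Tri) : Prop :=
  ¬ (triSgn u t T 0 = triSgn u t T 1 ∧ triSgn u t T 1 = triSgn u t T 2)

/-- The piece of the level set of `u` at height `t` in a triangle. -/
def triSeg (T : Tri) : Ed 2 :=
  cutSeg (fun i => u (triVert T i)) (fun i => latPos h (triVert T i)) t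

def triGrad (T : Tri) : Ed 2 :=
  rotGrad (fun i => u (triVert T i)) (fun i => latPos h (triVert T i))

def triCross (T : Tri) (i : Fin 3) : Ed 2 :=
  crossPt (fun i => u (triVert T i)) (fun i => latPos h (triVert T i)) t i

variable {h u t}

lemma triSgn_triFlip (T : Tri) (i : Fin 3) :
    triSgn u t (triFlip T i) i = triSgn u t T (i + 1) := by
  rw [triSgn, triSgn, triVert_triFlip]

lemma triSgn_triFlip_succ (T : Tri) (i : Fin 3) :
    triSgn u t (triFlip T i) (i + 1) = triSgn u t T i := by
  rw [triSgn, triSgn, triVert_triFlip_succ]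

lemma Crossed.flip_dn {T : Tri} (hT : Crossed u t T) :
    Crossed u t (triFlip T (dnIdx (triSgn u t T))) ∧
      upIdx (triSgn u t (triFlip T (dnIdx (triSgn u t T)))) = dnIdx (triSgn u t T) := by
  obtain ⟨h1, h2⟩ := dnIdx_spec _ hT
  set i := dnIdx (triSgn u t T)
  have e1 := triSgn_triFlip (u := u) (t := t) T i
  have e2 := triSgn_triFlip_succ (u := u) (t := t) T i
  rw [h2] at e1
  rw [h1] at e2
  exact ⟨not_constant_of_ne _ i (by rw [e1, e2]; decide), (eq_upIdx _ i e1 e2).symm⟩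

lemma Crossed.flip_up {T : Tri} (hT : Crossed u t T) :
    Crossed u t (triFlip T (upIdx (triSgn u t T))) ∧
      dnIdx (triSgn u t (triFlip T (upIdx (triSgn u t T)))) = upIdx (triSgn u t T) := by
  obtain ⟨h1, h2⟩ := upIdx_spec _ hT
  set i := upIdx (triSgn u t T)
  have e1 := triSgn_triFlip (u := u) (t := t) T i
  have e2 := triSgn_triFlip_succ (u := u) (t := t) T i
  rw [h2] at e1
  rw [h1] at e2
  exact ⟨not_constant_of_ne _ i (by rw [e1, e2]; decide), (eq_dnIdx _ i e1 e2).symm⟩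

variable (u t) in
/-- The permutation of the crossed triangles which follows the level set. -/
def triNext : Equiv.Perm {T : Tri // Crossed u t T} where
  toFun T := ⟨triFlip T.1 (dnIdx (triSgn u t T.1)), T.2.flip_dn.1⟩
  invFun T := ⟨triFlip T.1 (upIdx (triSgn u t T.1)), T.2.flip_up.1⟩
  left_inv T := by
    apply Subtype.ext
    simp only
    rw [T.2.flip_dn.2, triFlip_triFlip]
  right_inv T := by
    apply Subtype.ext
    simp only
    rw [T.2.flip_up.2, triFlip_triFlip]

lemma triCross_triFlip {T : Tri} {i : Fin 3}
    (hs : triSgn u t T i ≠ triSgn u t T (i + 1)) :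
    triCross h u t (triFlip T i) i = triCross h u t T i := by
  simp only [triCross, crossPt, triVert_triFlip, triVert_triFlip_succ]
  have hne : u (triVert T (i + 1)) - u (triVert T i) ≠ 0 := fun h0 => hs (by
    rw [triSgn, triSgn, sub_eq_zero.1 h0])
  set α := u (triVert T i)
  set β := u (triVert T (i + 1))
  have e : (t - β) / (α - β) = 1 - (t - α) / (β - α) := by
    have : α - β ≠ 0 := fun h0 => hne (by linarith)
    field_simp; ring
  rw [e]
  module

lemma triSeg_eq (hu : ∀ a, u a ≠ t) {T : Tri} (hT : Crossed u t T) :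
    triSeg h u t T = triCross h u t T (dnIdx (triSgn u t T)) -
      triCross h u t T (upIdx (triSgn u t T)) := by
  obtain ⟨h1, h2⟩ := upIdx_spec _ hT
  obtain ⟨h3, h4⟩ := dnIdx_spec _ hT
  have hT1 : ∀ i, triSgn u t T i = true → t < u (triVert T i) := fun i hi => by
    simpa [triSgn] using hi
  have hT2 : ∀ i, triSgn u t T i = false → u (triVert T i) < t := fun i hi => by
    have : u (triVert T i) ≤ t := by simpa [triSgn] using hi
    exact lt_of_le_of_ne this (hu _)
  exact cutSeg_eq_crossPt_sub _ (fun i => hu _) ⟨hT2 _ h1, hT1 _ h2⟩ ⟨hT1 _ h3, hT2 _ h4⟩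

lemma triSeg_eq_zero (hu : ∀ a, u a ≠ t) {T : Tri} (hT : ¬ Crossed u t T) :
    triSeg h u t T = 0 := by
  have hc := const_of_eq (triSgn u t T) (not_not.1 hT)
  cases hs : triSgn u t T 0
  · refine cutSeg_eq_zero_of_gt _ _ fun i => ?_
    have h1 : triSgn u t T i = false := (hc i).trans hs
    have : u (triVert T i) ≤ t := by simpa [triSgn] using h1
    exact lt_of_le_of_ne this (hu _)
  · refine cutSeg_eq_zero_of_lt _ _ fun i => ?_
    have h1 : triSgn u t T i = true := (hc i).trans hs
    simpa [triSgn] using h1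

lemma finite_crossed (hu : Tendsto u cofinite (nhds 0)) (ht : t ≠ 0) :
    {T : Tri | Crossed u t T}.Finite := by
  have hF : {a | |t| ≤ |u a|}.Finite := by
    have : ∀ᶠ a in cofinite, |u a| < |t| := by
      have h1 := hu.abs
      rw [abs_zero] at h1
      exact h1.eventually (gt_mem_nhds (abs_pos.2 ht))
    refine this.subset fun a ha => ?_
    simpa using ha
  have hfin : ∀ i : Fin 3, {T : Tri | |t| ≤ |u (triVert T i)|}.Finite := fun i => by
    have h1 : ({a | |t| ≤ |u a|} ×ˢ (Set.univ : Set Bool)).Finite := hF.prod Set.finite_univ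
    refine (h1.preimage (triVert_bool_injective i).injOn).subset fun T hT => ?_
    simpa using hT
  refine (Set.finite_iUnion hfin).subset fun T hT => ?_
  rw [Set.mem_iUnion]
  rcases lt_or_gt_of_ne ht with h0 | h0
  · refine ⟨upIdx (triSgn u t T), ?_⟩
    have h1 := (upIdx_spec _ hT).1
    have : u (triVert T (upIdx (triSgn u t T))) ≤ t := by
      rw [triSgn] at h1; simpa using h1
    change |t| ≤ |_|
    rw [abs_of_neg h0, abs_of_neg (by linarith)]
    linarith
  · refine ⟨dnIdx (triSgn u t T), ?_⟩
    have h1 := (dnIdx_spec _ hT).1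
    have : t < u (triVert T (dnIdx (triSgn u t T))) := by
      rw [triSgn] at h1; simpa using h1
    change |t| ≤ |_|
    rw [abs_of_pos h0, abs_of_pos (by linarith)]
    linarith

lemma norm_latPos_triVert_sub_le (hh : 0 ≤ h) (T : Tri) (i : Fin 3) :
    ‖latPos h (triVert T i) - latPos h T.1‖ ≤ 2 * h := by
  have key : ∀ x y : ℝ, 0 ≤ x → x ≤ h → 0 ≤ y → y ≤ h → ‖(!₂[x, y] : Ed 2)‖ ≤ 2 * h := by
    intro x y hx hx' hy hy'
    rw [EuclideanSpace.norm_eq, Real.sqrt_le_left (by linarith)]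
    simp only [Fin.sum_univ_two, Real.norm_eq_abs, sq_abs]
    change x ^ 2 + y ^ 2 ≤ _
    nlinarith
  have e : latPos h (triVert T i) - latPos h T.1 =
      !₂[h * ((triVert T i).1 - T.1.1), h * ((triVert T i).2 - T.1.2)] := by
    ext j; fin_cases j <;> simp [latPos] <;> ring
  rw [e]
  obtain ⟨⟨a, a'⟩, b⟩ := T
  cases b <;> fin_cases i <;> simp [triVert] <;> apply key <;> simp [hh]

lemma norm_triCross_sub_le (hh : 0 ≤ h) (hu : ∀ a, u a ≠ t) {T : Tri} {i : Fin 3}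
    (hs : triSgn u t T i ≠ triSgn u t T (i + 1)) :
    ‖triCross h u t T i - latPos h T.1‖ ≤ 2 * h := by
  have hconv := convex_closedBall (latPos h T.1) (2 * h)
  have hm : ∀ j, latPos h (triVert T j) ∈ Metric.closedBall (latPos h T.1) (2 * h) := fun j => by
    rw [mem_closedBall_iff_norm]; exact norm_latPos_triVert_sub_le hh T j
  rw [← mem_closedBall_iff_norm]
  refine hconv.add_smul_sub_mem (hm i) (hm (i + 1)) ?_
  simp only [triSgn, ne_eq, decide_eq_decide] at hs
  have h1 := hu (triVert T i)
  have h2 := hu (triVert T (i + 1))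
  rcases lt_or_gt_of_ne h1 with h3 | h3 <;> rcases lt_or_gt_of_ne h2 with h4 | h4
  · exact absurd ⟨fun h => by linarith, fun h => by linarith⟩ hs
  · exact ⟨div_nonneg (by linarith) (by linarith), by rw [div_le_one (by linarith)]; linarith⟩
  · exact ⟨div_nonneg_of_nonpos (by linarith) (by linarith), by
      rw [div_le_one_of_neg (by linarith)]; linarith⟩
  · exact absurd ⟨fun _ => h4, fun _ => h3⟩ hs

end Lattice

/-! ### Sums over level sets -/

lemma tsum_mul_sub_shift_le {c θ : ℤ × ℤ → ℝ} {e : ℤ × ℤ} {I : Finset (ℤ × ℤ)} {δ : ℝ}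
    (hI : ∀ a, a ∉ I → c a = 0 ∧ c (a - e) = 0) (hδ : ∀ a, |c a - c (a - e)| ≤ δ)
    (hθ : ∀ a, |θ a| ≤ 1) :
    Summable (fun a => c a * (θ a - θ (a + e))) ∧
      |∑' a, c a * (θ a - θ (a + e))| ≤ I.card * δ := by
  have hs1 : Summable fun a => c a * θ a :=
    summable_of_ne_finset_zero (s := I) fun a ha => by rw [(hI a ha).1, zero_mul]
  have hs2 : Summable fun a => c a * θ (a + e) :=
    summable_of_ne_finset_zero (s := I) fun a ha => by rw [(hI a ha).1, zero_mul]
  have hs3 : Summable fun a => c (a - e) * θ a :=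
    summable_of_ne_finset_zero (s := I) fun a ha => by rw [(hI a ha).2, zero_mul]
  have h1 : ∑' a, c a * θ (a + e) = ∑' a, c (a - e) * θ a := by
    rw [← (Equiv.addRight e).tsum_eq fun a => c (a - e) * θ a]
    simp
  have h2 : ∑' a, c a * (θ a - θ (a + e)) = ∑ a ∈ I, (c a - c (a - e)) * θ a := by
    simp only [mul_sub]
    rw [hs1.tsum_sub hs2, h1, ← hs1.tsum_sub hs3, tsum_eq_sum (s := I)]
    · simp only [sub_mul]
    · intro a ha; rw [(hI a ha).1, (hI a ha).2]; simp
  refine ⟨by simpa only [mul_sub] using hs1.sub hs2, ?_⟩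
  rw [h2]
  refine (Finset.abs_sum_le_sum_abs _ _).trans ?_
  rw [← nsmul_eq_mul]
  refine Finset.sum_le_card_nsmul _ _ _ fun a _ => ?_
  rw [abs_mul]
  calc _ ≤ δ * 1 := mul_le_mul (hδ a) (hθ a) (abs_nonneg _) ((abs_nonneg _).trans (hδ a))
    _ = δ := mul_one _

section LevelSet

variable {h t : ℝ} {u : ℤ × ℤ → ℝ}

lemma triSeg_add_triSeg_zero (a : ℤ × ℤ) :
    (triSeg h u t (a, false) + triSeg h u t (a, true)) 0 =
      h * (edgeFrac (u a) (u (a + (1, 0))) t -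
        edgeFrac (u (a + (0, 1))) (u (a + (0, 1) + (1, 0))) t) := by
  have h2' : (2:Fin 3) + 1 = 0 := rfl
  have h1' : (1:Fin 3) + 1 = 2 := rfl
  have h3 : a + (0, 1) + (1, 0) = a + (1, 1) := by ext <;> simp
  have h4 : edgeFrac (u (a + (0, 1))) (u (a + (1, 0))) t =
    edgeFrac (u (a + (1, 0))) (u (a + (0, 1))) t := edgeFrac_comm _ _ _
  have h5 : edgeFrac (u (a + (1, 1))) (u (a + (0, 1))) t =
    edgeFrac (u (a + (0, 1))) (u (a + (1, 1))) t := edgeFrac_comm _ _ _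
  simp only [triSeg, cutSeg, Fin.sum_univ_three, zero_add, h1', h2', triVert, latPos, h3]
  simp [h4, h5]
  ring

lemma triSeg_add_triSeg_one (a : ℤ × ℤ) :
    (triSeg h u t (a, false) + triSeg h u t (a, true)) 1 =
      -h * (edgeFrac (u a) (u (a + (0, 1))) t -
        edgeFrac (u (a + (1, 0))) (u (a + (1, 0) + (0, 1))) t) := by
  have h2' : (2:Fin 3) + 1 = 0 := rfl
  have h1' : (1:Fin 3) + 1 = 2 := rfl
  have h3 : a + (1, 0) + (0, 1) = a + (1, 1) := by ext <;> simp
  have h4 : edgeFrac (u (a + (0, 1))) (u (a + (1, 0))) t =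
    edgeFrac (u (a + (1, 0))) (u (a + (0, 1))) t := edgeFrac_comm _ _ _
  have h6 : edgeFrac (u (a + (0, 1))) (u a) t = edgeFrac (u a) (u (a + (0, 1))) t :=
    edgeFrac_comm _ _ _
  simp only [triSeg, cutSeg, Fin.sum_univ_three, zero_add, h1', h2', triVert, latPos, h3]
  simp [h4, h6]
  ring

lemma exists_finset_box (hh : 0 < h) (hh1 : h ≤ 1) {r : ℝ} (hr : 0 ≤ r) :
    ∃ I : Finset (ℤ × ℤ), (∀ a, a ∉ I → r + h < ‖latPos h a‖) ∧
      (I.card : ℝ) * h ^ 2 ≤ (2 * r + 3) ^ 2 := by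
  obtain ⟨J, hJ, hJc⟩ := exists_finset_int_box hh (ρ := r + h) (by linarith) 0
  refine ⟨J ×ˢ J, fun a ha => ?_, ?_⟩
  · by_contra hc
    rw [not_lt] at hc
    have h0 : |h * a.1| ≤ ‖latPos h a‖ := by
      have := PiLp.norm_apply_le (latPos h a) 0
      simpa [latPos] using this
    have h1 : |h * a.2| ≤ ‖latPos h a‖ := by
      have := PiLp.norm_apply_le (latPos h a) 1
      simpa [latPos] using this
    apply ha
    rw [Finset.mem_product]
    exact ⟨hJ _ (by rw [sub_zero]; linarith), hJ _ (by rw [sub_zero]; linarith)⟩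
  · have h1 : (J.card : ℝ) * h ≤ 2 * r + 3 := by
      have : (J.card : ℝ) * h ≤ (2 * (r + h) / h + 1) * h := by gcongr
      rw [add_mul, div_mul_cancel₀ _ hh.ne'] at this
      linarith
    rw [Finset.card_product]; push_cast
    have h2 : 0 ≤ (J.card : ℝ) * h := by positivity
    nlinarith

lemma tsum_inner_triSeg_le (hh : 0 < h) (hh1 : h ≤ 1) (hu : ∀ a, u a ≠ t) {Φ : Ed 2 → Ed 2}
    {K : ℝ≥0} (hΦ : LipschitzWith K Φ) {r : ℝ} (hr : 0 ≤ r) (hs : ∀ x, r < ‖x‖ → Φ x = 0) :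
    Summable (fun T : Tri => ⟪Φ (latPos h T.1), triSeg h u t T⟫) ∧
    ∑' T : Tri, ⟪Φ (latPos h T.1), triSeg h u t T⟫ ≤ 2 * K * (2 * r + 3) ^ 2 := by
  obtain ⟨I, hI, hIc⟩ := exists_finset_box hh hh1 hr
  have hz : ∀ a, a ∉ I → Φ (latPos h a) = 0 := fun a ha => hs _ (by linarith [hI a ha])
  have hsum : Summable (fun T : Tri => ⟪Φ (latPos h T.1), triSeg h u t T⟫) :=
    summable_of_ne_finset_zero (s := I ×ˢ Finset.univ) fun T hT => by
      rw [hz T.1 (by simpa using hT), inner_zero_left]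
  refine ⟨hsum, ?_⟩
  have hn : ∀ e : ℤ × ℤ, e = (0, 1) ∨ e = (1, 0) → ∀ a, ‖latPos h a - latPos h (a - e)‖ ≤ h := by
    have key : ∀ x y : ℝ, (x = h ∧ y = 0) ∨ (x = 0 ∧ y = h) → ‖(!₂[x, y] : Ed 2)‖ ≤ h := by
      intro x y hxy
      rw [EuclideanSpace.norm_eq, Real.sqrt_le_left hh.le]
      simp only [Fin.sum_univ_two, Real.norm_eq_abs, sq_abs]
      change x ^ 2 + y ^ 2 ≤ _
      rcases hxy with ⟨rfl, rfl⟩ | ⟨rfl, rfl⟩ <;> simp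
    intro e he a
    have : latPos h a - latPos h (a - e) = !₂[h * e.1, h * e.2] := by
      ext j; fin_cases j <;> simp [latPos] <;> ring
    rw [this]
    apply key
    rcases he with rfl | rfl <;> simp
  have hstep : ∀ e : ℤ × ℤ, e = (0, 1) ∨ e = (1, 0) → ∀ j : Fin 2, ∀ s : ℝ, |s| = h → ∀ a,
      |s * Φ (latPos h a) j - s * Φ (latPos h (a - e)) j| ≤ K * h ^ 2 := by
    intro e he j s hsh a
    have h1 : |Φ (latPos h a) j - Φ (latPos h (a - e)) j| ≤ K * h := by
      have h2 := PiLp.norm_apply_le (Φ (latPos h a) - Φ (latPos h (a - e))) j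
      have h3 := hΦ.dist_le_mul (latPos h a) (latPos h (a - e))
      rw [dist_eq_norm, dist_eq_norm] at h3
      have h4 : (K:ℝ) * ‖latPos h a - latPos h (a - e)‖ ≤ K * h := by gcongr; exact hn e he a
      exact (h2.trans h3).trans h4
    rw [← mul_sub, abs_mul, hsh]
    nlinarith
  have hsup : ∀ e : ℤ × ℤ, e = (0, 1) ∨ e = (1, 0) → ∀ j : Fin 2, ∀ s : ℝ, ∀ a, a ∉ I →
      s * Φ (latPos h a) j = 0 ∧ s * Φ (latPos h (a - e)) j = 0 := by
    intro e he j s a ha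
    have h1 : Φ (latPos h (a - e)) = 0 := hs _ (by
      have := norm_sub_norm_le (latPos h a) (latPos h (a - e))
      linarith [hn e he a, hI a ha])
    rw [hz a ha, h1]; simp
  obtain ⟨s1, b1⟩ := tsum_mul_sub_shift_le (c := fun a => h * Φ (latPos h a) 0) (e := (0, 1))
    (θ := fun a => edgeFrac (u a) (u (a + (1, 0))) t) (hsup _ (Or.inl rfl) 0 h)
    (hstep _ (Or.inl rfl) 0 h (abs_of_pos hh)) fun a => abs_edgeFrac_le (hu _) (hu _)
  obtain ⟨s2, b2⟩ := tsum_mul_sub_shift_le (c := fun a => -h * Φ (latPos h a) 1) (e := (1, 0))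
    (θ := fun a => edgeFrac (u a) (u (a + (0, 1))) t) (hsup _ (Or.inr rfl) 1 (-h))
    (hstep _ (Or.inr rfl) 1 (-h) (by rw [abs_neg, abs_of_pos hh])) fun a =>
      abs_edgeFrac_le (hu _) (hu _)
  have e : ∑' T : Tri, ⟪Φ (latPos h T.1), triSeg h u t T⟫ =
      (∑' a, h * Φ (latPos h a) 0 * (edgeFrac (u a) (u (a + (1, 0))) t -
        edgeFrac (u (a + (0, 1))) (u (a + (0, 1) + (1, 0))) t)) +
      ∑' a, -h * Φ (latPos h a) 1 * (edgeFrac (u a) (u (a + (0, 1))) t -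
        edgeFrac (u (a + (1, 0))) (u (a + (1, 0) + (0, 1))) t) := by
    rw [← s1.tsum_add s2, hsum.tsum_prod' fun a => (hasSum_fintype _).summable]
    refine tsum_congr fun a => ?_
    rw [tsum_fintype, Fintype.sum_bool, add_comm, ← inner_add_right, PiLp.inner_apply,
      Fin.sum_univ_two, triSeg_add_triSeg_zero, triSeg_add_triSeg_one]
    simp only [RCLike.inner_apply, conj_trivial]
    ring
  rw [e]
  have b3 : (I.card : ℝ) * (K * h ^ 2) ≤ K * (2 * r + 3) ^ 2 := by
    calc _ = K * (I.card * h ^ 2) := by ring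
      _ ≤ _ := by gcongr
  linarith [le_abs_self (∑' a, h * Φ (latPos h a) 0 * (edgeFrac (u a) (u (a + (1, 0))) t -
        edgeFrac (u (a + (0, 1))) (u (a + (0, 1) + (1, 0))) t)),
    le_abs_self (∑' a, -h * Φ (latPos h a) 1 * (edgeFrac (u a) (u (a + (0, 1))) t -
        edgeFrac (u (a + (1, 0))) (u (a + (1, 0) + (0, 1))) t))]

end LevelSet

lemma sum_range_increment_mul_le {H : ℕ → ℝ} (hH : Monotone H) {G : ℕ → ℝ} {L : ℝ}
    {k₀ K : ℕ} (hk : k₀ ≤ K) (h0 : ∀ k < k₀, G k ≤ 0) (hL : ∀ k, G k ≤ L) :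
    ∑ k ∈ Finset.range K, (H (k + 1) - H k) * G k ≤ (H K - H k₀) * L := by
  induction K, hk using Nat.le_induction with
  | base =>
    rw [sub_self, zero_mul]
    exact Finset.sum_nonpos fun k hk => mul_nonpos_of_nonneg_of_nonpos
      (sub_nonneg.2 (hH (Nat.le_succ k))) (h0 k (Finset.mem_range.1 hk))
  | succ K _ ih =>
    rw [Finset.sum_range_succ]
    have := mul_le_mul_of_nonneg_left (hL K) (sub_nonneg.2 (hH (Nat.le_succ K)))
    calc _ ≤ (H K - H k₀) * L + (H (K + 1) - H K) * L := add_le_add ih this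
      _ = _ := by ring

section LevelSet

variable {h t : ℝ} {u : ℤ × ℤ → ℝ}

lemma triCross_triNext (x : {T : Tri // Crossed u t T}) :
    triCross h u t (triNext u t x).1 (upIdx (triSgn u t (triNext u t x).1)) =
      triCross h u t x.1 (dnIdx (triSgn u t x.1)) := by
  change triCross h u t (triFlip x.1 (dnIdx (triSgn u t x.1)))
    (upIdx (triSgn u t (triFlip x.1 (dnIdx (triSgn u t x.1))))) = _
  rw [x.2.flip_dn.2]
  obtain ⟨h1, h2⟩ := dnIdx_spec _ x.2
  exact triCross_triFlip (by rw [h1, h2]; decide)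

/-- The sum of a tilted field along one closed level curve. -/
lemma orbit_sum_le (hh : 0 < h) (hh1 : h ≤ 1) (hu : ∀ a, u a ≠ t)
    {Φ : Ed 2 → Ed 2} (hΦ : Continuous Φ) {ψ : ℕ → Ed 2 → Ed 2} {H N r : ℕ → ℝ} {ω P : ℝ} {K : ℕ}
    (hH : Monotone H) (hHN : ∀ k < K, ∀ q ∈ loopSet (N k), loopPair q Φ ≤ H k)
    (hHK : ∀ x, ‖Φ x‖ ≤ H K) (hψ1 : ∀ k x, ‖ψ k x‖ ≤ 1)
    (hψs : ∀ k x, r k < ‖x‖ → ψ k x = 0) (hrN : ∀ k, r k + 2 ≤ N k)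
    (hω : ∀ x y, ‖x - y‖ ≤ 6 * h → ‖Φ x - Φ y‖ ≤ ω)
    (x : {T : Tri // Crossed u t T}) {n : ℕ} (hn : (triNext u t)^[n] x = x)
    (hP : ∑ i ∈ Finset.range n, ‖triSeg h u t ((triNext u t)^[i] x).1‖ ≤ P) :
    (∑ i ∈ Finset.range n, ⟪Φ (latPos h ((triNext u t)^[i] x).1.1),
      triSeg h u t ((triNext u t)^[i] x).1⟫) +
    ∑ k ∈ Finset.range K, (H (k + 1) - H k) * (if P ≤ N k then
      ∑ i ∈ Finset.range n, ⟪ψ k (latPos h ((triNext u t)^[i] x).1.1),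
        triSeg h u t ((triNext u t)^[i] x).1⟫ else 0) ≤
    (H K + ω) * ∑ i ∈ Finset.range n, ‖triSeg h u t ((triNext u t)^[i] x).1‖ := by
  classical
  set σ := triNext u t
  set S : ℕ → Ed 2 := fun i => triSeg h u t (σ^[i] x).1
  set a : ℕ → Ed 2 := fun i => latPos h (σ^[i] x).1.1
  set p : ℕ → Ed 2 := fun i => triCross h u t (σ^[i] x).1 (upIdx (triSgn u t (σ^[i] x).1))
  have hpS : ∀ i, p (i + 1) - p i = S i := fun i => by
    have : p (i + 1) = triCross h u t (σ^[i] x).1 (dnIdx (triSgn u t (σ^[i] x).1)) := by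
      simp only [p, Function.iterate_succ_apply']
      exact triCross_triNext _
    rw [this]
    exact (triSeg_eq hu (σ^[i] x).2).symm
  have hp1 : ∀ i, ‖p i - a i‖ ≤ 2 * h := fun i => by
    obtain ⟨h1, h2⟩ := upIdx_spec _ (σ^[i] x).2
    exact norm_triCross_sub_le hh.le hu (by rw [h1, h2]; decide)
  have hp2 : ∀ i, ‖p (i + 1) - a i‖ ≤ 2 * h := fun i => by
    obtain ⟨h1, h2⟩ := dnIdx_spec _ (σ^[i] x).2
    have : p (i + 1) = triCross h u t (σ^[i] x).1 (dnIdx (triSgn u t (σ^[i] x).1)) := by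
      simp only [p, Function.iterate_succ_apply']
      exact triCross_triNext _
    rw [this]
    exact norm_triCross_sub_le hh.le hu (by rw [h1, h2]; decide)
  have hclosed : p n = p 0 := by simp only [p, hn, Function.iterate_zero, id]
  have hZ : ∀ i < n, ∀ y, ‖y - p i‖ ≤ ‖p (i + 1) - p i‖ → ‖Φ y - Φ (a i)‖ ≤ ω := by
    intro i _ y hy
    apply hω
    have e1 : p (i + 1) - p i = (p (i + 1) - a i) - (p i - a i) := by abel
    have e2 : y - a i = (y - p i) + (p i - a i) := by abel
    have h1 : ‖p (i + 1) - p i‖ ≤ 4 * h := by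
      rw [e1]; linarith [norm_sub_le (p (i + 1) - a i) (p i - a i), hp1 i, hp2 i]
    rw [e2]
    linarith [norm_add_le (y - p i) (p i - a i), hp1 i]
  set L := ∑ i ∈ Finset.range n, ‖S i‖
  have hL0 : 0 ≤ L := Finset.sum_nonneg fun i _ => norm_nonneg _
  have hω0 : 0 ≤ ω := by
    have := hω 0 0 (by simp; linarith)
    exact (norm_nonneg _).trans this
  have hbound : ∀ (Ψ : Ed 2 → Ed 2) (B : ℝ), (∀ x, ‖Ψ x‖ ≤ B) →
      ∑ i ∈ Finset.range n, ⟪Ψ (a i), S i⟫ ≤ B * L := fun Ψ B hB => by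
    rw [Finset.mul_sum]
    exact Finset.sum_le_sum fun i _ => (real_inner_le_norm _ _).trans
      (mul_le_mul_of_nonneg_right (hB _) (norm_nonneg _))
  set G : ℕ → ℝ := fun k => if P ≤ N k then ∑ i ∈ Finset.range n, ⟪ψ k (a i), S i⟫ else 0
  have hGL : ∀ k, G k ≤ L := fun k => by
    simp only [G]
    split_ifs
    · simpa using hbound (ψ k) 1 (hψ1 k)
    · exact hL0
  change (∑ i ∈ Finset.range n, ⟪Φ (a i), S i⟫) + ∑ k ∈ Finset.range K, (H (k + 1) - H k) * G k ≤
    (H K + ω) * L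
  have hG0 : ∀ k, ¬ (L ≤ N k ∧ ∃ i < n, ‖p i‖ ≤ N k) → G k ≤ 0 := by
    intro k hk
    simp only [G]
    split_ifs with hPk
    · refine (Finset.sum_eq_zero fun i hi => ?_).le
      have hi' : N k < ‖p i‖ := by
        by_contra hc
        exact hk ⟨hP.trans hPk, i, Finset.mem_range.1 hi, not_lt.1 hc⟩
      rw [hψs k (a i), inner_zero_left]
      have := norm_sub_norm_le (p i) (a i)
      linarith [hp1 i, hrN k]
    · exact le_rfl
  obtain ⟨k₀, hk₀, hF, hlt⟩ : ∃ k₀ ≤ K, ∑ i ∈ Finset.range n, ⟪Φ (a i), S i⟫ ≤ (H k₀ + ω) * L ∧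
      ∀ k < k₀, ¬ (L ≤ N k ∧ ∃ i < n, ‖p i‖ ≤ N k) := by
    by_cases hex : ∃ k, k < K ∧ (L ≤ N k ∧ ∃ i < n, ‖p i‖ ≤ N k)
    · refine ⟨Nat.find hex, (Nat.find_spec hex).1.le, ?_, fun k hk hb =>
        Nat.find_min hex hk ⟨hk.trans (Nat.find_spec hex).1, hb⟩⟩
      obtain ⟨hK, hLN, i, hi, hpi⟩ := Nat.find_spec hex
      have := sum_inner_le_of_closed_chain hΦ (hHN _ hK) p (fun i => Φ (a i)) n hclosed hZ
        (by simpa only [hpS] using hLN) hi.le hpi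
      simpa only [hpS] using this
    · refine ⟨K, le_rfl, (hbound Φ _ hHK).trans ?_, fun k hk hb => hex ⟨k, hk, hb⟩⟩
      have := mul_nonneg hω0 hL0
      linarith
  have := sum_range_increment_mul_le hH hk₀ (fun k hk => hG0 k (hlt k hk)) hGL
  linarith

/-- The sum of a tilted field along a whole level set. -/
lemma tsum_inner_levelSet_le (hh : 0 < h) (hh1 : h ≤ 1) (hu : ∀ a, u a ≠ t)
    (hu0 : Tendsto u cofinite (nhds 0)) (ht : t ≠ 0)
    {Φ : Ed 2 → Ed 2} (hΦ : Continuous Φ) {ψ : ℕ → Ed 2 → Ed 2} {H N r : ℕ → ℝ} {Λ : ℕ → ℝ≥0}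
    {ω : ℝ} {K : ℕ}
    (hH : Monotone H) (hHN : ∀ k < K, ∀ q ∈ loopSet (N k), loopPair q Φ ≤ H k)
    (hHK : ∀ x, ‖Φ x‖ ≤ H K) (hψ1 : ∀ k x, ‖ψ k x‖ ≤ 1) (hψL : ∀ k, LipschitzWith (Λ k) (ψ k))
    (hr : ∀ k, 0 ≤ r k) (hψs : ∀ k x, r k < ‖x‖ → ψ k x = 0) (hrN : ∀ k, r k + 2 ≤ N k)
    (hω : ∀ x y, ‖x - y‖ ≤ 6 * h → ‖Φ x - Φ y‖ ≤ ω) :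
    ∑' T : Tri, ⟪Φ (latPos h T.1) +
      ∑ k ∈ Finset.range K, (H (k + 1) - H k) • ψ k (latPos h T.1), triSeg h u t T⟫ ≤
    (H K + ∑ k ∈ Finset.range K, (H (k + 1) - H k) * (2 * Λ k * (2 * r k + 3) ^ 2 / N k) + ω) *
      ∑' T : Tri, ‖triSeg h u t T‖ := by
  classical
  have : Fintype {T : Tri // Crossed u t T} := (finite_crossed hu0 ht).fintype
  have hsub : ∀ f : Tri → ℝ, (∀ T, triSeg h u t T = 0 → f T = 0) →
      ∑' T, f T = ∑ x : {T : Tri // Crossed u t T}, f x.1 := by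
    intro f hf
    have h1 := tsum_subtype {T : Tri | Crossed u t T} f
    have h2 : ({T : Tri | Crossed u t T}).indicator f = f := by
      rw [Set.indicator_eq_self]
      intro T hT
      by_contra hc
      exact hT (hf T (triSeg_eq_zero hu hc))
    rw [h2] at h1
    rw [← h1]
    change ∑' x : {T : Tri // Crossed u t T}, f x.1 = _
    exact tsum_fintype _
  set P := ∑ x : {T : Tri // Crossed u t T}, ‖triSeg h u t x.1‖
  have hP0 : 0 ≤ P := Finset.sum_nonneg fun i _ => norm_nonneg _
  rw [hsub _ fun T hT => by rw [hT, inner_zero_right], hsub _ fun T hT => by rw [hT, norm_zero]]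
  have key : 0 ≤ ∑ x : {T : Tri // Crossed u t T}, ((H K + ω) * ‖triSeg h u t x.1‖ -
      ⟪Φ (latPos h x.1.1), triSeg h u t x.1⟫ - ∑ k ∈ Finset.range K, (H (k + 1) - H k) *
        (if P ≤ N k then ⟪ψ k (latPos h x.1.1), triSeg h u t x.1⟫ else 0)) := by
    refine sum_nonneg_of_orbit_sum_nonneg (triNext u t) fun x => ?_
    have h1 := orbit_sum_le hh hh1 hu hΦ hH hHN hHK hψ1 hψs hrN hω x
      (Function.iterate_minimalPeriod (f := triNext u t)) (P := P)
      (orbit_sum_le_sum (triNext u t) (g := fun x => ‖triSeg h u t x.1‖)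
        (fun _ => norm_nonneg _) x)
    rw [Finset.sum_sub_distrib, Finset.sum_sub_distrib, Finset.sum_comm, ← Finset.mul_sum]
    have h2 : ∀ k, ∑ i ∈ Finset.range (Function.minimalPeriod (triNext u t) x),
        (H (k + 1) - H k) * (if P ≤ N k then ⟪ψ k (latPos h ((triNext u t)^[i] x).1.1),
          triSeg h u t ((triNext u t)^[i] x).1⟫ else 0) = (H (k + 1) - H k) * (if P ≤ N k then
        ∑ i ∈ Finset.range (Function.minimalPeriod (triNext u t) x),
        ⟪ψ k (latPos h ((triNext u t)^[i] x).1.1),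
          triSeg h u t ((triNext u t)^[i] x).1⟫ else 0) := fun k => by
      rw [← Finset.mul_sum]
      split_ifs <;> simp
    simp only [h2]
    linarith
  rw [Finset.sum_sub_distrib, Finset.sum_sub_distrib, Finset.sum_comm, ← Finset.mul_sum] at key
  have hk : ∀ k, ∑ x : {T : Tri // Crossed u t T}, (H (k + 1) - H k) *
      ⟪ψ k (latPos h x.1.1), triSeg h u t x.1⟫ ≤
      ∑ x : {T : Tri // Crossed u t T}, (H (k + 1) - H k) *
        (if P ≤ N k then ⟪ψ k (latPos h x.1.1), triSeg h u t x.1⟫ else 0) +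
      (H (k + 1) - H k) * (2 * Λ k * (2 * r k + 3) ^ 2 / N k) * P := by
    intro k
    have hN0 : 0 < N k := by linarith [hr k, hrN k]
    have hd : 0 ≤ H (k + 1) - H k := sub_nonneg.2 (hH (Nat.le_succ k))
    rw [← Finset.mul_sum, ← Finset.mul_sum, mul_assoc, ← mul_add]
    refine mul_le_mul_of_nonneg_left ?_ hd
    split_ifs with hPk
    · have : 0 ≤ 2 * Λ k * (2 * r k + 3) ^ 2 / N k * P := by positivity
      linarith
    · have h1 := (tsum_inner_triSeg_le hh hh1 hu (hψL k) (hr k) (hψs k)).2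
      rw [hsub _ fun T hT => by rw [hT, inner_zero_right]] at h1
      rw [Finset.sum_const_zero, zero_add]
      refine h1.trans ?_
      rw [div_mul_eq_mul_div, le_div_iff₀ hN0]
      have : 0 ≤ 2 * (Λ k : ℝ) * (2 * r k + 3) ^ 2 := by positivity
      exact mul_le_mul_of_nonneg_left (not_le.1 hPk).le this
  have hk' := Finset.sum_le_sum fun k (_ : k ∈ Finset.range K) => hk k
  rw [Finset.sum_add_distrib, ← Finset.sum_mul] at hk'
  simp only [inner_add_left, sum_inner, real_inner_smul_left, Finset.sum_add_distrib]
  rw [Finset.sum_comm (s := Finset.univ)]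
  linarith

end LevelSet

/-! ### Integration over the levels -/

section Coarea

variable {ι : Type*} [Countable ι] {F : ι → ℝ → Ed 2}

lemma tsum_inner_integral_le (hF : ∀ i, Integrable (F i)) {Ψ : ι → Ed 2} {I : Finset ι}
    (hI : ∀ i ∉ I, Ψ i = 0) {C : ℝ} (hC : 0 ≤ C) (hs : Summable fun i => ∫ t, ‖F i t‖)
    (hle : ∀ᵐ t, ∑' i, ⟪Ψ i, F i t⟫ ≤ C * ∑' i, ‖F i t‖) :
    ∑' i, ⟪Ψ i, ∫ t, F i t⟫ ≤ C * ∑' i, ∫ t, ‖F i t‖ := by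
  have e1 : ∀ t, ∑' i, ⟪Ψ i, F i t⟫ = ∑ i ∈ I, ⟪Ψ i, F i t⟫ := fun t =>
    tsum_eq_sum fun i hi => by rw [hI i hi, inner_zero_left]
  have e2 : ∑' i, ⟪Ψ i, ∫ t, F i t⟫ = ∫ t, ∑ i ∈ I, ⟪Ψ i, F i t⟫ := by
    rw [tsum_eq_sum (s := I) fun i hi => by rw [hI i hi, inner_zero_left],
      integral_finsetSum _ fun i _ => (hF i).const_inner (Ψ i)]
    exact Finset.sum_congr rfl fun i _ => (integral_inner (hF i) _).symm
  have hg : Integrable fun t => ∑ i ∈ I, ⟪Ψ i, F i t⟫ :=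
    integrable_finsetSum _ fun i _ => (hF i).const_inner (Ψ i)
  rw [e2]
  calc ∫ t, ∑ i ∈ I, ⟪Ψ i, F i t⟫ ≤ ∫ t, max (∑ i ∈ I, ⟪Ψ i, F i t⟫) 0 :=
        integral_mono hg hg.pos_part fun t => le_max_left _ _
    _ = (∫⁻ t, ENNReal.ofReal (max (∑ i ∈ I, ⟪Ψ i, F i t⟫) 0)).toReal :=
        integral_eq_lintegral_of_nonneg_ae (ae_of_all _ fun t => le_max_right _ _) hg.pos_part.1
    _ ≤ (ENNReal.ofReal C * ∑' i, ENNReal.ofReal (∫ t, ‖F i t‖)).toReal := by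
        refine ENNReal.toReal_mono ?_ ?_
        · rw [← ENNReal.ofReal_tsum_of_nonneg
            (fun i => integral_nonneg fun t => norm_nonneg _) hs]
          exact ENNReal.mul_ne_top ENNReal.ofReal_ne_top ENNReal.ofReal_ne_top
        · calc ∫⁻ t, ENNReal.ofReal (max (∑ i ∈ I, ⟪Ψ i, F i t⟫) 0)
              ≤ ∫⁻ t, ENNReal.ofReal C * ∑' i, ENNReal.ofReal ‖F i t‖ := by
                refine lintegral_mono_ae ?_
                filter_upwards [hle] with t ht
                rw [e1] at ht
                by_cases hsum : Summable fun i => ‖F i t‖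
                · rw [← ENNReal.ofReal_tsum_of_nonneg (fun i => norm_nonneg _) hsum,
                    ← ENNReal.ofReal_mul hC]
                  exact ENNReal.ofReal_le_ofReal (max_le ht (by positivity))
                · rw [tsum_eq_zero_of_not_summable hsum, mul_zero] at ht
                  rw [max_eq_right ht, ENNReal.ofReal_zero]
                  exact zero_le
            _ = _ := by
                rw [lintegral_const_mul' _ _ ENNReal.ofReal_ne_top, lintegral_tsum fun i =>
                  (hF i).norm.1.aemeasurable.ennreal_ofReal]
                congr 2
                ext1 i
                rw [ofReal_integral_eq_lintegral_ofReal (hF i).norm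
                  (ae_of_all _ fun t => norm_nonneg _)]
    _ = C * ∑' i, ∫ t, ‖F i t‖ := by
        rw [← ENNReal.ofReal_tsum_of_nonneg (fun i => integral_nonneg fun t => norm_nonneg _) hs,
          ENNReal.toReal_mul, ENNReal.toReal_ofReal hC, ENNReal.toReal_ofReal]
        exact tsum_nonneg fun i => integral_nonneg fun t => norm_nonneg _

end Coarea

lemma tsum_inner_triGrad_le {h : ℝ} {u : ℤ × ℤ → ℝ} (hh : 0 < h) (hh1 : h ≤ 1)
    (hu0 : Tendsto u cofinite (nhds 0)) (hus : Summable fun T : Tri => ‖triGrad h u T‖)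
    {Φ : Ed 2 → Ed 2} (hΦ : Continuous Φ) {R : ℝ} (hR : 0 ≤ R) (hΦs : ∀ x, R < ‖x‖ → Φ x = 0)
    {ψ : ℕ → Ed 2 → Ed 2} {H N r : ℕ → ℝ} {Λ : ℕ → ℝ≥0} {ω : ℝ} {K : ℕ}
    (hH : Monotone H) (hHN : ∀ k < K, ∀ q ∈ loopSet (N k), loopPair q Φ ≤ H k)
    (hHK : ∀ x, ‖Φ x‖ ≤ H K) (hψ1 : ∀ k x, ‖ψ k x‖ ≤ 1) (hψL : ∀ k, LipschitzWith (Λ k) (ψ k))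
    (hr : ∀ k, 0 ≤ r k) (hψs : ∀ k x, r k < ‖x‖ → ψ k x = 0) (hrN : ∀ k, r k + 2 ≤ N k)
    (hω : ∀ x y, ‖x - y‖ ≤ 6 * h → ‖Φ x - Φ y‖ ≤ ω) :
    ∑' T : Tri, ⟪Φ (latPos h T.1) +
      ∑ k ∈ Finset.range K, (H (k + 1) - H k) • ψ k (latPos h T.1), triGrad h u T⟫ ≤
    (H K + ∑ k ∈ Finset.range K, (H (k + 1) - H k) * (2 * Λ k * (2 * r k + 3) ^ 2 / N k) + ω) *
      ∑' T : Tri, ‖triGrad h u T‖ := by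
  set R' := R + ∑ k ∈ Finset.range K, r k
  have hR0 : 0 ≤ ∑ k ∈ Finset.range K, r k := Finset.sum_nonneg fun k _ => hr k
  obtain ⟨I, hI, -⟩ := exists_finset_box hh hh1 (r := R') (by positivity)
  have hω0 : 0 ≤ ω := (norm_nonneg _).trans (hω 0 0 (by simp; linarith))
  have hHK0 : 0 ≤ H K := (norm_nonneg _).trans (hHK 0)
  have hsum0 : 0 ≤ ∑ k ∈ Finset.range K,
      (H (k + 1) - H k) * (2 * Λ k * (2 * r k + 3) ^ 2 / N k) :=
    Finset.sum_nonneg fun k _ => mul_nonneg (sub_nonneg.2 (hH (Nat.le_succ k)))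
      (div_nonneg (by positivity) (by linarith [hr k, hrN k]))
  have e1 : ∀ T : Tri, ∫ t, triSeg h u t T = triGrad h u T := fun T => integral_cutSeg _ _
  have e2 : ∀ T : Tri, ∫ t, ‖triSeg h u t T‖ = ‖triGrad h u T‖ := fun T =>
    integral_norm_cutSeg _ _
  simp only [← e2] at hus
  have main := tsum_inner_integral_le (F := fun (T : Tri) t => triSeg h u t T)
    (Ψ := fun T => Φ (latPos h T.1) +
      ∑ k ∈ Finset.range K, (H (k + 1) - H k) • ψ k (latPos h T.1))
    (I := I ×ˢ Finset.univ) (fun T => integrable_cutSeg _ _) ?_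
    (C := H K + ∑ k ∈ Finset.range K,
      (H (k + 1) - H k) * (2 * Λ k * (2 * r k + 3) ^ 2 / N k) + ω) (by positivity) hus ?_
  · simpa only [e1, e2] using main
  · intro T hT
    have h1 := hI T.1 (by simpa using hT)
    rw [hΦs _ (by linarith), zero_add]
    refine Finset.sum_eq_zero fun k hk => ?_
    have := Finset.single_le_sum (f := r) (fun k _ => hr k) hk
    rw [hψs k _ (by linarith), smul_zero]
  · have hne : ∀ᵐ t : ℝ, ∀ a, u a ≠ t := by
      filter_upwards [(Set.countable_range u).ae_notMem volume] with t ht a ha using ht ⟨a, ha⟩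
    have h0 : ∀ᵐ t : ℝ, t ≠ 0 := by
      filter_upwards [(Set.countable_singleton (0:ℝ)).ae_notMem volume] with t ht using ht
    filter_upwards [hne, h0] with t ht ht0
    exact tsum_inner_levelSet_le hh hh1 ht hu0 ht0 hΦ hH hHN hHK hψ1 hψL hr hψs hrN hω

/-! ### Smooth steps -/

/-- A smooth step from `0` to `1` with transition in `[-ε, ε]`, together with its derivative. -/
structure SmoothStep (ε : ℝ) where
  B : ℝ → ℝ
  β : ℝ → ℝ
  contDiff : ContDiff ℝ (⊤ : ℕ∞) B
  hasDerivAt : ∀ s, HasDerivAt B (β s) s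
  mono : Monotone B
  eq_zero : ∀ s ≤ -ε, B s = 0
  eq_one : ∀ s, ε ≤ s → B s = 1
  M : ℝ≥0
  lipschitz : LipschitzWith M β

lemma exists_smoothStep {ε : ℝ} (hε : 0 < ε) : Nonempty (SmoothStep ε) := by
  set B : ℝ → ℝ := fun s => Real.smoothTransition ((s + ε) / (2 * ε))
  have hB : ContDiff ℝ (⊤ : ℕ∞) B := Real.smoothTransition.contDiff.comp (by fun_prop)
  have h0 : ∀ s ≤ -ε, B s = 0 := fun s hs =>
    Real.smoothTransition.zero_of_nonpos (div_nonpos_of_nonpos_of_nonneg (by linarith)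
      (by linarith))
  have h1 : ∀ s, ε ≤ s → B s = 1 := fun s hs =>
    Real.smoothTransition.one_of_one_le (by rw [le_div_iff₀ (by linarith)]; linarith)
  have hd : ContDiff ℝ 1 (deriv B) := by
    exact ContDiff.iterate_deriv' 1 1 (contDiff_infty.1 hB (1 + 1))
  have hcs : HasCompactSupport (deriv B) := by
    refine HasCompactSupport.intro (isCompact_Icc (a := -ε) (b := ε)) fun s hs => ?_
    rw [Set.mem_Icc, not_and_or, not_le, not_le] at hs
    rcases hs with hs | hs
    · have : B =ᶠ[nhds s] fun _ => 0 := by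
        filter_upwards [gt_mem_nhds hs] with y hy using h0 y hy.le
      rw [this.deriv_eq, deriv_const]
    · have : B =ᶠ[nhds s] fun _ => 1 := by
        filter_upwards [lt_mem_nhds hs] with y hy using h1 y hy.le
      rw [this.deriv_eq, deriv_const]
  obtain ⟨M, hM⟩ := ContDiff.lipschitzWith_of_hasCompactSupport hcs hd one_ne_zero
  exact ⟨⟨B, deriv B, hB, fun s => (hB.differentiable (by simp) s).hasDerivAt, fun x y hxy =>
    Real.smoothTransition.monotone (by gcongr), h0, h1, M, hM⟩⟩

namespace SmoothStep

variable {ε : ℝ} (S : SmoothStep ε)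

lemma nonneg (s : ℝ) : 0 ≤ S.B s := by
  rcases le_total s (-ε) with h | h
  · rw [S.eq_zero s h]
  · rw [← S.eq_zero (-ε) le_rfl]; exact S.mono h

lemma le_one (s : ℝ) : S.B s ≤ 1 := by
  rcases le_total s ε with h | h
  · rw [← S.eq_one ε le_rfl]; exact S.mono h
  · rw [S.eq_one s h]

lemma abs_le_one (s : ℝ) : |S.B s| ≤ 1 := by
  rw [abs_of_nonneg (S.nonneg s)]; exact S.le_one s

lemma continuous : Continuous S.B := S.contDiff.continuous

lemma continuous_β : Continuous S.β := S.lipschitz.continuous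

lemma β_nonneg (s : ℝ) : 0 ≤ S.β s := by
  rw [← (S.hasDerivAt s).deriv]; exact S.mono.deriv_nonneg

lemma β_eq_zero {s : ℝ} (hs : ε < |s|) : S.β s = 0 := by
  rw [← (S.hasDerivAt s).deriv]
  rcases lt_abs.1 hs with h | h
  · have : S.B =ᶠ[nhds s] fun _ => 1 := by
      filter_upwards [lt_mem_nhds h] with y hy using S.eq_one y hy.le
    rw [this.deriv_eq, deriv_const]
  · have : S.B =ᶠ[nhds s] fun _ => 0 := by
      filter_upwards [gt_mem_nhds (show s < -ε by linarith)] with y hy using S.eq_zero y hy.le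
    rw [this.deriv_eq, deriv_const]

lemma β_le (hε : 0 < ε) (s : ℝ) : S.β s ≤ S.M * (3 * ε) := by
  by_cases hs : ε < |s|
  · rw [S.β_eq_zero hs]; positivity
  · have h1 := S.lipschitz.dist_le_mul s (2 * ε)
    rw [S.β_eq_zero (s := 2 * ε) (by rw [abs_of_pos (by linarith)]; linarith), Real.dist_eq,
      sub_zero, abs_of_nonneg (S.β_nonneg s), Real.dist_eq] at h1
    obtain ⟨h2, h3⟩ := abs_le.1 (not_lt.1 hs)
    refine h1.trans (mul_le_mul_of_nonneg_left ?_ S.M.2)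
    rw [abs_le]; constructor <;> linarith

variable (h : ℝ) (j : ℤ) (s : ℝ)

/-- The increment of the step over a mesh interval. -/
def inc : ℝ := S.B (h * (j + 1) - s) - S.B (h * j - s)

lemma continuous_inc : Continuous (S.inc h j) := by
  have := S.continuous
  unfold inc
  fun_prop

variable {h} in
lemma inc_nonneg (hh : 0 ≤ h) : 0 ≤ S.inc h j s := sub_nonneg.2 (S.mono (by linarith))

variable {h} in
lemma inc_eq_zero (hh : 0 ≤ h) (hs : ε + h < |h * j - s|) : S.inc h j s = 0 := by
  unfold inc
  rcases lt_abs.1 hs with h1 | h1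
  · rw [S.eq_one _ (by linarith), S.eq_one _ (by linarith), sub_self]
  · rw [S.eq_zero _ (by linarith), S.eq_zero _ (by linarith), sub_self]

variable {h} in
lemma exists_sum_inc_eq_one (hh : 0 < h) (I : Finset ℤ) :
    ∃ J, I ⊆ J ∧ ∑ j ∈ J, S.inc h j s = 1 := by
  classical
  obtain ⟨n, hn⟩ := exists_nat_gt ((ε + |s|) / h + ∑ j ∈ I, |(j:ℝ)|)
  have hpos : 0 ≤ ∑ j ∈ I, |(j:ℝ)| := Finset.sum_nonneg fun j _ => abs_nonneg _
  have h1 : ε + |s| < h * n := by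
    rw [← div_lt_iff₀' hh]; linarith
  rcases lt_or_ge (ε + |s|) 0 with hneg | hneg
  · exfalso
    have h2 := S.eq_one ε le_rfl
    rw [S.eq_zero ε (by linarith [abs_nonneg s])] at h2
    exact zero_ne_one h2
  have h0 : 0 ≤ (ε + |s|) / h := div_nonneg hneg hh.le
  refine ⟨(Finset.range (2 * n)).image fun i : ℕ => (i:ℤ) - n, fun j hj => ?_, ?_⟩
  · have h2 := Finset.single_le_sum (f := fun j : ℤ => |(j:ℝ)|) (fun j _ => abs_nonneg _) hj
    obtain ⟨h3, h4⟩ := abs_lt.1 (lt_of_le_of_lt h2 (by linarith : _ < (n:ℝ)))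
    have h3' : -(n:ℤ) < j := by exact_mod_cast h3
    have h4' : j < n := by exact_mod_cast h4
    rw [Finset.mem_image]
    exact ⟨(j + n).toNat, by rw [Finset.mem_range]; omega, by omega⟩
  · rw [Finset.sum_image (fun i _ i' _ e => by simpa using e)]
    have e : ∀ i : ℕ, S.inc h ((i:ℤ) - n) s =
        S.B (h * ((i + 1 : ℕ) - n) - s) - S.B (h * (i - n) - s) := by
      intro i
      simp only [inc]
      push_cast
      congr 3; ring
    rw [Finset.sum_congr rfl fun i _ => e i,
      Finset.sum_range_sub fun i : ℕ => S.B (h * (i - n) - s)]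
    rw [S.eq_one, S.eq_zero, sub_zero]
    · push_cast; nlinarith [neg_abs_le s]
    · push_cast; nlinarith [le_abs_self s]

variable {h} in
lemma sum_inc_le_one (hh : 0 < h) (I : Finset ℤ) : ∑ j ∈ I, S.inc h j s ≤ 1 := by
  obtain ⟨J, hIJ, hJ⟩ := S.exists_sum_inc_eq_one s hh I
  rw [← hJ]
  exact Finset.sum_le_sum_of_subset_of_nonneg hIJ fun j _ _ => S.inc_nonneg j s hh.le

variable {h} in
lemma sum_β_le (hε : 0 < ε) (hh : 0 < h) (I : Finset ℤ) :
    ∑ j ∈ I, S.β (h * j - s) ≤ S.M * (3 * ε) * (2 * ε / h + 1) := by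
  obtain ⟨J, hJ, hJc⟩ := exists_finset_int_box hh hε.le s
  have h1 : ∑ j ∈ I, S.β (h * j - s) = ∑ j ∈ I with j ∈ J, S.β (h * j - s) := by
    rw [Finset.sum_filter]
    refine Finset.sum_congr rfl fun j _ => ?_
    split_ifs with hj
    · rfl
    · exact S.β_eq_zero (not_le.1 fun hc => hj (hJ j hc))
  have h2 : (({j ∈ I | j ∈ J} : Finset ℤ).card : ℝ) ≤ 2 * ε / h + 1 := by
    refine le_trans ?_ hJc
    exact_mod_cast Finset.card_le_card fun j hj => (Finset.mem_filter.1 hj).2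
  rw [h1]
  calc _ ≤ ({j ∈ I | j ∈ J} : Finset ℤ).card • ((S.M : ℝ) * (3 * ε)) :=
        Finset.sum_le_card_nsmul _ _ _ fun j _ => S.β_le hε _
    _ ≤ _ := by
        rw [nsmul_eq_mul, mul_comm]
        gcongr

/-- The error of replacing an increment by a derivative at `h * (j + c)`. -/
def incErr (c : ℝ) : ℝ := h * S.β (h * (j + c) - s) - S.inc h j s

lemma continuous_incErr (c : ℝ) : Continuous (S.incErr h j · c) := by
  have := S.continuous_β
  have := S.continuous_inc h j
  unfold incErr
  fun_prop

variable {h} in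
lemma abs_incErr_le (hh : 0 < h) {c : ℝ} (hc0 : 0 ≤ c) (hc1 : c ≤ 1) :
    |S.incErr h j s c| ≤ S.M * h ^ 2 := by
  obtain ⟨ξ, hξ, e⟩ := exists_hasDerivAt_eq_slope S.B S.β
    (show h * j - s < h * (j + 1) - s by linarith) S.continuous.continuousOn
    fun x _ => S.hasDerivAt x
  have e1 : h * (j + 1) - s - (h * j - s) = h := by ring
  rw [e1, eq_div_iff hh.ne'] at e
  rw [incErr, inc, ← e, mul_comm (S.β ξ), ← mul_sub, abs_mul, abs_of_pos hh]
  have h1 := S.lipschitz.dist_le_mul (h * (j + c) - s) ξ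
  rw [Real.dist_eq, Real.dist_eq] at h1
  have h2 : |h * (j + c) - s - ξ| ≤ h := by
    have := mul_nonneg hh.le hc0
    have := mul_le_mul_of_nonneg_left hc1 hh.le
    rw [abs_le]; constructor <;> nlinarith [hξ.1, hξ.2]
  have h3 : (S.M:ℝ) * |h * (j + c) - s - ξ| ≤ S.M * h := mul_le_mul_of_nonneg_left h2 S.M.2
  nlinarith

variable {h} in
lemma incErr_eq_zero (hh : 0 < h) {c : ℝ} (hc0 : 0 ≤ c) (hc1 : c ≤ 1)
    (hs : ε + h < |h * j - s|) : S.incErr h j s c = 0 := by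
  rw [incErr, S.inc_eq_zero j s hh.le hs, S.β_eq_zero, mul_zero, sub_zero]
  have := mul_nonneg hh.le hc0
  have := mul_le_mul_of_nonneg_left hc1 hh.le
  rw [lt_abs] at hs ⊢
  rcases hs with hs | hs
  · left; linarith
  · right; linarith

variable {h} in
lemma sum_abs_incErr_le (hε : 0 < ε) (hh : 0 < h) (hh1 : h ≤ 1) {c : ℝ} (hc0 : 0 ≤ c)
    (hc1 : c ≤ 1) (I : Finset ℤ) :
    ∑ j ∈ I, |S.incErr h j s c| ≤ S.M * (2 * ε + 3) * h := by
  obtain ⟨J, hJ, hJc⟩ := exists_finset_int_box hh (ρ := ε + h) (by linarith) s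
  have h1 : ∑ j ∈ I, |S.incErr h j s c| = ∑ j ∈ I with j ∈ J, |S.incErr h j s c| := by
    rw [Finset.sum_filter]
    refine Finset.sum_congr rfl fun j _ => ?_
    split_ifs with hj
    · rfl
    · rw [S.incErr_eq_zero j s hh hc0 hc1 (not_le.1 fun hc => hj (hJ j hc)), abs_zero]
  have h2 : (({j ∈ I | j ∈ J} : Finset ℤ).card : ℝ) ≤ 2 * (ε + h) / h + 1 := by
    refine le_trans ?_ hJc
    exact_mod_cast Finset.card_le_card fun j hj => (Finset.mem_filter.1 hj).2
  rw [h1]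
  calc _ ≤ ({j ∈ I | j ∈ J} : Finset ℤ).card • ((S.M : ℝ) * h ^ 2) :=
        Finset.sum_le_card_nsmul _ _ _ fun j _ => S.abs_incErr_le j s hh hc0 hc1
    _ ≤ (2 * (ε + h) / h + 1) * (S.M * h ^ 2) := by
        rw [nsmul_eq_mul]; gcongr
    _ = S.M * (2 * (ε + h) + h) * h := by field_simp
    _ ≤ _ := by
        have : 2 * (ε + h) + h ≤ 2 * ε + 3 := by linarith
        gcongr

end SmoothStep

/-! ### The stream function on a lattice -/

section Stream

variable {σ : Measure (Ed 2)} {τ : Ed 2 → Ed 2}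

lemma aestronglyMeasurable_fderiv_apply (hτ : Measurable τ) {φ : Ed 2 → ℝ}
    (hφ : ContDiff ℝ (⊤ : ℕ∞) φ) : AEStronglyMeasurable (fun x => fderiv ℝ φ x (τ x)) σ := by
  have h1 : StronglyMeasurable (fderiv ℝ φ) :=
    (hφ.continuous_fderiv (by simp)).stronglyMeasurable
  exact (isBoundedBilinearMap_apply.continuous.comp_stronglyMeasurable
    (h1.prodMk hτ.stronglyMeasurable)).aestronglyMeasurable

variable [IsProbabilityMeasure σ]

lemma integral_fderiv_eq_zero_of_bounded (hτ : Measurable τ) (hτ1 : ∀ x, ‖τ x‖ ≤ 1)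
    (hdiv : ∀ φ : Ed 2 → ℝ, ContDiff ℝ (⊤ : ℕ∞) φ → HasCompactSupport φ →
      ∫ x, fderiv ℝ φ x (τ x) ∂σ = 0)
    {φ : Ed 2 → ℝ} (hφ : ContDiff ℝ (⊤ : ℕ∞) φ) {C₀ C₁ : ℝ} (h0 : ∀ x, ‖φ x‖ ≤ C₀)
    (h1 : ∀ x, ‖fderiv ℝ φ x‖ ≤ C₁) : ∫ x, fderiv ℝ φ x (τ x) ∂σ = 0 := by
  set f : ContDiffBump (0 : Ed 2) := ⟨1, 2, one_pos, one_lt_two⟩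
  have hfc : ContDiff ℝ (⊤ : ℕ∞) f := f.contDiff
  have hfd : Differentiable ℝ f := hfc.differentiable (by simp)
  obtain ⟨C, hC⟩ := (f.hasCompactSupport.fderiv ℝ).exists_bound_of_continuous
    (hfc.continuous_fderiv (by simp))
  set c : ℕ → ℝ := fun n => 1 / ((n : ℝ) + 1)
  have hc0 : ∀ n, 0 < c n := fun n => by positivity
  have hc1 : ∀ n, c n ≤ 1 := fun n => by
    simp only [c]; rw [div_le_one (by positivity)]; linarith [(Nat.cast_nonneg n : (0:ℝ) ≤ n)]
  have hct : Tendsto c atTop (nhds 0) := tendsto_one_div_add_atTop_nhds_zero_nat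
  set χ : ℕ → Ed 2 → ℝ := fun n x => f (c n • x)
  have hχc : ∀ n, ContDiff ℝ (⊤ : ℕ∞) (χ n) := fun n => hfc.comp (contDiff_const_smul _)
  have hχd : ∀ n x, fderiv ℝ (χ n) x = c n • fderiv ℝ f (c n • x) := fun n x =>
    fderiv_comp_smul (c n)
  have hF : ∀ n x, fderiv ℝ (fun y => χ n y * φ y) x (τ x) =
      χ n x * fderiv ℝ φ x (τ x) + φ x * (c n * fderiv ℝ f (c n • x) (τ x)) := fun n x => by
    rw [fderiv_fun_mul ((hχc n).differentiable (by simp) x) (hφ.differentiable (by simp) x), hχd]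
    simp
  have hbd : ∀ n x, ‖fderiv ℝ (fun y => χ n y * φ y) x (τ x)‖ ≤ C₁ + C₀ * C := fun n x => by
    have b1 : ‖fderiv ℝ φ x (τ x)‖ ≤ C₁ := by
      refine (ContinuousLinearMap.le_opNorm _ _).trans ?_
      have := mul_le_mul (h1 x) (hτ1 x) (norm_nonneg _) ((norm_nonneg _).trans (h1 x))
      linarith
    have b2 : ‖fderiv ℝ f (c n • x) (τ x)‖ ≤ C := by
      refine (ContinuousLinearMap.le_opNorm _ _).trans ?_
      have := mul_le_mul (hC (c n • x)) (hτ1 x) (norm_nonneg _)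
        ((norm_nonneg _).trans (hC 0))
      linarith
    have b3 : ‖χ n x‖ ≤ 1 := by
      rw [Real.norm_of_nonneg f.nonneg]; exact f.le_one
    have b4 : ‖c n‖ ≤ 1 := by rw [Real.norm_of_nonneg (hc0 n).le]; exact hc1 n
    rw [hF]
    refine (norm_add_le _ _).trans ?_
    rw [norm_mul, norm_mul, norm_mul]
    have b5 : ‖χ n x‖ * ‖fderiv ℝ φ x (τ x)‖ ≤ 1 * C₁ :=
      mul_le_mul b3 b1 (norm_nonneg _) zero_le_one
    have b6 : ‖c n‖ * ‖fderiv ℝ f (c n • x) (τ x)‖ ≤ 1 * C :=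
      mul_le_mul b4 b2 (norm_nonneg _) zero_le_one
    have b7 : ‖φ x‖ * (‖c n‖ * ‖fderiv ℝ f (c n • x) (τ x)‖) ≤ C₀ * (1 * C) :=
      mul_le_mul (h0 x) b6 (by positivity) ((norm_nonneg _).trans (h0 x))
    linarith
  have hzero : ∀ n, ∫ x, fderiv ℝ (fun y => χ n y * φ y) x (τ x) ∂σ = 0 := fun n =>
    hdiv _ ((hχc n).mul hφ) ((f.hasCompactSupport.comp_smul (hc0 n).ne').mul_right)
  have hlim : Tendsto (fun n => ∫ x, fderiv ℝ (fun y => χ n y * φ y) x (τ x) ∂σ) atTop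
      (nhds (∫ x, fderiv ℝ φ x (τ x) ∂σ)) := by
    refine tendsto_integral_of_dominated_convergence (fun _ => C₁ + C₀ * C)
      (fun n => aestronglyMeasurable_fderiv_apply hτ ((hχc n).mul hφ)) (integrable_const _)
      (fun n => ae_of_all _ (hbd n)) (ae_of_all _ fun x => ?_)
    simp only [hF]
    have hcx : Tendsto (fun n => c n • x) atTop (nhds 0) := by
      simpa using hct.smul_const x
    have t1 : Tendsto (fun n => χ n x) atTop (nhds 1) := by
      have := (hfd.continuous.tendsto 0).comp hcx
      rwa [f.one_of_mem_closedBall (by simp [f])] at this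
    have t2 : Tendsto (fun n => fderiv ℝ f (c n • x) (τ x)) atTop
        (nhds (fderiv ℝ f 0 (τ x))) := by
      have := ((hfc.continuous_fderiv (by simp)).tendsto 0).comp hcx
      exact ((ContinuousLinearMap.apply ℝ ℝ (τ x)).continuous.tendsto _).comp this
    have := (t1.mul_const (fderiv ℝ φ x (τ x))).add ((hct.mul t2).const_mul (φ x))
    simpa using this
  simp only [hzero] at hlim
  exact (tendsto_nhds_unique hlim tendsto_const_nhds)

variable {ε : ℝ} (S : SmoothStep ε)

variable (σ τ) in
/-- The mollified stream function of the divergence-free measure `τ σ`. -/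
def stream (p q : ℝ) : ℝ := ∫ x, S.B (p - x 0) * S.β (q - x 1) * τ x 1 ∂σ

lemma abs_apply_le_one {v : Ed 2} (hv : ‖v‖ ≤ 1) (i : Fin 2) : |v i| ≤ 1 :=
  (PiLp.norm_apply_le v i).trans hv

lemma integrable_mul_apply (hτ : Measurable τ) (hτ1 : ∀ x, ‖τ x‖ ≤ 1) {f : Ed 2 → ℝ}
    (hf : Continuous f) {C : ℝ} (hC : ∀ x, |f x| ≤ C) (i : Fin 2) :
    Integrable (fun x => f x * τ x i) σ := by
  have hm : Measurable fun x => τ x i := (PiLp.continuous_apply 2 _ i).measurable.comp hτ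
  refine Integrable.mono' (integrable_const C) (hf.measurable.mul hm).aestronglyMeasurable
    (ae_of_all _ fun x => ?_)
  rw [norm_mul]
  have := mul_le_mul (hC x) (abs_apply_le_one (hτ1 x) i) (abs_nonneg _)
    ((abs_nonneg _).trans (hC x))
  simpa using this

lemma stream_eq_neg (hε : 0 < ε) (hτ : Measurable τ) (hτ1 : ∀ x, ‖τ x‖ ≤ 1)
    (hdiv : ∀ φ : Ed 2 → ℝ, ContDiff ℝ (⊤ : ℕ∞) φ → HasCompactSupport φ →
      ∫ x, fderiv ℝ φ x (τ x) ∂σ = 0) (p q : ℝ) :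
    stream σ τ S p q = -∫ x, S.β (p - x 0) * S.B (q - x 1) * τ x 0 ∂σ := by
  set φ : Ed 2 → ℝ := fun x => S.B (p - x 0) * S.B (q - x 1)
  have hφ : ContDiff ℝ (⊤ : ℕ∞) φ := by
    have := S.contDiff
    exact (this.comp (by fun_prop)).mul (this.comp (by fun_prop))
  have hd : ∀ x, HasFDerivAt φ (-(S.β (p - x 0) * S.B (q - x 1)) •
      (EuclideanSpace.proj 0 : Ed 2 →L[ℝ] ℝ) +
      -(S.B (p - x 0) * S.β (q - x 1)) • (EuclideanSpace.proj 1 : Ed 2 →L[ℝ] ℝ)) x := by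
    intro x
    have e0 : HasFDerivAt (fun x : Ed 2 => p - x 0) (-(EuclideanSpace.proj 0 : Ed 2 →L[ℝ] ℝ)) x :=
      (EuclideanSpace.proj 0 : Ed 2 →L[ℝ] ℝ).hasFDerivAt.const_sub p
    have e1 : HasFDerivAt (fun x : Ed 2 => q - x 1) (-(EuclideanSpace.proj 1 : Ed 2 →L[ℝ] ℝ)) x :=
      (EuclideanSpace.proj 1 : Ed 2 →L[ℝ] ℝ).hasFDerivAt.const_sub q
    have h0 := (S.hasDerivAt (p - x 0)).comp_hasFDerivAt x e0
    have h1 := (S.hasDerivAt (q - x 1)).comp_hasFDerivAt x e1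
    refine (h0.mul h1).congr_fderiv ?_
    ext v
    simp
    ring
  have hproj : ∀ i, ‖(EuclideanSpace.proj i : Ed 2 →L[ℝ] ℝ)‖ ≤ 1 := fun i =>
    ContinuousLinearMap.opNorm_le_bound _ zero_le_one fun v => by
      rw [one_mul]; exact PiLp.norm_apply_le v i
  have hβ : ∀ s, |S.β s| ≤ S.M * (3 * ε) := fun s => by
    rw [abs_of_nonneg (S.β_nonneg s)]; exact S.β_le hε s
  have hb1 : ∀ x : Ed 2, |S.β (p - x 0) * S.B (q - x 1)| ≤ S.M * (3 * ε) := fun x => by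
    rw [abs_mul]
    simpa using mul_le_mul (hβ _) (S.abs_le_one (q - x 1)) (abs_nonneg _) (by positivity)
  have hb2 : ∀ x : Ed 2, |S.B (p - x 0) * S.β (q - x 1)| ≤ S.M * (3 * ε) := fun x => by
    rw [abs_mul]
    simpa using mul_le_mul (S.abs_le_one (p - x 0)) (hβ (q - x 1)) (abs_nonneg _) zero_le_one
  have key := integral_fderiv_eq_zero_of_bounded hτ hτ1 hdiv hφ (C₀ := 1)
    (C₁ := S.M * (3 * ε) + S.M * (3 * ε)) (fun x => ?_) (fun x => ?_)
  · have e : ∀ x, fderiv ℝ φ x (τ x) = -(S.β (p - x 0) * S.B (q - x 1) * τ x 0) -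
        S.B (p - x 0) * S.β (q - x 1) * τ x 1 := fun x => by
      rw [(hd x).fderiv]
      simp
      ring
    have c1 := S.continuous
    have c2 := S.continuous_β
    simp only [e] at key
    rw [integral_sub, integral_neg] at key
    · rw [stream]; linarith
    · exact (integrable_mul_apply hτ hτ1 (by fun_prop) hb1 0).neg
    · exact integrable_mul_apply hτ hτ1 (by fun_prop) hb2 1
  · rw [norm_mul]
    simpa using mul_le_mul (S.abs_le_one (p - x 0)) (S.abs_le_one (q - x 1)) (abs_nonneg _)
      zero_le_one
  · rw [(hd x).fderiv]
    refine (norm_add_le _ _).trans (add_le_add ?_ ?_)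
    · rw [norm_smul, norm_neg]
      simpa using mul_le_mul (hb1 x) (hproj 0) (norm_nonneg _) (by positivity)
    · rw [norm_smul, norm_neg]
      simpa using mul_le_mul (hb2 x) (hproj 1) (norm_nonneg _) (by positivity)

end Stream

/-! ### Discretisation of a divergence-free measure -/

section Discrete

variable {ε : ℝ} (S : SmoothStep ε) (h : ℝ)

/-- The partition of unity attached to the lattice. -/
def latKer (a : ℤ × ℤ) (x : Ed 2) : ℝ := S.inc h a.1 (x 0) * S.inc h a.2 (x 1)

def cornerShift (b : Bool) : ℝ := if b then 1 else 0

def latErr (T : Tri) (x : Ed 2) : ℝ :=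
  |S.incErr h T.1.1 (x 0) (cornerShift T.2)| * S.inc h T.1.2 (x 1) +
    S.inc h T.1.1 (x 0) * |S.incErr h T.1.2 (x 1) (cornerShift T.2)|

lemma cornerShift_nonneg (b : Bool) : 0 ≤ cornerShift b := by unfold cornerShift; split_ifs <;> simp

lemma cornerShift_le_one (b : Bool) : cornerShift b ≤ 1 := by unfold cornerShift; split_ifs <;> simp

lemma continuous_latKer (a : ℤ × ℤ) : Continuous (latKer S h a) := by
  have := S.continuous_inc h
  unfold latKer
  exact ((this _).comp (by fun_prop)).mul ((this _).comp (by fun_prop))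

lemma continuous_latErr (T : Tri) : Continuous (latErr S h T) := by
  have h1 := S.continuous_inc h
  have h2 := S.continuous_incErr h
  unfold latErr
  exact (((h2 _ _).comp (by fun_prop : Continuous fun x : Ed 2 => x 0)).abs.mul
    ((h1 _).comp (by fun_prop))).add (((h1 _).comp (by fun_prop)).mul
    ((h2 _ _).comp (by fun_prop : Continuous fun x : Ed 2 => x 1)).abs)

variable {h} (hh : 0 < h)
include hh

lemma latKer_nonneg (a : ℤ × ℤ) (x : Ed 2) : 0 ≤ latKer S h a x :=
  mul_nonneg (S.inc_nonneg _ _ hh.le) (S.inc_nonneg _ _ hh.le)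

lemma inc_le_one (j : ℤ) (s : ℝ) : S.inc h j s ≤ 1 := by
  simpa using S.sum_inc_le_one s hh {j}

lemma abs_inc_le_one (j : ℤ) (s : ℝ) : |S.inc h j s| ≤ 1 := by
  rw [abs_of_nonneg (S.inc_nonneg _ _ hh.le)]; exact inc_le_one S hh j s

lemma abs_latKer_le_one (a : ℤ × ℤ) (x : Ed 2) : |latKer S h a x| ≤ 1 := by
  rw [latKer, abs_mul]
  simpa using mul_le_mul (abs_inc_le_one S hh a.1 (x 0)) (abs_inc_le_one S hh a.2 (x 1))
    (abs_nonneg _) zero_le_one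

lemma latErr_nonneg (T : Tri) (x : Ed 2) : 0 ≤ latErr S h T x :=
  add_nonneg (mul_nonneg (abs_nonneg _) (S.inc_nonneg _ _ hh.le))
    (mul_nonneg (S.inc_nonneg _ _ hh.le) (abs_nonneg _))

lemma exists_sum_latKer_eq_one (I : Finset (ℤ × ℤ)) (x : Ed 2) :
    ∃ J, I ⊆ J ∧ ∑ a ∈ J, latKer S h a x = 1 := by
  classical
  obtain ⟨J₁, h1, e1⟩ := S.exists_sum_inc_eq_one (x 0) hh (I.image Prod.fst)
  obtain ⟨J₂, h2, e2⟩ := S.exists_sum_inc_eq_one (x 1) hh (I.image Prod.snd)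
  refine ⟨J₁ ×ˢ J₂, fun a ha => ?_, ?_⟩
  · rw [Finset.mem_product]
    exact ⟨h1 (Finset.mem_image_of_mem _ ha), h2 (Finset.mem_image_of_mem _ ha)⟩
  · rw [Finset.sum_product]
    simp only [latKer]
    rw [← Finset.sum_mul_sum, e1, e2, one_mul]

lemma sum_latKer_le_one (I : Finset (ℤ × ℤ)) (x : Ed 2) : ∑ a ∈ I, latKer S h a x ≤ 1 := by
  obtain ⟨J, hIJ, hJ⟩ := exists_sum_latKer_eq_one S hh I x
  rw [← hJ]
  exact Finset.sum_le_sum_of_subset_of_nonneg hIJ fun j _ _ => latKer_nonneg S hh j x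

lemma norm_sub_latPos_le {a : ℤ × ℤ} {x : Ed 2} (hx : latKer S h a x ≠ 0) :
    ‖x - latPos h a‖ ≤ 2 * (ε + h) := by
  have h1 : |h * a.1 - x 0| ≤ ε + h := by
    by_contra hc
    exact hx (by rw [latKer, S.inc_eq_zero _ _ hh.le (not_le.1 hc), zero_mul])
  have h2 : |h * a.2 - x 1| ≤ ε + h := by
    by_contra hc
    exact hx (by rw [latKer, S.inc_eq_zero _ _ hh.le (not_le.1 hc), mul_zero])
  have h3 : 0 ≤ ε + h := (abs_nonneg _).trans h1
  rw [EuclideanSpace.norm_eq, Real.sqrt_le_left (by linarith)]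
  simp only [Fin.sum_univ_two, Real.norm_eq_abs, sq_abs]
  change (x 0 - h * a.1) ^ 2 + (x 1 - h * a.2) ^ 2 ≤ _
  have h4 := sq_le_sq' (neg_le_of_abs_le h1) (le_of_abs_le h1)
  have h5 := sq_le_sq' (neg_le_of_abs_le h2) (le_of_abs_le h2)
  nlinarith

lemma sum_latErr_le (hε : 0 < ε) (hh1 : h ≤ 1) (I : Finset (ℤ × ℤ)) (b : Bool) (x : Ed 2) :
    ∑ a ∈ I, latErr S h (a, b) x ≤ 2 * (S.M * (2 * ε + 3) * h) := by
  classical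
  have hsub : I ⊆ I.image Prod.fst ×ˢ I.image Prod.snd := fun a ha =>
    Finset.mem_product.2 ⟨Finset.mem_image_of_mem _ ha, Finset.mem_image_of_mem _ ha⟩
  refine (Finset.sum_le_sum_of_subset_of_nonneg hsub fun a _ _ =>
    latErr_nonneg S hh (a, b) x).trans ?_
  simp only [latErr]
  rw [Finset.sum_add_distrib, Finset.sum_product, Finset.sum_product]
  simp only
  rw [← Finset.sum_mul_sum, ← Finset.sum_mul_sum, two_mul]
  have e0 := fun s J => S.sum_abs_incErr_le s hε hh hh1 (cornerShift_nonneg b)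
    (cornerShift_le_one b) J
  have n0 : ∀ s (J : Finset ℤ), 0 ≤ ∑ j ∈ J, |S.incErr h j s (cornerShift b)| := fun s J =>
    Finset.sum_nonneg fun _ _ => abs_nonneg _
  have n1 : ∀ s (J : Finset ℤ), 0 ≤ ∑ j ∈ J, S.inc h j s := fun s J =>
    Finset.sum_nonneg fun j _ => S.inc_nonneg j s hh.le
  refine add_le_add ?_ ?_
  · have := mul_le_mul (e0 (x 0) (I.image Prod.fst)) (S.sum_inc_le_one (x 1) hh
      (I.image Prod.snd)) (n1 _ _) ((n0 (x 0) (I.image Prod.fst)).trans (e0 _ _))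
    simpa using this
  · have := mul_le_mul (S.sum_inc_le_one (x 0) hh (I.image Prod.fst))
      (e0 (x 1) (I.image Prod.snd)) (n0 _ _) zero_le_one
    simpa using this

lemma abs_latErr_le (hε : 0 < ε) (hh1 : h ≤ 1) (T : Tri) (x : Ed 2) :
    |latErr S h T x| ≤ 2 * (S.M * (2 * ε + 3) * h) := by
  rw [abs_of_nonneg (latErr_nonneg S hh T x)]
  simpa using sum_latErr_le S hh hε hh1 {T.1} T.2 x

omit hh

variable {σ : Measure (Ed 2)} [IsProbabilityMeasure σ] {τ : Ed 2 → Ed 2}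

variable (σ τ h) in
def latStream (a : ℤ × ℤ) : ℝ := stream σ τ S (h * a.1) (h * a.2)

variable (σ τ h) in
def latMass (a : ℤ × ℤ) : Ed 2 := ∫ x, latKer S h a x • τ x ∂σ

lemma abs_β_mul_le (hε : 0 < ε) {f : ℝ → ℝ} (hf : ∀ s, |f s| ≤ 1) (s s' : ℝ) :
    |S.β s * f s'| ≤ S.M * (3 * ε) := by
  rw [abs_mul, abs_of_nonneg (S.β_nonneg s)]
  simpa using mul_le_mul (S.β_le hε s) (hf s') (abs_nonneg _) (by positivity)

lemma integrable_β_sub (hε : 0 < ε) (q : ℝ) (i : Fin 2) :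
    Integrable (fun x : Ed 2 => S.β (q - x i)) σ := by
  have c2 := S.continuous_β
  refine Integrable.mono' (integrable_const (S.M * (3 * ε) : ℝ))
    (by fun_prop : Continuous fun x : Ed 2 => S.β (q - x i)).aestronglyMeasurable
    (ae_of_all _ fun x => ?_)
  rw [Real.norm_of_nonneg (S.β_nonneg _)]
  exact S.β_le hε _

lemma abs_stream_le₁ (hε : 0 < ε) (hτ1 : ∀ x, ‖τ x‖ ≤ 1) (p q : ℝ) :
    |stream σ τ S p q| ≤ ∫ x, S.β (q - x 1) ∂σ := by
  rw [stream, ← Real.norm_eq_abs]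
  refine norm_integral_le_of_norm_le (integrable_β_sub S hε q 1) (ae_of_all _ fun x => ?_)
  rw [norm_mul, norm_mul, Real.norm_of_nonneg (S.β_nonneg _)]
  have h3 := S.β_nonneg (q - x 1)
  have h4 : ‖S.B (p - x 0)‖ * S.β (q - x 1) ≤ 1 * S.β (q - x 1) := by
    gcongr; exact S.abs_le_one (p - x 0)
  have h5 := mul_le_mul h4 (abs_apply_le_one (hτ1 x) 1) (abs_nonneg _) (by positivity)
  simpa using h5

lemma abs_stream_le₀ (hε : 0 < ε) (hτ : Measurable τ) (hτ1 : ∀ x, ‖τ x‖ ≤ 1)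
    (hdiv : ∀ φ : Ed 2 → ℝ, ContDiff ℝ (⊤ : ℕ∞) φ → HasCompactSupport φ →
      ∫ x, fderiv ℝ φ x (τ x) ∂σ = 0) (p q : ℝ) :
    |stream σ τ S p q| ≤ ∫ x, S.β (p - x 0) ∂σ := by
  rw [stream_eq_neg S hε hτ hτ1 hdiv, abs_neg, ← Real.norm_eq_abs]
  refine norm_integral_le_of_norm_le (integrable_β_sub S hε p 0) (ae_of_all _ fun x => ?_)
  rw [norm_mul, norm_mul, Real.norm_of_nonneg (S.β_nonneg _)]
  have h3 := S.β_nonneg (p - x 0)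
  have h4 : S.β (p - x 0) * ‖S.B (q - x 1)‖ ≤ S.β (p - x 0) * 1 := by
    gcongr; exact S.abs_le_one (q - x 1)
  have h5 := mul_le_mul h4 (abs_apply_le_one (hτ1 x) 0) (abs_nonneg _) (by positivity)
  simpa using h5

lemma tendsto_integral_β_sub (hε : 0 < ε) (hh : 0 < h) (i : Fin 2) :
    Tendsto (fun j : ℤ => ∫ x, S.β (h * j - x i) ∂σ) cofinite (nhds 0) := by
  refine Summable.tendsto_cofinite_zero (summable_of_sum_le
    (fun j => integral_nonneg fun x => S.β_nonneg _) (c := S.M * (3 * ε) * (2 * ε / h + 1))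
    fun I => ?_)
  rw [← integral_finsetSum _ fun j _ => integrable_β_sub S hε _ i]
  refine (integral_mono (integrable_finsetSum _ fun j _ => integrable_β_sub S hε _ i)
    (integrable_const _) fun x => S.sum_β_le (x i) hε hh I).trans ?_
  simp

lemma tendsto_latStream (hε : 0 < ε) (hh : 0 < h) (hτ : Measurable τ) (hτ1 : ∀ x, ‖τ x‖ ≤ 1)
    (hdiv : ∀ φ : Ed 2 → ℝ, ContDiff ℝ (⊤ : ℕ∞) φ → HasCompactSupport φ →
      ∫ x, fderiv ℝ φ x (τ x) ∂σ = 0) :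
    Tendsto (latStream S h σ τ) cofinite (nhds 0) := by
  rw [Metric.tendsto_nhds]
  intro c hc
  have t0 := (Metric.tendsto_nhds.1 (tendsto_integral_β_sub (σ := σ) S hε hh 0)) c hc
  have t1 := (Metric.tendsto_nhds.1 (tendsto_integral_β_sub (σ := σ) S hε hh 1)) c hc
  rw [eventually_cofinite] at t0 t1 ⊢
  refine (t0.prod t1).subset fun a ha => ?_
  have ha' : ¬ |latStream S h σ τ a| < c := by simpa using ha
  have nn : ∀ (j : ℤ) (i : Fin 2), 0 ≤ ∫ x, S.β (h * j - x i) ∂σ := fun j i =>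
    integral_nonneg fun x => S.β_nonneg _
  constructor
  · intro hlt
    simp only [Real.dist_eq, sub_zero, abs_of_nonneg (nn _ _)] at hlt
    exact ha' ((abs_stream_le₀ S hε hτ hτ1 hdiv _ _).trans_lt hlt)
  · intro hlt
    simp only [Real.dist_eq, sub_zero, abs_of_nonneg (nn _ _)] at hlt
    exact ha' ((abs_stream_le₁ S hε hτ1 _ _).trans_lt hlt)

end Discrete

section Discrete

variable {ε : ℝ} (S : SmoothStep ε) {h : ℝ} {σ : Measure (Ed 2)} [IsProbabilityMeasure σ]
  {τ : Ed 2 → Ed 2}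

omit [IsProbabilityMeasure σ] in
lemma triGrad_latStream_apply_zero (T : Tri) :
    triGrad h (latStream S h σ τ) T 0 = h / 2 *
      (stream σ τ S (h * (T.1.1 + cornerShift T.2)) (h * T.1.2) -
        stream σ τ S (h * (T.1.1 + cornerShift T.2)) (h * (T.1.2 + 1))) := by
  obtain ⟨⟨a, a'⟩, b⟩ := T
  cases b <;> simp [triGrad, rotGrad, triVert, latStream, latPos, cornerShift, Fin.sum_univ_three] <;>
    ring

omit [IsProbabilityMeasure σ] in
lemma triGrad_latStream_apply_one (T : Tri) :
    triGrad h (latStream S h σ τ) T 1 = h / 2 *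
      (stream σ τ S (h * (T.1.1 + 1)) (h * (T.1.2 + cornerShift T.2)) -
        stream σ τ S (h * T.1.1) (h * (T.1.2 + cornerShift T.2))) := by
  obtain ⟨⟨a, a'⟩, b⟩ := T
  cases b <;> simp [triGrad, rotGrad, triVert, latStream, latPos, cornerShift, Fin.sum_univ_three] <;>
    ring

lemma integrable_smul_of_bounded (hτ : Measurable τ) (hτ1 : ∀ x, ‖τ x‖ ≤ 1) {f : Ed 2 → ℝ}
    (hf : Continuous f) {C : ℝ} (hC : ∀ x, |f x| ≤ C) :
    Integrable (fun x => f x • τ x) σ := by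
  refine Integrable.mono' (integrable_const C) (hf.measurable.smul hτ).aestronglyMeasurable
    (ae_of_all _ fun x => ?_)
  rw [norm_smul]
  simpa using mul_le_mul (hC x) (hτ1 x) (norm_nonneg _) ((abs_nonneg _).trans (hC x))

lemma latMass_apply (hh : 0 < h) (hτ : Measurable τ) (hτ1 : ∀ x, ‖τ x‖ ≤ 1) (a : ℤ × ℤ)
    (i : Fin 2) : latMass S h σ τ a i = ∫ x, latKer S h a x * τ x i ∂σ := by
  have := (EuclideanSpace.proj i : Ed 2 →L[ℝ] ℝ).integral_comp_comm
    (integrable_smul_of_bounded (σ := σ) hτ hτ1 (continuous_latKer S h a) (abs_latKer_le_one S hh a))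
  simpa [latMass] using this.symm

lemma norm_le_abs_add_abs (v : Ed 2) : ‖v‖ ≤ |v 0| + |v 1| := by
  rw [EuclideanSpace.norm_eq, Real.sqrt_le_left (by positivity)]
  simp only [Fin.sum_univ_two, Real.norm_eq_abs]
  nlinarith [abs_nonneg (v 0), abs_nonneg (v 1)]

lemma integrable_latErr (hε : 0 < ε) (hh : 0 < h) (hh1 : h ≤ 1) (T : Tri) :
    Integrable (latErr S h T) σ :=
  Integrable.mono' (integrable_const _) (continuous_latErr S h T).aestronglyMeasurable
    (ae_of_all _ fun x => abs_latErr_le S hh hε hh1 T x)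

lemma norm_triGrad_sub_latMass_le (hε : 0 < ε) (hh : 0 < h) (hh1 : h ≤ 1) (hτ : Measurable τ)
    (hτ1 : ∀ x, ‖τ x‖ ≤ 1)
    (hdiv : ∀ φ : Ed 2 → ℝ, ContDiff ℝ (⊤ : ℕ∞) φ → HasCompactSupport φ →
      ∫ x, fderiv ℝ φ x (τ x) ∂σ = 0) (T : Tri) :
    ‖triGrad h (latStream S h σ τ) T - (1 / 2 : ℝ) • latMass S h σ τ T.1‖ ≤
      1 / 2 * ∫ x, latErr S h T x ∂σ := by
  set c := cornerShift T.2
  have hc0 : 0 ≤ c := cornerShift_nonneg _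
  have hc1 : c ≤ 1 := cornerShift_le_one _
  have cB := S.continuous
  have cβ := S.continuous_β
  have cinc := S.continuous_inc h
  have cerr := S.continuous_incErr h
  have berr : ∀ j s, |S.incErr h j s c| ≤ S.M * (2 * ε + 3) * h := fun j s => by
    simpa using S.sum_abs_incErr_le s hε hh hh1 hc0 hc1 {j}
  have hE : ∀ {f g : ℝ → ℝ} {C : ℝ} (i : Fin 2), Continuous f → Continuous g → (∀ s, |f s| ≤ C) →
      (∀ s, |g s| ≤ 1) → Integrable (fun x : Ed 2 => f (x 0) * g (x 1) * τ x i) σ := by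
    intro f g C i hf hg hfC hg1
    refine integrable_mul_apply hτ hτ1 (by fun_prop) (C := C) (fun x => ?_) i
    rw [abs_mul]
    simpa using mul_le_mul (hfC (x 0)) (hg1 (x 1)) (abs_nonneg _) ((abs_nonneg _).trans (hfC 0))
  have hE' : ∀ {f g : ℝ → ℝ} {C : ℝ} (i : Fin 2), Continuous f → Continuous g → (∀ s, |f s| ≤ 1) →
      (∀ s, |g s| ≤ C) → Integrable (fun x : Ed 2 => f (x 0) * g (x 1) * τ x i) σ := by
    intro f g C i hf hg hf1 hgC
    refine integrable_mul_apply hτ hτ1 (by fun_prop) (C := C) (fun x => ?_) i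
    rw [abs_mul]
    simpa using mul_le_mul (hf1 (x 0)) (hgC (x 1)) (abs_nonneg _) zero_le_one
  have bβ : ∀ p s, |S.β (p - s)| ≤ S.M * (3 * ε) := fun p s => by
    rw [abs_of_nonneg (S.β_nonneg _)]; exact S.β_le hε _
  have f0 : (triGrad h (latStream S h σ τ) T - (1 / 2 : ℝ) • latMass S h σ τ T.1) 0 =
      1 / 2 * ∫ x, S.incErr h T.1.1 (x 0) c * S.inc h T.1.2 (x 1) * τ x 0 ∂σ := by
    have e := fun q => hE (f := fun s => S.β (h * (T.1.1 + c) - s)) (g := fun s => S.B (q - s)) 0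
      (by fun_prop) (by fun_prop) (bβ _) (fun s => S.abs_le_one _)
    have e' := hE (f := fun s => S.incErr h T.1.1 s c) (g := S.inc h T.1.2) 0
      (cerr _ _) (cinc _) (berr _) (abs_inc_le_one S hh _)
    have e'' := hE (f := S.inc h T.1.1) (g := S.inc h T.1.2) 0
      (cinc _) (cinc _) (abs_inc_le_one S hh _) (abs_inc_le_one S hh _)
    rw [PiLp.sub_apply, PiLp.smul_apply, triGrad_latStream_apply_zero,
      stream_eq_neg S hε hτ hτ1 hdiv, stream_eq_neg S hε hτ hτ1 hdiv, latMass_apply S hh hτ hτ1,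
      neg_sub_neg, ← integral_sub (e _) (e _), smul_eq_mul, mul_comm_div, ← mul_div_assoc,
      ← integral_const_mul, div_eq_inv_mul, ← one_div, ← mul_sub, ← integral_sub]
    · congr 2
      ext x
      simp only [latKer, SmoothStep.incErr, SmoothStep.inc]
      ring
    · exact ((e _).sub (e _)).const_mul h
    · exact e''
  have f1 : (triGrad h (latStream S h σ τ) T - (1 / 2 : ℝ) • latMass S h σ τ T.1) 1 =
      1 / 2 * ∫ x, S.inc h T.1.1 (x 0) * S.incErr h T.1.2 (x 1) c * τ x 1 ∂σ := by
    have e := fun q => hE' (f := fun s => S.B (q - s)) (g := fun s => S.β (h * (T.1.2 + c) - s)) 1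
      (by fun_prop) (by fun_prop) (fun s => S.abs_le_one _) (bβ _)
    have e'' := hE (f := S.inc h T.1.1) (g := S.inc h T.1.2) 1
      (cinc _) (cinc _) (abs_inc_le_one S hh _) (abs_inc_le_one S hh _)
    rw [PiLp.sub_apply, PiLp.smul_apply, triGrad_latStream_apply_one, stream, stream,
      latMass_apply S hh hτ hτ1, ← integral_sub (e _) (e _), smul_eq_mul, mul_comm_div,
      ← mul_div_assoc, ← integral_const_mul, div_eq_inv_mul, ← one_div, ← mul_sub, ← integral_sub]
    · congr 2
      ext x
      simp only [latKer, SmoothStep.incErr, SmoothStep.inc]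
      ring
    · exact ((e _).sub (e _)).const_mul h
    · exact e''
  have i0 : Integrable (fun x : Ed 2 => |S.incErr h T.1.1 (x 0) c| * S.inc h T.1.2 (x 1)) σ := by
    refine Integrable.mono' (integrable_latErr S hε hh hh1 T) ?_ (ae_of_all _ fun x => ?_)
    · exact (((cerr _ _).comp (by fun_prop : Continuous fun x : Ed 2 => x 0)).abs.mul
        ((cinc _).comp (by fun_prop))).aestronglyMeasurable
    · rw [norm_mul, Real.norm_of_nonneg (abs_nonneg _), Real.norm_of_nonneg (S.inc_nonneg _ _ hh.le)]
      exact le_add_of_nonneg_right (mul_nonneg (S.inc_nonneg _ _ hh.le) (abs_nonneg _))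
  have i1 : Integrable (fun x : Ed 2 => S.inc h T.1.1 (x 0) * |S.incErr h T.1.2 (x 1) c|) σ := by
    refine Integrable.mono' (integrable_latErr S hε hh hh1 T) ?_ (ae_of_all _ fun x => ?_)
    · exact (((cinc _).comp (by fun_prop : Continuous fun x : Ed 2 => x 0)).mul
        ((cerr _ _).comp (by fun_prop : Continuous fun x : Ed 2 => x 1)).abs).aestronglyMeasurable
    · rw [norm_mul, Real.norm_of_nonneg (abs_nonneg _), Real.norm_of_nonneg (S.inc_nonneg _ _ hh.le)]
      exact le_add_of_nonneg_left (mul_nonneg (abs_nonneg _) (S.inc_nonneg _ _ hh.le))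
  refine (norm_le_abs_add_abs _).trans ?_
  rw [f0, f1, abs_mul, abs_mul, abs_of_pos (by norm_num : (0 : ℝ) < 1 / 2), ← mul_add]
  refine mul_le_mul_of_nonneg_left ?_ (by norm_num)
  have := integral_add i0 i1
  simp only [latErr]
  rw [this]
  refine add_le_add ?_ ?_
  · rw [← Real.norm_eq_abs]
    refine norm_integral_le_of_norm_le i0 (ae_of_all _ fun x => ?_)
    rw [norm_mul, norm_mul, Real.norm_of_nonneg (S.inc_nonneg _ _ hh.le)]
    exact mul_le_of_le_one_right (mul_nonneg (norm_nonneg _) (S.inc_nonneg _ _ hh.le))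
      (abs_apply_le_one (hτ1 x) 0)
  · rw [← Real.norm_eq_abs]
    refine norm_integral_le_of_norm_le i1 (ae_of_all _ fun x => ?_)
    rw [norm_mul, norm_mul, Real.norm_of_nonneg (S.inc_nonneg _ _ hh.le)]
    exact mul_le_of_le_one_right (mul_nonneg (S.inc_nonneg _ _ hh.le) (norm_nonneg _))
      (abs_apply_le_one (hτ1 x) 1)

lemma sum_triGrad_sub_latMass_le (hε : 0 < ε) (hh : 0 < h) (hh1 : h ≤ 1) (hτ : Measurable τ)
    (hτ1 : ∀ x, ‖τ x‖ ≤ 1)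
    (hdiv : ∀ φ : Ed 2 → ℝ, ContDiff ℝ (⊤ : ℕ∞) φ → HasCompactSupport φ →
      ∫ x, fderiv ℝ φ x (τ x) ∂σ = 0) (I : Finset (ℤ × ℤ)) :
    ∑ T ∈ I ×ˢ (Finset.univ : Finset Bool),
      ‖triGrad h (latStream S h σ τ) T - (1 / 2 : ℝ) • latMass S h σ τ T.1‖ ≤
      2 * (S.M * (2 * ε + 3) * h) := by
  refine (Finset.sum_le_sum fun T _ =>
    norm_triGrad_sub_latMass_le S hε hh hh1 hτ hτ1 hdiv T).trans ?_
  rw [Finset.sum_product_right]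
  have key : ∀ b, ∑ a ∈ I, 1 / 2 * ∫ x, latErr S h (a, b) x ∂σ ≤ S.M * (2 * ε + 3) * h := by
    intro b
    rw [← Finset.mul_sum, ← integral_finsetSum _ fun a _ => integrable_latErr S hε hh hh1 (a, b)]
    have := integral_mono (μ := σ) (integrable_finsetSum I fun a _ =>
      integrable_latErr S hε hh hh1 (a, b)) (integrable_const _)
      fun x => sum_latErr_le S hh hε hh1 I b x
    simp only [integral_const, probReal_univ, smul_eq_mul, one_mul] at this
    linarith
  refine (Finset.sum_le_sum fun b _ => key b).trans ?_
  simp [two_mul]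

lemma sum_norm_latMass_le (hh : 0 < h) (hτ1 : ∀ x, ‖τ x‖ ≤ 1) (I : Finset (ℤ × ℤ)) :
    ∑ a ∈ I, ‖latMass S h σ τ a‖ ≤ 1 := by
  have hi : ∀ a, Integrable (latKer S h a) σ := fun a => Integrable.mono' (integrable_const (1 : ℝ))
    (continuous_latKer S h a).aestronglyMeasurable
    (ae_of_all _ fun x => abs_latKer_le_one S hh a x)
  have : ∀ a, ‖latMass S h σ τ a‖ ≤ ∫ x, latKer S h a x ∂σ := fun a => by
    refine norm_integral_le_of_norm_le (hi a) (ae_of_all _ fun x => ?_)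
    rw [norm_smul, Real.norm_of_nonneg (latKer_nonneg S hh a x)]
    exact mul_le_of_le_one_right (latKer_nonneg S hh a x) (hτ1 x)
  refine (Finset.sum_le_sum fun a _ => this a).trans ?_
  rw [← integral_finsetSum _ fun a _ => hi a]
  refine (integral_mono (integrable_finsetSum _ fun a _ => hi a) (integrable_const 1)
    fun x => sum_latKer_le_one S hh I x).trans ?_
  simp

lemma sum_norm_triGrad_latStream_le (hε : 0 < ε) (hh : 0 < h) (hh1 : h ≤ 1) (hτ : Measurable τ)
    (hτ1 : ∀ x, ‖τ x‖ ≤ 1)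
    (hdiv : ∀ φ : Ed 2 → ℝ, ContDiff ℝ (⊤ : ℕ∞) φ → HasCompactSupport φ →
      ∫ x, fderiv ℝ φ x (τ x) ∂σ = 0) (J : Finset Tri) :
    ∑ T ∈ J, ‖triGrad h (latStream S h σ τ) T‖ ≤ 1 + 2 * (S.M * (2 * ε + 3) * h) := by
  classical
  set I := J.image Prod.fst
  have hsub : J ⊆ I ×ˢ (Finset.univ : Finset Bool) := fun T hT =>
    Finset.mem_product.2 ⟨Finset.mem_image_of_mem _ hT, Finset.mem_univ _⟩
  refine (Finset.sum_le_sum_of_subset_of_nonneg hsub fun _ _ _ => norm_nonneg _).trans ?_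
  have h1 : ∀ T : Tri, ‖triGrad h (latStream S h σ τ) T‖ ≤ 1 / 2 * ‖latMass S h σ τ T.1‖ +
      ‖triGrad h (latStream S h σ τ) T - (1 / 2 : ℝ) • latMass S h σ τ T.1‖ := fun T => by
    have := norm_add_le ((1 / 2 : ℝ) • latMass S h σ τ T.1)
      (triGrad h (latStream S h σ τ) T - (1 / 2 : ℝ) • latMass S h σ τ T.1)
    rwa [add_sub_cancel, norm_smul, Real.norm_of_nonneg (by norm_num)] at this
  refine (Finset.sum_le_sum fun T _ => h1 T).trans ?_
  rw [Finset.sum_add_distrib]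
  refine add_le_add ?_ (sum_triGrad_sub_latMass_le S hε hh hh1 hτ hτ1 hdiv I)
  rw [Finset.sum_product]
  simp only [Fintype.univ_bool, Finset.sum_const, nsmul_eq_mul]
  have := sum_norm_latMass_le (σ := σ) S hh hτ1 I
  simpa using this

lemma summable_norm_triGrad_latStream (hε : 0 < ε) (hh : 0 < h) (hh1 : h ≤ 1) (hτ : Measurable τ)
    (hτ1 : ∀ x, ‖τ x‖ ≤ 1)
    (hdiv : ∀ φ : Ed 2 → ℝ, ContDiff ℝ (⊤ : ℕ∞) φ → HasCompactSupport φ →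
      ∫ x, fderiv ℝ φ x (τ x) ∂σ = 0) :
    Summable fun T : Tri => ‖triGrad h (latStream S h σ τ) T‖ :=
  summable_of_sum_le (fun _ => norm_nonneg _)
    (sum_norm_triGrad_latStream_le S hε hh hh1 hτ hτ1 hdiv)

lemma tsum_norm_triGrad_latStream_le (hε : 0 < ε) (hh : 0 < h) (hh1 : h ≤ 1) (hτ : Measurable τ)
    (hτ1 : ∀ x, ‖τ x‖ ≤ 1)
    (hdiv : ∀ φ : Ed 2 → ℝ, ContDiff ℝ (⊤ : ℕ∞) φ → HasCompactSupport φ →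
      ∫ x, fderiv ℝ φ x (τ x) ∂σ = 0) :
    ∑' T : Tri, ‖triGrad h (latStream S h σ τ) T‖ ≤ 1 + 2 * (S.M * (2 * ε + 3) * h) :=
  Real.tsum_le_of_sum_le (fun _ => norm_nonneg _)
    (sum_norm_triGrad_latStream_le S hε hh hh1 hτ hτ1 hdiv)

lemma integral_inner_le_tsum (hε : 0 < ε) (hh : 0 < h) (hh1 : h ≤ 1) (hτ : Measurable τ)
    (hτ1 : ∀ x, ‖τ x‖ ≤ 1)
    (hdiv : ∀ φ : Ed 2 → ℝ, ContDiff ℝ (⊤ : ℕ∞) φ → HasCompactSupport φ →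
      ∫ x, fderiv ℝ φ x (τ x) ∂σ = 0)
    {Ψ : Ed 2 → Ed 2} (hΨ : Continuous Ψ) {b ω R : ℝ} (hb : ∀ x, ‖Ψ x‖ ≤ b) (hR : 0 ≤ R)
    (hΨs : ∀ x, R < ‖x‖ → Ψ x = 0) (hω : ∀ x y, ‖x - y‖ ≤ 2 * (ε + h) → ‖Ψ x - Ψ y‖ ≤ ω) :
    ∫ x, ⟪Ψ x, τ x⟫ ∂σ ≤ ∑' T : Tri, ⟪Ψ (latPos h T.1), triGrad h (latStream S h σ τ) T⟫ + ω +
      b * (2 * (S.M * (2 * ε + 3) * h)) := by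
  obtain ⟨I, hI, -⟩ := exists_finset_box hh hh1 hR
  have hI' : ∀ a ∉ I, Ψ (latPos h a) = 0 := fun a ha => hΨs _ (by linarith [hI a ha])
  have hω0 : 0 ≤ ω := (norm_nonneg _).trans (hω 0 0 (by simp; positivity))
  have hb0 : 0 ≤ b := (norm_nonneg _).trans (hb 0)
  have e1 : ∑' T : Tri, ⟪Ψ (latPos h T.1), triGrad h (latStream S h σ τ) T⟫ =
      ∑ T ∈ I ×ˢ (Finset.univ : Finset Bool),
        ⟪Ψ (latPos h T.1), triGrad h (latStream S h σ τ) T⟫ := by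
    refine tsum_eq_sum fun T hT => ?_
    rw [hI' T.1 (fun hc => hT (Finset.mem_product.2 ⟨hc, Finset.mem_univ _⟩)), inner_zero_left]
  have e2 : ∑ T ∈ I ×ˢ (Finset.univ : Finset Bool),
      ⟪Ψ (latPos h T.1), (1 / 2 : ℝ) • latMass S h σ τ T.1⟫ =
        ∑ a ∈ I, ⟪Ψ (latPos h a), latMass S h σ τ a⟫ := by
    rw [Finset.sum_product]
    refine Finset.sum_congr rfl fun a _ => ?_
    simp [inner_smul_right, ← two_mul]
  have e3 : ∑ T ∈ I ×ˢ (Finset.univ : Finset Bool),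
      ⟪Ψ (latPos h T.1), (1 / 2 : ℝ) • latMass S h σ τ T.1⟫ ≤
      ∑ T ∈ I ×ˢ (Finset.univ : Finset Bool),
        ⟪Ψ (latPos h T.1), triGrad h (latStream S h σ τ) T⟫ +
        b * (2 * (S.M * (2 * ε + 3) * h)) := by
    rw [← sub_le_iff_le_add', ← Finset.sum_sub_distrib]
    refine le_trans (Finset.sum_le_sum fun T _ => ?_) ((Finset.mul_sum _ _ _).symm.le.trans
      (mul_le_mul_of_nonneg_left (sum_triGrad_sub_latMass_le S hε hh hh1 hτ hτ1 hdiv I) hb0))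
    rw [← inner_sub_right, norm_sub_rev]
    exact (real_inner_le_norm _ _).trans (mul_le_mul_of_nonneg_right (hb _) (norm_nonneg _))
  have hi : ∀ a, Integrable (fun x => latKer S h a x • τ x) σ := fun a =>
    integrable_smul_of_bounded hτ hτ1 (continuous_latKer S h a) (abs_latKer_le_one S hh a)
  have hi' : ∀ a, Integrable (fun x => ⟪Ψ (latPos h a), latKer S h a x • τ x⟫) σ := fun a =>
    (hi a).const_inner _
  have e4 : ∑ a ∈ I, ⟪Ψ (latPos h a), latMass S h σ τ a⟫ =
      ∫ x, ∑ a ∈ I, ⟪Ψ (latPos h a), latKer S h a x • τ x⟫ ∂σ := by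
    rw [integral_finsetSum _ fun a _ => hi' a]
    exact Finset.sum_congr rfl fun a _ => (integral_inner (hi a) _).symm
  have hiΨ : Integrable (fun x => ⟪Ψ x, τ x⟫) σ := by
    refine Integrable.mono' (integrable_const b) (hΨ.measurable.inner hτ).aestronglyMeasurable
      (ae_of_all _ fun x => (norm_inner_le_norm _ _).trans ?_)
    simpa using mul_le_mul (hb x) (hτ1 x) (norm_nonneg _) hb0
  have e5 : ∫ x, ⟪Ψ x, τ x⟫ ∂σ ≤
      ∫ x, ∑ a ∈ I, ⟪Ψ (latPos h a), latKer S h a x • τ x⟫ ∂σ + ω := by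
    rw [← sub_le_iff_le_add', ← integral_sub hiΨ (integrable_finsetSum _ fun a _ => hi' a)]
    refine (integral_mono (hiΨ.sub (integrable_finsetSum _ fun a _ => hi' a)) (integrable_const ω)
      fun x => ?_).trans (by simp)
    obtain ⟨J, hIJ, hJ⟩ := exists_sum_latKer_eq_one S hh I x
    have g1 : ∑ a ∈ I, ⟪Ψ (latPos h a), latKer S h a x • τ x⟫ =
        ∑ a ∈ J, latKer S h a x * ⟪Ψ (latPos h a), τ x⟫ := by
      simp only [inner_smul_right]
      refine Finset.sum_subset hIJ fun a _ ha => by rw [hI' a ha, inner_zero_left, mul_zero]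
    have g2 : ⟪Ψ x, τ x⟫ = ∑ a ∈ J, latKer S h a x * ⟪Ψ x, τ x⟫ := by
      rw [← Finset.sum_mul, hJ, one_mul]
    change ⟪Ψ x, τ x⟫ - ∑ a ∈ I, ⟪Ψ (latPos h a), latKer S h a x • τ x⟫ ≤ ω
    rw [g1, g2, ← Finset.sum_sub_distrib, ← one_mul ω, ← hJ, Finset.sum_mul]
    refine Finset.sum_le_sum fun a _ => ?_
    rw [← mul_sub, ← inner_sub_left]
    by_cases hk : latKer S h a x = 0
    · simp [hk]
    · refine mul_le_mul_of_nonneg_left ((real_inner_le_norm _ _).trans ?_) (latKer_nonneg S hh a x)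
      simpa using mul_le_mul (hω _ _ (norm_sub_latPos_le S hh hk)) (hτ1 x) (norm_nonneg _) hω0
  rw [e1]
  linarith

end Discrete

lemma exists_bound_modulus {Ψ : Ed 2 → Ed 2} (hΨ : Continuous Ψ) {R : ℝ}
    (hΨs : ∀ x, R < ‖x‖ → Ψ x = 0) :
    (∃ b, ∀ x, ‖Ψ x‖ ≤ b) ∧ ∀ ω > 0, ∃ ρ > 0, ∀ x y, ‖x - y‖ ≤ ρ → ‖Ψ x - Ψ y‖ ≤ ω := by
  have hs : HasCompactSupport Ψ := HasCompactSupport.intro (isCompact_closedBall (0 : Ed 2) R)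
    fun x hx => hΨs x (by simpa using hx)
  refine ⟨hs.exists_bound_of_continuous hΨ, fun ω hω => ?_⟩
  obtain ⟨ρ, hρ, h⟩ := Metric.uniformContinuous_iff.1
    (HasCompactSupport.uniformContinuous_of_continuous hs hΨ) ω hω
  refine ⟨ρ / 2, by positivity, fun x y hxy => ?_⟩
  rw [← dist_eq_norm]
  exact (h (by rw [dist_eq_norm]; linarith)).le

lemma integral_inner_add_sum_le {σ : Measure (Ed 2)} [IsProbabilityMeasure σ] {τ : Ed 2 → Ed 2}
    (hτ : Measurable τ) (hτ1 : ∀ x, ‖τ x‖ ≤ 1)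
    (hdiv : ∀ φ : Ed 2 → ℝ, ContDiff ℝ (⊤ : ℕ∞) φ → HasCompactSupport φ →
      ∫ x, fderiv ℝ φ x (τ x) ∂σ = 0)
    {Φ : Ed 2 → Ed 2} (hΦ : Continuous Φ) {R : ℝ} (hR : 0 ≤ R) (hΦs : ∀ x, R < ‖x‖ → Φ x = 0)
    {ψ : ℕ → Ed 2 → Ed 2} {H N r : ℕ → ℝ} {Λ : ℕ → ℝ≥0} {K : ℕ}
    (hH : Monotone H) (hHN : ∀ k < K, ∀ q ∈ loopSet (N k), loopPair q Φ ≤ H k)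
    (hHK : ∀ x, ‖Φ x‖ ≤ H K) (hψ1 : ∀ k x, ‖ψ k x‖ ≤ 1) (hψL : ∀ k, LipschitzWith (Λ k) (ψ k))
    (hr : ∀ k, 0 ≤ r k) (hψs : ∀ k x, r k < ‖x‖ → ψ k x = 0) (hrN : ∀ k, r k + 2 ≤ N k) :
    ∫ x, ⟪Φ x + ∑ k ∈ Finset.range K, (H (k + 1) - H k) • ψ k x, τ x⟫ ∂σ ≤
      H K + ∑ k ∈ Finset.range K, (H (k + 1) - H k) * (2 * Λ k * (2 * r k + 3) ^ 2 / N k) := by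
  set Ψ : Ed 2 → Ed 2 := fun x => Φ x + ∑ k ∈ Finset.range K, (H (k + 1) - H k) • ψ k x
  set C := H K + ∑ k ∈ Finset.range K, (H (k + 1) - H k) * (2 * Λ k * (2 * r k + 3) ^ 2 / N k)
  have hΨ : Continuous Ψ := hΦ.add (continuous_finsetSum _ fun k _ => by
    have := (hψL k).continuous
    fun_prop)
  set R' := R + ∑ k ∈ Finset.range K, r k
  have hR0 : 0 ≤ ∑ k ∈ Finset.range K, r k := Finset.sum_nonneg fun k _ => hr k
  have hR' : 0 ≤ R' := by positivity
  have hΨs : ∀ x, R' < ‖x‖ → Ψ x = 0 := by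
    intro x hx
    have h1 : Φ x = 0 := hΦs x (by linarith)
    have h2 : ∀ k ∈ Finset.range K, (H (k + 1) - H k) • ψ k x = 0 := fun k hk => by
      rw [hψs k x, smul_zero]
      linarith [Finset.single_le_sum (f := r) (fun k _ => hr k) hk]
    simp [Ψ, h1, Finset.sum_eq_zero h2]
  obtain ⟨⟨b, hb⟩, hΨm⟩ := exists_bound_modulus hΨ hΨs
  obtain ⟨-, hΦm⟩ := exists_bound_modulus hΦ hΦs
  refine le_of_forall_pos_le_add fun e he => ?_
  obtain ⟨ρ₁, hρ₁, h1⟩ := hΨm (e / 2) (by positivity)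
  obtain ⟨ρ₂, hρ₂, h2⟩ := hΦm (e / 2) (by positivity)
  set ε := ρ₁ / 4
  have hε : 0 < ε := by positivity
  obtain ⟨S⟩ := exists_smoothStep hε
  have key : ∀ᶠ h in nhdsWithin (0 : ℝ) (Set.Ioi 0), ∫ x, ⟪Ψ x, τ x⟫ ∂σ ≤
      (C + e / 2) * (1 + 2 * (S.M * (2 * ε + 3) * h)) + e / 2 +
        b * (2 * (S.M * (2 * ε + 3) * h)) := by
    have : Set.Ioo 0 (min 1 (min (ρ₁ / 4) (ρ₂ / 6))) ∈ nhdsWithin (0 : ℝ) (Set.Ioi 0) :=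
      Ioo_mem_nhdsGT (by positivity)
    filter_upwards [this] with h hh
    obtain ⟨hh0, hh⟩ := hh
    obtain ⟨hh1, hh⟩ := lt_min_iff.1 hh
    obtain ⟨hh2, hh3⟩ := lt_min_iff.1 hh
    have m1 := integral_inner_le_tsum (σ := σ) S hε hh0 hh1.le hτ hτ1 hdiv hΨ hb hR' hΨs
      (ω := e / 2) (fun x y hxy => h1 x y (by simp only [ε] at hxy; linarith))
    have m2 := tsum_inner_triGrad_le hh0 hh1.le (tendsto_latStream S hε hh0 hτ hτ1 hdiv)
      (summable_norm_triGrad_latStream S hε hh0 hh1.le hτ hτ1 hdiv) hΦ hR hΦs hH hHN hHK hψ1 hψL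
      hr hψs hrN (ω := e / 2) (fun x y hxy => h2 x y (by linarith))
    have m3 := tsum_norm_triGrad_latStream_le S hε hh0 hh1.le hτ hτ1 hdiv
    have hHK0 : 0 ≤ H K := (norm_nonneg _).trans (hHK 0)
    have hC : 0 ≤ C := add_nonneg hHK0 (Finset.sum_nonneg fun k _ =>
      mul_nonneg (sub_nonneg.2 (hH (Nat.le_succ k)))
      (div_nonneg (by positivity) (by linarith [hr k, hrN k])))
    have m4 := mul_le_mul_of_nonneg_left m3 (by positivity : 0 ≤ C + e / 2)
    linarith
  have lim : Tendsto (fun h : ℝ => (C + e / 2) * (1 + 2 * (S.M * (2 * ε + 3) * h)) + e / 2 +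
      b * (2 * (S.M * (2 * ε + 3) * h))) (nhdsWithin 0 (Set.Ioi 0)) (nhds (C + e)) := by
    have : Continuous (fun h : ℝ => (C + e / 2) * (1 + 2 * (S.M * (2 * ε + 3) * h)) + e / 2 +
      b * (2 * (S.M * (2 * ε + 3) * h))) := by fun_prop
    convert! (this.tendsto 0).mono_left nhdsWithin_le_nhds using 2
    ring
  exact ge_of_tendsto lim key

/-- The radial retraction onto the unit ball. -/
def unitRetract (v : Ed 2) : Ed 2 := (max 1 ‖v‖)⁻¹ • v

lemma norm_unitRetract_le (v : Ed 2) : ‖unitRetract v‖ ≤ 1 := by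
  have h : 0 < max 1 ‖v‖ := lt_max_of_lt_left one_pos
  rw [unitRetract, norm_smul, norm_inv, Real.norm_of_nonneg h.le, inv_mul_le_iff₀ h, mul_one]
  exact le_max_right _ _

lemma unitRetract_of_norm_le {v : Ed 2} (hv : ‖v‖ ≤ 1) : unitRetract v = v := by
  rw [unitRetract, max_eq_left hv, inv_one, one_smul]

lemma lipschitzWith_unitRetract : LipschitzWith 2 unitRetract := by
  refine LipschitzWith.of_dist_le_mul fun v w => ?_
  rw [dist_eq_norm, dist_eq_norm]
  set a := max 1 ‖v‖
  set b := max 1 ‖w‖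
  have ha : 1 ≤ a := le_max_left _ _
  have hb : 1 ≤ b := le_max_left _ _
  have hab : |b - a| ≤ ‖v - w‖ := by
    have := abs_max_sub_max_le_max 1 ‖w‖ 1 ‖v‖
    rw [sub_self, abs_zero, max_eq_right (abs_nonneg (‖w‖ - ‖v‖))] at this
    rw [norm_sub_rev]
    exact this.trans (abs_norm_sub_norm_le _ _)
  have e : unitRetract v - unitRetract w = a⁻¹ • (v - w) + ((b - a) / (a * b)) • w := by
    have : (b - a) / (a * b) = a⁻¹ - b⁻¹ := by field_simp
    rw [this, unitRetract, unitRetract, smul_sub, sub_smul]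
    abel
  have h1 : ‖a⁻¹ • (v - w)‖ ≤ ‖v - w‖ := by
    rw [norm_smul, norm_inv, Real.norm_of_nonneg (by linarith)]
    exact mul_le_of_le_one_left (norm_nonneg _) (inv_le_one_of_one_le₀ ha)
  have h2 : ‖((b - a) / (a * b)) • w‖ ≤ ‖v - w‖ := by
    rw [norm_smul, norm_div, Real.norm_eq_abs, Real.norm_of_nonneg (by positivity), div_mul_eq_mul_div,
      div_le_iff₀ (by positivity)]
    have h3 : ‖w‖ ≤ a * b := (le_max_right 1 ‖w‖).trans (le_mul_of_one_le_left (by linarith) ha)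
    exact mul_le_mul hab h3 (norm_nonneg _) (norm_nonneg _)
  rw [e]
  refine (norm_add_le _ _).trans ?_
  change _ ≤ (2 : ℝ) * ‖v - w‖
  linarith

lemma exists_lipschitz_approx {σ : Measure (Ed 2)} [IsProbabilityMeasure σ] {τ : Ed 2 → Ed 2}
    (hτ : Measurable τ) (hτ1 : ∀ x, ‖τ x‖ ≤ 1) {e : ℝ} (he : 0 < e) :
    ∃ (ψ : Ed 2 → Ed 2) (Λ : ℝ≥0) (r : ℝ), LipschitzWith Λ ψ ∧ (∀ x, ‖ψ x‖ ≤ 1) ∧ 0 ≤ r ∧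
      (∀ x, r < ‖x‖ → ψ x = 0) ∧ ∫ x, ‖τ x - ψ x‖ ∂σ ≤ e := by
  have hm : MemLp τ 1 σ := MemLp.of_bound hτ.aestronglyMeasurable 1 (ae_of_all _ hτ1)
  obtain ⟨g, hg1, hg2, hg3⟩ := hm.exist_eLpNorm_sub_le ENNReal.one_ne_top le_rfl
    (ε := e / 2) (by positivity)
  obtain ⟨Λ, hΛ⟩ := hg2.lipschitzWith_of_hasCompactSupport hg1 (by simp)
  obtain ⟨r, hr⟩ := hg1.isCompact.isBounded.subset_closedBall (0 : Ed 2)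
  refine ⟨unitRetract ∘ g, 2 * Λ, max r 0, lipschitzWith_unitRetract.comp hΛ,
    fun x => norm_unitRetract_le _, le_max_right _ _, fun x hx => ?_, ?_⟩
  · have : g x = 0 := image_eq_zero_of_notMem_tsupport fun hc => by
      have := hr hc
      rw [mem_closedBall_zero_iff] at this
      exact absurd ((le_max_left r 0).trans_lt hx) (not_lt.2 this)
    simp [this, unitRetract]
  · have hi : Integrable (fun x => τ x - g x) σ := by
      have := hm.integrable le_rfl
      exact this.sub (hg2.continuous.integrable_of_hasCompactSupport hg1)
    have h1 : ∫ x, ‖τ x - g x‖ ∂σ ≤ e / 2 := by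
      rw [integral_norm_eq_lintegral_enorm hi.aestronglyMeasurable]
      refine ENNReal.toReal_le_of_le_ofReal (by positivity) ?_
      rw [← eLpNorm_one_eq_lintegral_enorm]
      exact hg3
    have h2 : ∀ x, ‖τ x - (unitRetract ∘ g) x‖ ≤ 2 * ‖τ x - g x‖ := fun x => by
      have := lipschitzWith_unitRetract.dist_le_mul (τ x) (g x)
      rw [dist_eq_norm, dist_eq_norm, unitRetract_of_norm_le (hτ1 x)] at this
      exact this
    refine (integral_mono_of_nonneg (ae_of_all _ fun x => norm_nonneg _) (hi.norm.const_mul 2)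
      (ae_of_all _ h2)).trans ?_
    rw [integral_const_mul]
    linarith

lemma integrable_inner_of_bounded {σ : Measure (Ed 2)} [IsFiniteMeasure σ] {τ Ψ : Ed 2 → Ed 2}
    (hτ : Measurable τ) (hτ1 : ∀ x, ‖τ x‖ ≤ 1) (hΨ : Continuous Ψ) {b : ℝ}
    (hb : ∀ x, ‖Ψ x‖ ≤ b) : Integrable (fun x => ⟪Ψ x, τ x⟫) σ := by
  refine Integrable.mono' (integrable_const b) (hΨ.measurable.inner hτ).aestronglyMeasurable
    (ae_of_all _ fun x => (norm_inner_le_norm _ _).trans ?_)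
  simpa using mul_le_mul (hb x) (hτ1 x) (norm_nonneg _) ((norm_nonneg _).trans (hb x))

lemma one_sub_le_integral_inner {σ : Measure (Ed 2)} [IsProbabilityMeasure σ] {τ ψ : Ed 2 → Ed 2}
    (hτ : Measurable τ) (hτ1 : ∀ x, ‖τ x‖ ≤ 1) (hτe : ∀ᵐ x ∂σ, ‖τ x‖ = 1) (hψ : Continuous ψ)
    (hψ1 : ∀ x, ‖ψ x‖ ≤ 1) {e : ℝ} (he : ∫ x, ‖τ x - ψ x‖ ∂σ ≤ e) :
    1 - e ≤ ∫ x, ⟪ψ x, τ x⟫ ∂σ := by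
  have hi : Integrable (fun x => ‖τ x - ψ x‖) σ := by
    refine Integrable.mono' (integrable_const (2 : ℝ))
      (hτ.sub hψ.measurable).norm.aestronglyMeasurable (ae_of_all _ fun x => ?_)
    rw [norm_norm]
    exact (norm_sub_le _ _).trans (by linarith [hτ1 x, hψ1 x])
  have : ∫ x, (1 - ‖τ x - ψ x‖) ∂σ ≤ ∫ x, ⟪ψ x, τ x⟫ ∂σ := by
    refine integral_mono_ae ((integrable_const 1).sub hi)
      (integrable_inner_of_bounded hτ hτ1 hψ hψ1) ?_
    filter_upwards [hτe] with x hx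
    have h1 : ⟪ψ x, τ x⟫ = 1 - ⟪τ x - ψ x, τ x⟫ := by
      rw [inner_sub_left, real_inner_self_eq_norm_sq, hx]; ring
    rw [h1]
    have := real_inner_le_norm (τ x - ψ x) (τ x)
    rw [hx, mul_one] at this
    linarith
  rw [integral_sub (integrable_const 1) hi] at this
  simp only [integral_const, probReal_univ, smul_eq_mul, mul_one] at this
  linarith

lemma sum_range_sub_mul_one_sub (H : ℕ → ℝ) (n : ℕ) :
    ∑ k ∈ Finset.range n, (H (k + 1) - H k) * (1 - (1 / 2) ^ (k + 1)) =
      H n - ∑ k ∈ Finset.range n, (1 / 2) ^ (k + 1) * H k - (1 / 2) ^ n * H n := by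
  induction n with
  | zero => simp
  | succ n ih => rw [Finset.sum_range_succ, ih, Finset.sum_range_succ]; ring

lemma summable_half_mul {g : ℕ → ℝ} {B : ℝ} (hg : ∀ k, |g k| ≤ B) :
    Summable fun k : ℕ => (1 / 2 : ℝ) ^ (k + 1) * g k := by
  have h0 : Summable fun k : ℕ => (1 / 2 : ℝ) ^ (k + 1) * B :=
    ((summable_nat_add_iff 1).2 summable_geometric_two).mul_right B
  refine h0.of_norm_bounded fun k => ?_
  rw [norm_mul, Real.norm_of_nonneg (by positivity)]
  exact mul_le_mul_of_nonneg_left (hg k) (by positivity)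

/-- The action of a divergence-free measure is bounded by a weighted supremum over loops. -/
lemma exists_radii_integral_le {σ : Measure (Ed 2)} [IsProbabilityMeasure σ] {τ : Ed 2 → Ed 2}
    (hτ : Measurable τ) (hτ1 : ∀ x, ‖τ x‖ ≤ 1) (hτe : ∀ᵐ x ∂σ, ‖τ x‖ = 1)
    (hdiv : ∀ φ : Ed 2 → ℝ, ContDiff ℝ (⊤ : ℕ∞) φ → HasCompactSupport φ →
      ∫ x, fderiv ℝ φ x (τ x) ∂σ = 0) :
    ∃ N : ℕ → ℝ, (∀ k, 0 < N k) ∧ ∀ Φ : Ed 2 → Ed 2, Continuous Φ → HasCompactSupport Φ →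
      ∃ q : ℕ → LoopData, (∀ k, q k ∈ loopSet (N k)) ∧
        ∫ x, ⟪Φ x, τ x⟫ ∂σ ≤ ∑' k : ℕ, (1 / 2 : ℝ) ^ (k + 1) * loopPair (q k) Φ := by
  choose ψ Λ r hψL hψ1 hr hψs hψe using fun k : ℕ =>
    exists_lipschitz_approx (σ := σ) hτ hτ1 (e := (1 / 2) ^ (k + 2)) (by positivity)
  set A : ℕ → ℝ := fun k => 2 * Λ k * (2 * r k + 3) ^ 2
  set s : ℕ → ℝ := fun j => 1 + (r j + 2) + A j * 2 ^ (j + 2)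
  set N : ℕ → ℝ := fun k => ∑ j ∈ Finset.range (k + 1), s j
  have hA : ∀ k, 0 ≤ A k := fun k => by positivity
  have hs0 : ∀ k, 0 ≤ s k := fun k => by have := hr k; have := hA k; positivity
  have hsN : ∀ k, s k ≤ N k := fun k =>
    Finset.single_le_sum (fun j _ => hs0 j) (Finset.self_mem_range_succ k)
  have hA2 : ∀ k, 0 ≤ A k * 2 ^ (k + 2) := fun k => by have := hA k; positivity
  have hN0 : ∀ k, 0 < N k := fun k => lt_of_lt_of_le
    (by simp only [s]; linarith [hr k, hA2 k]) (hsN k)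
  have hrN : ∀ k, r k + 2 ≤ N k := fun k => le_trans (by simp only [s]; linarith [hA2 k]) (hsN k)
  have hAN : ∀ k, A k / N k ≤ (1 / 2) ^ (k + 2) := fun k => by
    have h1 : A k * 2 ^ (k + 2) ≤ N k := le_trans (by simp only [s]; linarith [hr k]) (hsN k)
    rw [div_le_iff₀ (hN0 k), one_div, inv_pow, inv_mul_eq_div, le_div_iff₀ (by positivity)]
    exact h1
  have hNm : Monotone N := monotone_nat_of_le_succ fun k => by
    simp only [N]
    rw [Finset.sum_range_succ _ (k + 1)]
    linarith [hs0 (k + 1)]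
  refine ⟨N, hN0, fun Φ hΦ hΦs => ?_⟩
  obtain ⟨B, hB⟩ := hΦs.exists_bound_of_continuous hΦ
  choose q hqm hqx using fun k => (isCompact_loopSet (N k)).exists_isMaxOn
    ⟨0, zero_mem_loopSet (hN0 k).le⟩ (continuousOn_loopPair (N k) hΦ hΦs)
  refine ⟨q, hqm, ?_⟩
  set g : ℕ → ℝ := fun k => loopPair (q k) Φ
  have hgB : ∀ k, |g k| ≤ B := fun k => abs_loopPair_le (hqm k) hB
  have hg0 : ∀ k, 0 ≤ g k := fun k => by
    have := hqx k (zero_mem_loopSet (hN0 k).le)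
    simpa [loopPair_zero] using this
  have hgm : Monotone g := monotone_nat_of_le_succ fun k =>
    hqx (k + 1) (loopSet_mono (hNm (Nat.le_succ k)) (hqm k))
  obtain ⟨R, hR⟩ := hΦs.isCompact.isBounded.subset_closedBall (0 : Ed 2)
  have hΦR : ∀ x, max R 0 < ‖x‖ → Φ x = 0 := fun x hx =>
    image_eq_zero_of_notMem_tsupport fun hc => by
      have := hR hc
      rw [mem_closedBall_zero_iff] at this
      exact absurd ((le_max_left R 0).trans_lt hx) (not_lt.2 this)
  have hsum := summable_half_mul hgB
  have key : ∀ K : ℕ, ∫ x, ⟪Φ x, τ x⟫ ∂σ ≤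
      ∑' k : ℕ, (1 / 2 : ℝ) ^ (k + 1) * g k + (1 / 2) ^ K * B := by
    intro K
    set H : ℕ → ℝ := fun k => if k < K then g k else B
    have hHm : Monotone H := monotone_nat_of_le_succ fun k => by
      simp only [H]
      split_ifs with h1 h2
      · exact hgm (Nat.le_succ k)
      · exact le_of_abs_le (hgB k)
      · omega
      · exact le_rfl
    have hd : ∀ k, 0 ≤ H (k + 1) - H k := fun k => sub_nonneg.2 (hHm (Nat.le_succ k))
    have m1 := integral_inner_add_sum_le hτ hτ1 hdiv hΦ (le_max_right R 0) hΦR (ψ := ψ) (H := H)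
      (N := N) (r := r) (K := K) hHm (fun k hk q' hq' => by
        simp only [H, if_pos hk]; exact hqx k hq')
      (fun x => by simpa [H] using hB x) hψ1 hψL hr hψs hrN
    have hi : ∀ k, Integrable (fun x => ⟪ψ k x, τ x⟫) σ := fun k =>
      integrable_inner_of_bounded hτ hτ1 (hψL k).continuous (hψ1 k)
    have e1 : ∫ x, ⟪Φ x + ∑ k ∈ Finset.range K, (H (k + 1) - H k) • ψ k x, τ x⟫ ∂σ =
        ∫ x, ⟪Φ x, τ x⟫ ∂σ + ∑ k ∈ Finset.range K, (H (k + 1) - H k) * ∫ x, ⟪ψ k x, τ x⟫ ∂σ := by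
      simp only [inner_add_left, sum_inner, real_inner_smul_left]
      rw [integral_add (integrable_inner_of_bounded hτ hτ1 hΦ hB)
        (integrable_finsetSum _ fun k _ => (hi k).const_mul _),
        integral_finsetSum _ fun k _ => (hi k).const_mul _]
      simp only [integral_const_mul]
    rw [e1] at m1
    have m2 : ∑ k ∈ Finset.range K, (H (k + 1) - H k) * (1 - (1 / 2) ^ (k + 1)) ≤
        ∑ k ∈ Finset.range K, (H (k + 1) - H k) * ∫ x, ⟪ψ k x, τ x⟫ ∂σ -
        ∑ k ∈ Finset.range K, (H (k + 1) - H k) * (2 * Λ k * (2 * r k + 3) ^ 2 / N k) := by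
      rw [← Finset.sum_sub_distrib]
      refine Finset.sum_le_sum fun k _ => ?_
      rw [← mul_sub]
      refine mul_le_mul_of_nonneg_left ?_ (hd k)
      have a1 := one_sub_le_integral_inner hτ hτ1 hτe (hψL k).continuous (hψ1 k) (hψe k)
      have a2 : 2 * Λ k * (2 * r k + 3) ^ 2 / N k ≤ (1 / 2 : ℝ) ^ (k + 2) := hAN k
      have a3 : (1 / 2 : ℝ) ^ (k + 1) = 2 * (1 / 2) ^ (k + 2) := by ring
      linarith
    rw [sum_range_sub_mul_one_sub] at m2
    have e2 : H K = B := by simp [H]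
    have e3 : ∑ k ∈ Finset.range K, (1 / 2 : ℝ) ^ (k + 1) * H k =
        ∑ k ∈ Finset.range K, (1 / 2 : ℝ) ^ (k + 1) * g k :=
      Finset.sum_congr rfl fun k hk => by simp only [H, if_pos (Finset.mem_range.1 hk)]
    have m3 := hsum.sum_le_tsum (Finset.range K) fun k _ =>
      mul_nonneg (by positivity) (hg0 k)
    rw [e2, e3] at m2
    rw [e2] at m1
    linarith
  have lim : Tendsto (fun K : ℕ => ∑' k : ℕ, (1 / 2 : ℝ) ^ (k + 1) * g k + (1 / 2) ^ K * B) atTop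
      (nhds (∑' k : ℕ, (1 / 2 : ℝ) ^ (k + 1) * g k)) := by
    have := ((tendsto_pow_atTop_nhds_zero_of_lt_one (by norm_num : (0 : ℝ) ≤ 1 / 2)
      (by norm_num)).mul_const B).const_add (∑' k : ℕ, (1 / 2 : ℝ) ^ (k + 1) * g k)
    simpa using this
  exact ge_of_tendsto' lim key

section Representation

variable {X : Type*} [TopologicalSpace X] [CompactSpace X] [Nonempty X]
  {E : Type*} [AddCommGroup E] [Module ℝ E]

omit [Nonempty X] in
lemma le_iSup_continuousMap (g : C(X, ℝ)) (x : X) : g x ≤ ⨆ y, g y :=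
  le_ciSup (isCompact_range g.continuous).bddAbove x

/-- The sublinear gauge obtained by correcting with the functional `ℓ` on the range of `m`. -/
def infGauge (m : E →ₗ[ℝ] C(X, ℝ)) (ℓ : E →ₗ[ℝ] ℝ) (g : C(X, ℝ)) : ℝ :=
  ⨅ Φ : E, (ℓ Φ + ⨆ x, (g - m Φ) x)

variable {m : E →ₗ[ℝ] C(X, ℝ)} {ℓ : E →ₗ[ℝ] ℝ} (hℓ : ∀ Φ, ∃ x, ℓ Φ ≤ m Φ x)
include hℓ

omit [Nonempty X] in
lemma infGauge_le (g : C(X, ℝ)) (Φ : E) : infGauge m ℓ g ≤ ℓ Φ + ⨆ x, (g - m Φ) x := by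
  refine ciInf_le ⟨-‖g‖, ?_⟩ Φ
  rintro _ ⟨Ψ, rfl⟩
  obtain ⟨x, hx⟩ := hℓ (-Ψ)
  have h1 := le_iSup_continuousMap (g - m Ψ) x
  have h2 := neg_le_of_abs_le (g.norm_coe_le_norm x)
  simp only [map_neg, ContinuousMap.neg_apply, ContinuousMap.sub_apply] at hx h1
  change -‖g‖ ≤ ℓ Ψ + ⨆ x, (g - m Ψ) x
  simp only [ContinuousMap.sub_apply]
  linarith

lemma infGauge_smul_le {c : ℝ} (hc : 0 < c) (g : C(X, ℝ)) :
    infGauge m ℓ (c • g) ≤ c * infGauge m ℓ g := by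
  rw [infGauge, infGauge, Real.mul_iInf_of_nonneg hc.le]
  refine le_ciInf fun Φ => (infGauge_le hℓ (c • g) (c • Φ)).trans ?_
  rw [map_smul, smul_eq_mul, mul_add]
  refine add_le_add le_rfl (ciSup_le fun x => ?_)
  have := mul_le_mul_of_nonneg_left (le_iSup_continuousMap (g - m Φ) x) hc.le
  simpa [mul_sub] using this

lemma infGauge_smul {c : ℝ} (hc : 0 < c) (g : C(X, ℝ)) :
    infGauge m ℓ (c • g) = c * infGauge m ℓ g := by
  refine le_antisymm (infGauge_smul_le hℓ hc g) ?_
  have := infGauge_smul_le hℓ (inv_pos.2 hc) (c • g)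
  rwa [smul_smul, inv_mul_cancel₀ hc.ne', one_smul, le_inv_mul_iff₀ hc] at this

lemma infGauge_add_le (g g' : C(X, ℝ)) :
    infGauge m ℓ (g + g') ≤ infGauge m ℓ g + infGauge m ℓ g' := by
  refine le_of_forall_pos_le_add fun e he => ?_
  obtain ⟨Φ, h1⟩ := exists_lt_of_ciInf_lt (lt_add_of_pos_right (infGauge m ℓ g) (half_pos he))
  obtain ⟨Ψ, h2⟩ := exists_lt_of_ciInf_lt (lt_add_of_pos_right (infGauge m ℓ g') (half_pos he))
  have h3 := infGauge_le hℓ (g + g') (Φ + Ψ)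
  have h4 : ⨆ x, (g + g' - m (Φ + Ψ)) x ≤ (⨆ x, (g - m Φ) x) + ⨆ x, (g' - m Ψ) x := by
    refine ciSup_le fun x => ?_
    have a1 := le_iSup_continuousMap (g - m Φ) x
    have a2 := le_iSup_continuousMap (g' - m Ψ) x
    have a3 : (g + g' - m (Φ + Ψ)) x = (g - m Φ) x + (g' - m Ψ) x := by
      simp only [map_add, ContinuousMap.sub_apply, ContinuousMap.add_apply]; ring
    linarith
  rw [map_add] at h3
  linarith

omit [Nonempty X] in
lemma infGauge_le_iSup (g : C(X, ℝ)) : infGauge m ℓ g ≤ ⨆ x, g x := by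
  simpa using infGauge_le hℓ g 0

omit [Nonempty X] in
lemma infGauge_map_le (Φ : E) : infGauge m ℓ (m Φ) ≤ ℓ Φ := by
  simpa using infGauge_le hℓ (m Φ) Φ

lemma exists_linear_le_infGauge (f : C(X, ℝ)) : ∃ L : C(X, ℝ) →ₗ[ℝ] ℝ,
    (∀ g, L g ≤ infGauge m ℓ g) ∧ L f = infGauge m ℓ f := by
  have h0 : infGauge m ℓ 0 = 0 := by
    have := infGauge_smul hℓ (c := 2) (by norm_num) 0
    rw [smul_zero] at this
    linarith
  have hH : ∀ c : ℝ, c • f = 0 → c • infGauge m ℓ f = 0 := fun c hc => by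
    rcases smul_eq_zero.1 hc with h | h
    · rw [h, zero_smul]
    · rw [h, h0, smul_zero]
  let p : C(X, ℝ) →ₗ.[ℝ] ℝ := LinearPMap.mkSpanSingleton' f (infGauge m ℓ f) hH
  obtain ⟨L, h1, h2⟩ := exists_extension_of_le_sublinear
    p (infGauge m ℓ)
    (fun c hc g => infGauge_smul hℓ hc g) (infGauge_add_le hℓ) (by
      rintro ⟨x, hx⟩
      obtain ⟨c, rfl⟩ := Submodule.mem_span_singleton.1 hx
      change p ⟨c • f, hx⟩ ≤ _
      rw [LinearPMap.mkSpanSingleton'_apply]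
      simp only [smul_eq_mul, RingHom.id_apply]
      rcases lt_trichotomy c 0 with hc | rfl | hc
      · have e1 := infGauge_add_le hℓ (c • f) ((-c) • f)
        rw [← add_smul, add_neg_cancel, zero_smul, h0, infGauge_smul hℓ (neg_pos.2 hc)] at e1
        linarith
      · simp [h0]
      · rw [infGauge_smul hℓ hc])
  refine ⟨L, h2, ?_⟩
  have hf : f ∈ p.domain :=
    Submodule.mem_span_singleton_self f
  have := h1 ⟨f, hf⟩
  rw [LinearPMap.mkSpanSingleton'_apply_self] at this
  exact this

variable [T2Space X] [MeasurableSpace X] [BorelSpace X]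

omit [Nonempty X] hℓ in
lemma exists_measure_of_nonneg_linear (L : C(X, ℝ) →ₗ[ℝ] ℝ)
    (hL : ∀ g : C(X, ℝ), (∀ x, 0 ≤ g x) → 0 ≤ L g) (hL1 : L 1 = 1) :
    ∃ P : Measure X, IsProbabilityMeasure P ∧ ∀ g : C(X, ℝ), ∫ x, g x ∂P = L g := by
  let Λ₀ : CompactlySupportedContinuousMap X ℝ →ₗ[ℝ] ℝ :=
    { toFun := fun g => L g.toContinuousMap
      map_add' := fun g g' => by rw [← map_add]; rfl
      map_smul' := fun c g => by rw [RingHom.id_apply, ← map_smul]; rfl }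
  let Λ : CompactlySupportedContinuousMap X ℝ →ₚ[ℝ] ℝ := PositiveLinearMap.mk₀ Λ₀ fun g hg => hL _ fun x => hg x
  have key : ∀ g : C(X, ℝ), ∫ x, g x ∂(RealRMK.rieszMeasure Λ) = L g := fun g =>
    RealRMK.integral_rieszMeasure Λ ⟨g, HasCompactSupport.of_compactSpace _⟩
  have hfin : IsFiniteMeasure (RealRMK.rieszMeasure Λ) :=
    ⟨(isCompact_univ (X := X)).measure_lt_top⟩
  refine ⟨RealRMK.rieszMeasure Λ, ⟨?_⟩, key⟩
  have h1 := key 1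
  rw [hL1] at h1
  simp only [ContinuousMap.one_apply, integral_const, smul_eq_mul, mul_one] at h1
  rw [measureReal_def] at h1
  rw [← ENNReal.ofReal_toReal (measure_ne_top (RealRMK.rieszMeasure Λ) Set.univ), h1,
    ENNReal.ofReal_one]

/-- A functional dominated by the supremum is represented by a probability measure, which may be
taken extremal with respect to a given continuous function. -/
lemma exists_measure_of_le_sup (f : C(X, ℝ)) :
    ∃ P : Measure X, IsProbabilityMeasure P ∧ (∀ Φ, ∫ x, m Φ x ∂P = ℓ Φ) ∧
      ∀ᵐ x ∂P, ∀ ε > 0, ∃ Φ, ∀ y, f y - m Φ y ≤ f x - m Φ x + ε := by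
  obtain ⟨L, hL, hLf⟩ := exists_linear_le_infGauge hℓ f
  have hLs : ∀ g, L g ≤ ⨆ x, g x := fun g => (hL g).trans (infGauge_le_iSup hℓ g)
  have hc : ∀ c : ℝ, L (c • 1) = c := fun c => by
    refine le_antisymm ((hLs _).trans (ciSup_le fun x => by simp)) ?_
    have := (hLs (-(c • 1))).trans (ciSup_le (c := -c) fun x => by simp)
    rw [map_neg] at this
    linarith
  have hpos : ∀ g : C(X, ℝ), (∀ x, 0 ≤ g x) → 0 ≤ L g := fun g hg => by
    have := (hLs (-g)).trans (ciSup_le (c := 0) fun x => by simpa using hg x)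
    rw [map_neg] at this
    linarith
  have hm : ∀ Φ, L (m Φ) = ℓ Φ := fun Φ => by
    refine le_antisymm ((hL _).trans (infGauge_map_le hℓ Φ)) ?_
    have := (hL (m (-Φ))).trans (infGauge_map_le hℓ (-Φ))
    rw [map_neg, map_neg, map_neg] at this
    linarith
  obtain ⟨P, hP, hPL⟩ := exists_measure_of_nonneg_linear L hpos (by simpa using hc 1)
  refine ⟨P, hP, fun Φ => (hPL _).trans (hm Φ), ?_⟩
  have near : ∀ j : ℕ, ∃ Φ, ℓ Φ + (⨆ x, (f - m Φ) x) < L f + 1 / (j + 1 : ℝ) := fun j => by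
    rw [hLf]
    exact exists_lt_of_ciInf_lt (lt_add_of_pos_right _ (by positivity))
  choose Φ hΦ using near
  set D : ℕ → C(X, ℝ) := fun j => (⨆ x, (f - m (Φ j)) x) • 1 - (f - m (Φ j))
  have hD0 : ∀ j x, 0 ≤ D j x := fun j x => by
    have := le_iSup_continuousMap (f - m (Φ j)) x
    simp only [D, ContinuousMap.sub_apply, ContinuousMap.smul_apply, ContinuousMap.one_apply,
      smul_eq_mul, mul_one] at this ⊢
    linarith
  have hDi : ∀ j, ∫ x, D j x ∂P ≤ 1 / (j + 1 : ℝ) := fun j => by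
    rw [hPL, map_sub, hc, map_sub, hm]
    linarith [hΦ j]
  have hae : ∀ e : ℝ, 0 < e → ∀ᵐ x ∂P, ∃ j, D j x < e := by
    intro e he
    rw [ae_iff]
    have hi : ∀ j, Integrable (D j) P := fun j =>
      (D j).continuous.integrable_of_hasCompactSupport (HasCompactSupport.of_compactSpace _)
    have hb : ∀ j : ℕ, P.real {x | ¬ ∃ j, D j x < e} ≤ 1 / (j + 1 : ℝ) / e := fun j => by
      have h1 := mul_meas_ge_le_integral_of_nonneg (ae_of_all P (hD0 j)) (hi j) e
      rw [le_div_iff₀ he, mul_comm]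
      refine le_trans (mul_le_mul_of_nonneg_left (measureReal_mono fun x hx => ?_) he.le)
        (h1.trans (hDi j))
      simp only [not_exists, not_lt, Set.mem_ofPred_eq] at hx
      exact hx j
    have hlim : Tendsto (fun j : ℕ => 1 / (j + 1 : ℝ) / e) atTop (nhds 0) := by
      simpa using (tendsto_one_div_add_atTop_nhds_zero_nat (𝕜 := ℝ)).div_const e
    have h0 := ge_of_tendsto' hlim hb
    exact (measureReal_eq_zero_iff).1 (le_antisymm h0 measureReal_nonneg)
  have hall : ∀ᵐ x ∂P, ∀ n : ℕ, ∃ j, D j x < 1 / (n + 1 : ℝ) :=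
    ae_all_iff.2 fun n => hae _ (by positivity)
  filter_upwards [hall] with x hx ε hε
  obtain ⟨n, hn⟩ := exists_nat_one_div_lt hε
  obtain ⟨j, hj⟩ := hx n
  refine ⟨Φ j, fun y => ?_⟩
  have h1 := le_iSup_continuousMap (f - m (Φ j)) y
  simp only [D, ContinuousMap.sub_apply, ContinuousMap.smul_apply, ContinuousMap.one_apply,
    smul_eq_mul, mul_one] at hj h1
  linarith

end Representation

/-! ### Extremal representation by loops -/

instance : MeasurableSpace C(Set.Icc (0:ℝ) 1, Ed 2) := borel _

instance : BorelSpace C(Set.Icc (0:ℝ) 1, Ed 2) := ⟨rfl⟩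

/-- Continuous compactly supported vector fields. -/
def testField : Submodule ℝ (Ed 2 → Ed 2) where
  carrier := {Φ | Continuous Φ ∧ HasCompactSupport Φ}
  add_mem' h h' := ⟨h.1.add h'.1, h.2.add h'.2⟩
  zero_mem' := ⟨continuous_const, HasCompactSupport.zero⟩
  smul_mem' c _ h := ⟨h.1.const_smul c, h.2.smul_left (f := fun _ => c)⟩

/-- Sequences of loops of prescribed sizes. -/
abbrev LoopSeq (N : ℕ → ℝ) : Type := ∀ k, loopSet (N k)

instance (N : ℝ) : CompactSpace (loopSet N) := isCompact_iff_compactSpace.1 (isCompact_loopSet N)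

lemma exists_bound_testField (Φ : testField) : ∃ B, ∀ x, ‖Φ.1 x‖ ≤ B :=
  Φ.2.2.exists_bound_of_continuous Φ.2.1

/-- The weighted pairing of a sequence of loops with a test field. -/
def seqPair (N : ℕ → ℝ) : testField →ₗ[ℝ] C(LoopSeq N, ℝ) where
  toFun Φ := ⟨fun q => ∑' k, (1/2:ℝ)^(k+1) * loopPair (q k).1 Φ.1, by
    obtain ⟨B, hB⟩ := exists_bound_testField Φ
    refine continuous_tsum (u := fun k => (1/2:ℝ)^(k+1) * B) (fun k => ?_)
      (summable_half_mul (g := fun _ => B) (B := |B|) fun _ => le_rfl) fun k q => ?_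
    · exact continuous_const.mul ((continuousOn_iff_continuous_domRestrict.1
        (continuousOn_loopPair (N k) Φ.2.1 Φ.2.2)).comp (continuous_apply k))
    · rw [norm_mul, Real.norm_of_nonneg (by positivity), Real.norm_eq_abs]
      exact mul_le_mul_of_nonneg_left (abs_loopPair_le (q k).2 hB) (by positivity)⟩
  map_add' Φ Ψ := by
    obtain ⟨B, hB⟩ := exists_bound_testField Φ
    obtain ⟨C, hC⟩ := exists_bound_testField Ψ
    ext q
    change ∑' k : ℕ, (1/2:ℝ)^(k+1) * loopPair (q k).1 (Φ.1 + Ψ.1) =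
      (∑' k : ℕ, (1/2:ℝ)^(k+1) * loopPair (q k).1 Φ.1) +
        ∑' k : ℕ, (1/2:ℝ)^(k+1) * loopPair (q k).1 Ψ.1
    rw [← Summable.tsum_add (summable_half_mul fun k => abs_loopPair_le (q k).2 hB)
      (summable_half_mul fun k => abs_loopPair_le (q k).2 hC)]
    refine tsum_congr fun k => ?_
    rw [← mul_add, ← loopPair_add (q k).2 Φ.2.1 Ψ.2.1]
  map_smul' c Φ := by
    ext q
    change ∑' k : ℕ, (1/2:ℝ)^(k+1) * loopPair (q k).1 (c • Φ.1) =
      c * ∑' k : ℕ, (1/2:ℝ)^(k+1) * loopPair (q k).1 Φ.1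
    rw [← tsum_mul_left]
    refine tsum_congr fun k => ?_
    rw [loopPair_smul, mul_left_comm]

lemma seqPair_apply {N : ℕ → ℝ} (Φ : testField) (q : LoopSeq N) :
    seqPair N Φ q = ∑' k, (1/2:ℝ)^(k+1) * loopPair (q k).1 Φ.1 := rfl

lemma abs_length_ratio_le {N : ℝ} (hN : 0 < N) (q : loopSet N) : |-(q.1.1 / N)| ≤ 1 := by
  rw [abs_neg, abs_of_nonneg (div_nonneg q.2.1 hN.le), div_le_one hN]
  exact q.2.2.1

/-- Minus the weighted relative length of a sequence of loops. -/
def seqLength (N : ℕ → ℝ) (hN : ∀ k, 0 < N k) : C(LoopSeq N, ℝ) :=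
  ⟨fun q => ∑' k, (1/2:ℝ)^(k+1) * -((q k).1.1 / N k), by
    refine continuous_tsum (u := fun k => (1/2:ℝ)^(k+1) * 1) (fun k => ?_)
      (summable_half_mul (g := fun _ => 1) (B := 1) fun _ => by simp) fun k q => ?_
    · have : Continuous fun q : LoopSeq N => (q k).1.1 :=
        continuous_fst.comp (continuous_subtype_val.comp (continuous_apply k))
      fun_prop
    · rw [norm_mul, Real.norm_of_nonneg (by positivity), Real.norm_eq_abs]
      exact mul_le_mul_of_nonneg_left (abs_length_ratio_le (hN k) (q k)) (by positivity)⟩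

lemma tsum_update_sub {N : ℕ → ℝ} (F : ∀ k, loopSet (N k) → ℝ) {B : ℝ}
    (hF : ∀ k x, |F k x| ≤ B) (q : LoopSeq N) (k : ℕ) (y : loopSet (N k)) :
    (∑' j, (1/2:ℝ)^(j+1) * F j (Function.update q k y j)) - ∑' j, (1/2:ℝ)^(j+1) * F j (q j) =
      (1/2:ℝ)^(k+1) * (F k y - F k (q k)) := by
  rw [← Summable.tsum_sub (summable_half_mul fun j => hF j _) (summable_half_mul fun j => hF j _),
    tsum_eq_single k fun j hj => by rw [Function.update_of_ne hj, sub_self],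
    Function.update_self]
  ring

/-- A sequence of loops which is extremal for the length consists of simple loops. -/
lemma injOn_of_extremal {N : ℕ → ℝ} (hN : ∀ k, 0 < N k) {q : LoopSeq N}
    (hq : ∀ ε > 0, ∃ Φ, ∀ y, seqLength N hN y - seqPair N Φ y ≤
      seqLength N hN q - seqPair N Φ q + ε) (k : ℕ) (hk : 0 < (q k).1.1) :
    Set.InjOn (loopCurve (q k).1) (Set.Ico 0 1) := by
  have key : ∀ s t : ℝ, 0 ≤ s → s < t → t < 1 →
      loopCurve (q k).1 s = loopCurve (q k).1 t → False := by
    intro s t hs hst ht he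
    obtain ⟨q₁, hq₁, q₂, hq₂, hl₁, hl₂, hp⟩ :=
      exists_loop_split (q k).2 hk hs hst ht.le (by linarith) he
    set d := t - s with hd
    have hd0 : 0 < d := by linarith
    have hd1 : d < 1 := by linarith
    have hpos : 0 < (1/2:ℝ)^(k+1) * ((q k).1.1 / N k * (2 * (d * (1 - d)))) := by
      have := hN k
      have : 0 < 1 - d := by linarith
      positivity
    obtain ⟨Φ, hΦ⟩ := hq _ (half_pos hpos)
    obtain ⟨B, hB⟩ := exists_bound_testField Φ
    have step : ∀ y : loopSet (N k), (1/2:ℝ)^(k+1) *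
        ((q k).1.1 / N k - y.1.1 / N k - (loopPair y.1 Φ.1 - loopPair (q k).1 Φ.1)) ≤
        (1/2:ℝ)^(k+1) * ((q k).1.1 / N k * (2 * (d * (1 - d)))) / 2 := fun y => by
      have h1 := tsum_update_sub (fun k (x : loopSet (N k)) => -(x.1.1 / N k))
        (fun k x => abs_length_ratio_le (hN k) x) q k y
      have h2 := tsum_update_sub (fun k (x : loopSet (N k)) => loopPair x.1 Φ.1)
        (fun k x => abs_loopPair_le x.2 hB) q k y
      have h3 := hΦ (Function.update q k y)
      rw [seqPair_apply, seqPair_apply] at h3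
      simp only [seqLength, ContinuousMap.coe_mk] at h3
      rw [mul_sub] at h1 h2
      linarith
    have h1 := mul_le_mul_of_nonneg_left (step ⟨q₁, hq₁⟩) hd0.le
    have h2 := mul_le_mul_of_nonneg_left (step ⟨q₂, hq₂⟩) (sub_pos.2 hd1).le
    have h3 := hp Φ.1 Φ.2.1
    simp only [hl₁, hl₂] at h1 h2
    have h4 : (1/2:ℝ)^(k+1) * ((q k).1.1 / N k * (2 * (d * (1 - d)))) ≤
        (1/2:ℝ)^(k+1) * ((q k).1.1 / N k * (2 * (d * (1 - d)))) / 2 := by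
      have h5 := add_le_add h1 h2
      have e : d * ((1/2:ℝ)^(k+1) * ((q k).1.1 / N k - d * (q k).1.1 / N k -
          (loopPair q₁ Φ.1 - loopPair (q k).1 Φ.1))) + (1 - d) * ((1/2:ℝ)^(k+1) *
          ((q k).1.1 / N k - (1 - d) * (q k).1.1 / N k -
          (loopPair q₂ Φ.1 - loopPair (q k).1 Φ.1))) =
          (1/2:ℝ)^(k+1) * ((q k).1.1 / N k * (2 * (d * (1 - d)))) := by
        rw [h3]; ring
      rw [e] at h5
      linarith
    linarith
  intro s hs t ht he
  rcases lt_trichotomy s t with h | h | h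
  · exact (key s t hs.1 h ht.2 he).elim
  · exact h
  · exact (key t s ht.1 h hs.2 he.symm).elim

lemma measurableSet_injOn_Ico :
    MeasurableSet {c : C(Set.Icc (0:ℝ) 1, Ed 2) | Set.InjOn (hat c) (Set.Ico 0 1)} := by
  have e : {c : C(Set.Icc (0:ℝ) 1, Ed 2) | Set.InjOn (hat c) (Set.Ico 0 1)} =
      ⋂ n : ℕ, (Prod.fst '' {p : C(Set.Icc (0:ℝ) 1, Ed 2) × Set.Icc (0:ℝ) 1 × Set.Icc (0:ℝ) 1 |
        (p.2.2 : ℝ) ≤ 1 - 1 / (n + 1 : ℝ) ∧ 1 / (n + 1 : ℝ) ≤ p.2.2 - p.2.1 ∧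
          p.1 p.2.1 = p.1 p.2.2})ᶜ := by
    ext c
    simp only [Set.mem_ofPred_eq, Set.mem_iInter, Set.mem_compl_iff, Set.mem_image, not_exists,
      not_and]
    constructor
    · rintro h n ⟨c', s, t⟩ ⟨h1, h2, h3⟩ rfl
      have hn : (0:ℝ) < 1 / (n + 1 : ℝ) := by positivity
      simp only at h1 h2 h3
      have hst := h ⟨s.2.1, by linarith⟩ ⟨t.2.1, by linarith⟩ (by rw [hat_coe, hat_coe, h3])
      linarith
    · intro h
      have key : ∀ s t : ℝ, 0 ≤ s → s < t → t < 1 → hat c s = hat c t → False := by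
        intro s t hs hst ht he
        obtain ⟨n, hn⟩ := exists_nat_one_div_lt (lt_min (sub_pos.2 hst) (sub_pos.2 ht))
        rw [lt_min_iff] at hn
        refine h n ⟨c, ⟨s, hs, by linarith⟩, ⟨t, by linarith, ht.le⟩⟩
          ⟨by simp only; linarith, by simp only; linarith, ?_⟩ rfl
        rw [← hat_coe, ← hat_coe, he]
      intro s hs t ht he
      rcases lt_trichotomy s t with h' | h' | h'
      · exact (key s t hs.1 h' ht.2 he).elim
      · exact h'
      · exact (key t s ht.1 h' hs.2 he.symm).elim
  rw [e]
  refine MeasurableSet.iInter fun n => (IsClosed.measurableSet ?_).compl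
  refine isClosedMap_fst_of_compactSpace _ ?_
  simp only [Set.ofPred_and]
  refine (isClosed_le ?_ ?_).inter ((isClosed_le ?_ ?_).inter (isClosed_eq ?_ ?_)) <;> fun_prop

/-- The loop as an element of the space of continuous paths. -/
def loopPath (q : LoopData) : C(Set.Icc (0:ℝ) 1, Ed 2) :=
  ContinuousMap.const _ q.2.1 + q.1 • q.2.2

lemma continuous_loopPath : Continuous loopPath := by
  unfold loopPath
  have := ContinuousMap.continuous_const' (X := Set.Icc (0:ℝ) 1) (Y := Ed 2)
  exact (this.comp (by fun_prop)).add (by fun_prop)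

lemma hat_loopPath (q : LoopData) : hat (loopPath q) = loopCurve q := rfl

lemma measurableSet_simple :
    MeasurableSet {q : LoopData | 0 < q.1 → Set.InjOn (loopCurve q) (Set.Ico 0 1)} := by
  have : {q : LoopData | 0 < q.1 → Set.InjOn (loopCurve q) (Set.Ico 0 1)} =
      {q : LoopData | 0 < q.1}ᶜ ∪ loopPath ⁻¹' {c | Set.InjOn (hat c) (Set.Ico 0 1)} := by
    ext q
    simp only [Set.mem_ofPred_eq, Set.mem_union, Set.mem_compl_iff, Set.mem_preimage,
      hat_loopPath, imp_iff_not_or]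
  rw [this]
  exact (measurableSet_lt measurable_const measurable_fst).compl.union
    (continuous_loopPath.measurable measurableSet_injOn_Ico)

lemma measurable_deriv_hat :
    Measurable fun p : LoopData × ℝ => deriv (hat p.1.2.2) p.2 := by
  refine measurable_deriv_with_param (f := fun q : LoopData => hat q.2.2) ?_
  simp only [Function.uncurry_def, hat]
  have := continuous_projIcc (h := zero_le_one (α := ℝ))
  fun_prop

lemma continuous_uncurry_loopCurve :
    Continuous fun p : LoopData × ℝ => loopCurve p.1 p.2 := by
  have := continuous_projIcc (h := zero_le_one (α := ℝ))
  unfold loopCurve hat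
  fun_prop

lemma measurable_loopPair {Φ : Ed 2 → Ed 2} (hΦ : Continuous Φ) :
    Measurable fun q => loopPair q Φ := by
  have h : Measurable fun p : LoopData × ℝ =>
      ⟪Φ (loopCurve p.1 p.2), deriv (hat p.1.2.2) p.2⟫ :=
    (hΦ.comp continuous_uncurry_loopCurve).measurable.inner measurable_deriv_hat
  simp only [loopPair, intervalIntegral.integral_of_le zero_le_one]
  exact (h.stronglyMeasurable.integral_prod_right').measurable

/-- A unit divergence-free measure is an average of simple loops. -/
lemma exists_loop_measure {σ : Measure (Ed 2)} [IsProbabilityMeasure σ] {τ : Ed 2 → Ed 2}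
    (hτ : Measurable τ) (hτ1 : ∀ x, ‖τ x‖ ≤ 1) (hτe : ∀ᵐ x ∂σ, ‖τ x‖ = 1)
    (hdiv : ∀ φ : Ed 2 → ℝ, ContDiff ℝ (⊤ : ℕ∞) φ → HasCompactSupport φ →
      ∫ x, fderiv ℝ φ x (τ x) ∂σ = 0) :
    ∃ ν : Measure LoopData, IsProbabilityMeasure ν ∧
      (∀ Φ, Continuous Φ → HasCompactSupport Φ →
        Integrable (fun q => loopPair q Φ) ν ∧ ∫ q, loopPair q Φ ∂ν = ∫ x, ⟪Φ x, τ x⟫ ∂σ) ∧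
      ∀ᵐ q ∂ν, (∃ N, q ∈ loopSet N) ∧ (0 < q.1 → Set.InjOn (loopCurve q) (Set.Ico 0 1)) := by
  obtain ⟨N, hN, hq⟩ := exists_radii_integral_le hτ hτ1 hτe hdiv
  let ℓ : testField →ₗ[ℝ] ℝ :=
    { toFun := fun Φ => ∫ x, ⟪Φ.1 x, τ x⟫ ∂σ
      map_add' := fun Φ Ψ => by
        obtain ⟨B, hB⟩ := exists_bound_testField Φ
        obtain ⟨C, hC⟩ := exists_bound_testField Ψ
        rw [← integral_add (integrable_inner_of_bounded hτ hτ1 Φ.2.1 hB)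
          (integrable_inner_of_bounded hτ hτ1 Ψ.2.1 hC)]
        simp [inner_add_left]
      map_smul' := fun c Φ => by
        rw [RingHom.id_apply, smul_eq_mul, ← integral_const_mul]
        simp [inner_smul_left] }
  have : Nonempty (LoopSeq N) := ⟨fun k => ⟨0, zero_mem_loopSet (hN k).le⟩⟩
  obtain ⟨P, hP, hPℓ, hPe⟩ := exists_measure_of_le_sup (m := seqPair N) (ℓ := ℓ) (fun Φ => by
    obtain ⟨q, hqN, hle⟩ := hq Φ.1 Φ.2.1 Φ.2.2
    exact ⟨fun k => ⟨q k, hqN k⟩, hle⟩) (seqLength N hN)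
  have hpm : ∀ k, Measurable fun q : LoopSeq N => (q k).1 := fun k =>
    measurable_subtype_coe.comp (measurable_pi_apply k)
  let w : ℕ → ℝ≥0∞ := fun k => ENNReal.ofReal ((1/2:ℝ)^(k+1))
  let ν : Measure LoopData := Measure.sum fun k => w k • P.map fun q : LoopSeq N => (q k).1
  have hone : HasSum (fun k : ℕ => (1/2:ℝ)^(k+1)) 1 := by
    convert hasSum_geometric_two' 1 using 2 with k
    rw [pow_succ, one_div, inv_pow]; ring
  have hν : IsProbabilityMeasure ν := ⟨by
    rw [Measure.sum_apply _ MeasurableSet.univ]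
    simp only [Measure.smul_apply, smul_eq_mul, Measure.map_apply (hpm _) MeasurableSet.univ,
      Set.preimage_univ, measure_univ, mul_one, w]
    rw [← ENNReal.ofReal_tsum_of_nonneg (fun k => by positivity) hone.summable, hone.tsum_eq,
      ENNReal.ofReal_one]⟩
  have hae : ∀ᵐ q ∂ν, (∃ N, q ∈ loopSet N) ∧
      (0 < q.1 → Set.InjOn (loopCurve q) (Set.Ico 0 1)) := by
    refine Measure.ae_sum_iff.2 fun k => Measure.ae_smul_measure ?_ _
    have : ∀ᵐ q ∂P.map (fun q : LoopSeq N => (q k).1),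
        q ∈ loopSet (N k) ∧ (0 < q.1 → Set.InjOn (loopCurve q) (Set.Ico 0 1)) := by
      refine (ae_map_iff (hpm k).aemeasurable
        ((isCompact_loopSet (N k)).measurableSet.inter measurableSet_simple)).2 ?_
      filter_upwards [hPe] with q hq
      exact ⟨(q k).2, injOn_of_extremal hN hq k⟩
    filter_upwards [this] with q hq using ⟨⟨_, hq.1⟩, hq.2⟩
  refine ⟨ν, hν, fun Φ hΦ hs => ?_, hae⟩
  obtain ⟨B, hB⟩ := hs.exists_bound_of_continuous hΦ
  have hmeas := measurable_loopPair hΦ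
  have hinteg : Integrable (fun q => loopPair q Φ) ν :=
    Integrable.of_bound hmeas.aestronglyMeasurable B (by
      filter_upwards [hae] with q hq
      exact abs_loopPair_le hq.1.choose_spec hB)
  refine ⟨hinteg, ?_⟩
  rw [integral_sum_measure hinteg]
  have hk : ∀ k, ∫ q, loopPair q Φ ∂(w k • P.map fun q : LoopSeq N => (q k).1) =
      ∫ q : LoopSeq N, (1/2:ℝ)^(k+1) * loopPair (q k).1 Φ ∂P := fun k => by
    rw [integral_smul_measure, integral_map (hpm k).aemeasurable hmeas.aestronglyMeasurable,
      integral_const_mul, smul_eq_mul, ENNReal.toReal_ofReal (by positivity)]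
  simp only [hk]
  have hb : ∀ k (q : LoopSeq N), ‖(1/2:ℝ)^(k+1) * loopPair (q k).1 Φ‖ ≤ (1/2:ℝ)^(k+1) * B :=
    fun k q => by
      rw [norm_mul, Real.norm_of_nonneg (by positivity), Real.norm_eq_abs]
      exact mul_le_mul_of_nonneg_left (abs_loopPair_le (q k).2 hB) (by positivity)
  have hi : ∀ k, Integrable (fun q : LoopSeq N => (1/2:ℝ)^(k+1) * loopPair (q k).1 Φ) P :=
    fun k => Integrable.of_bound
      ((hmeas.comp (hpm k)).const_mul _).aestronglyMeasurable _ (ae_of_all _ (hb k))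
  rw [integral_tsum_of_summable_integral_norm hi]
  · exact hPℓ ⟨Φ, hΦ, hs⟩
  · refine Summable.of_nonneg_of_le (fun k => integral_nonneg fun q => norm_nonneg _)
      (fun k => ?_) (hone.summable.mul_right B)
    refine (integral_mono (hi k).norm (integrable_const _) (hb k)).trans ?_
    simp

/-! ### The superposition measure on curves -/

/-- The normalised mass of a loop tested against a function. -/
def loopMass (q : LoopData) (f : Ed 2 → ℝ) : ℝ :=
  ∫ t in (0:ℝ)..1, f (loopCurve q t) * ‖deriv (hat q.2.2) t‖

lemma deriv_loopCurve (q : LoopData) (t : ℝ) :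
    deriv (loopCurve q) t = q.1 • deriv (hat q.2.2) t := by
  change deriv (fun t => q.2.1 + q.1 • hat q.2.2 t) t = _
  rw [deriv_const_add, deriv_fun_const_smul_field]

lemma curvePair_loopCurve (q : LoopData) (Φ : Ed 2 → Ed 2) :
    curvePair (loopCurve q) Φ = q.1 * loopPair q Φ := by
  simp only [curvePair, loopPair, deriv_loopCurve, inner_smul_right,
    intervalIntegral.integral_const_mul]

lemma curveMass_loopCurve (q : LoopData) (hq : 0 ≤ q.1) (f : Ed 2 → ℝ) :
    curveMass (loopCurve q) f = q.1 * loopMass q f := by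
  simp only [curveMass, loopMass, deriv_loopCurve, norm_smul, Real.norm_of_nonneg hq,
    mul_left_comm _ q.1, intervalIntegral.integral_const_mul]

lemma measurable_loopMass {f : Ed 2 → ℝ} (hf : Continuous f) :
    Measurable fun q => loopMass q f := by
  have h : Measurable fun p : LoopData × ℝ =>
      f (loopCurve p.1 p.2) * ‖deriv (hat p.1.2.2) p.2‖ :=
    (hf.comp continuous_uncurry_loopCurve).measurable.mul measurable_deriv_hat.norm
  simp only [loopMass, intervalIntegral.integral_of_le zero_le_one]
  exact (h.stronglyMeasurable.integral_prod_right').measurable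

section

variable {N : ℝ} {q : LoopData}

lemma norm_deriv_hat_le (hq : q ∈ loopSet N) (t : ℝ) : ‖deriv (hat q.2.2) t‖ ≤ 1 := by
  simpa using norm_deriv_le_of_lipschitz (lipschitz_hat hq.2.2.1) (x₀ := t)

lemma intervalIntegrable_loopMass (hq : q ∈ loopSet N) {f : Ed 2 → ℝ} (hf : Continuous f) :
    IntervalIntegrable (fun t => f (loopCurve q t) * ‖deriv (hat q.2.2) t‖) volume 0 1 := by
  have h1 : IntervalIntegrable (fun t => ‖deriv (hat q.2.2) t‖) volume 0 1 :=
    (intervalIntegrable_const (c := (1:ℝ))).mono_fun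
      (measurable_deriv (hat q.2.2)).norm.aestronglyMeasurable
      (ae_of_all _ fun t => by simpa using norm_deriv_hat_le hq t)
  exact h1.continuousOn_mul (hf.comp (continuous_loopCurve q)).continuousOn

lemma loopMass_add (hq : q ∈ loopSet N) {f g : Ed 2 → ℝ} (hf : Continuous f)
    (hg : Continuous g) : loopMass q (fun x => f x + g x) = loopMass q f + loopMass q g := by
  rw [loopMass, loopMass, loopMass, ← intervalIntegral.integral_add
    (intervalIntegrable_loopMass hq hf) (intervalIntegrable_loopMass hq hg)]
  simp only [add_mul]

lemma loopMass_nonneg {f : Ed 2 → ℝ} (h0 : ∀ x, 0 ≤ f x) : 0 ≤ loopMass q f :=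
  intervalIntegral.integral_nonneg zero_le_one fun _ _ => mul_nonneg (h0 _) (norm_nonneg _)

lemma loopMass_le (hq : q ∈ loopSet N) {f : Ed 2 → ℝ} {B : ℝ} (h0 : ∀ x, 0 ≤ f x)
    (hB : ∀ x, f x ≤ B) : loopMass q f ≤ B := by
  have h := intervalIntegral.norm_integral_le_of_norm_le_const (a := 0) (b := 1) (C := B)
    (f := fun t => f (loopCurve q t) * ‖deriv (hat q.2.2) t‖) (fun t _ => by
      rw [norm_mul, norm_norm, Real.norm_of_nonneg (h0 _)]
      exact (mul_le_of_le_one_right (h0 _) (norm_deriv_hat_le hq t)).trans (hB _))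
  rw [sub_zero, abs_one, mul_one] at h
  exact (le_abs_self _).trans h

lemma loopPair_smul_le_loopMass (hq : q ∈ loopSet N) {f : Ed 2 → ℝ} (hf : Continuous f)
    (h0 : ∀ x, 0 ≤ f x) {ψ : Ed 2 → Ed 2} (hψ : Continuous ψ) (hψ1 : ∀ x, ‖ψ x‖ ≤ 1) :
    loopPair q (fun x => f x • ψ x) ≤ loopMass q f := by
  have hc : Continuous fun x => f x • ψ x := hf.smul hψ
  have h1 := intervalIntegrable_loopPair hq hc
  have h2 := intervalIntegrable_loopMass hq hf
  refine intervalIntegral.integral_mono_on zero_le_one h1 h2 fun t _ => ?_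
  rw [inner_smul_left, conj_trivial]
  refine mul_le_mul_of_nonneg_left ((real_inner_le_norm _ _).trans ?_) (h0 _)
  exact mul_le_of_le_one_left (norm_nonneg _) (hψ1 _)

end

/-- The mass of the loops of positive length. -/
def posMass (q : LoopData) (f : Ed 2 → ℝ) : ℝ := q.1⁻¹ * (q.1 * loopMass q f)

section

variable {N : ℝ} {q : LoopData}

lemma posMass_of_eq_zero (h : q.1 = 0) (f : Ed 2 → ℝ) : posMass q f = 0 := by
  rw [posMass, h, zero_mul, mul_zero]

lemma posMass_of_ne_zero (h : q.1 ≠ 0) (f : Ed 2 → ℝ) : posMass q f = loopMass q f :=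
  inv_mul_cancel_left₀ h _

lemma measurable_posMass {f : Ed 2 → ℝ} (hf : Continuous f) :
    Measurable fun q => posMass q f :=
  measurable_fst.inv.mul (measurable_fst.mul (measurable_loopMass hf))

lemma posMass_add (hq : q ∈ loopSet N) {f g : Ed 2 → ℝ} (hf : Continuous f)
    (hg : Continuous g) : posMass q (fun x => f x + g x) = posMass q f + posMass q g := by
  rw [posMass, loopMass_add hq hf hg, posMass, posMass]; ring

lemma posMass_nonneg {f : Ed 2 → ℝ} (h0 : ∀ x, 0 ≤ f x) : 0 ≤ posMass q f := by
  by_cases h : q.1 = 0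
  · rw [posMass_of_eq_zero h]
  · rw [posMass_of_ne_zero h]; exact loopMass_nonneg h0

lemma posMass_le (hq : q ∈ loopSet N) {f : Ed 2 → ℝ} {B : ℝ} (h0 : ∀ x, 0 ≤ f x)
    (hB : ∀ x, f x ≤ B) : posMass q f ≤ B := by
  by_cases h : q.1 = 0
  · rw [posMass_of_eq_zero h]; exact (h0 0).trans (hB 0)
  · rw [posMass_of_ne_zero h]; exact loopMass_le hq h0 hB

lemma loopPair_smul_le_posMass (hq : q ∈ loopSet N) {f : Ed 2 → ℝ} (hf : Continuous f)
    (h0 : ∀ x, 0 ≤ f x) {ψ : Ed 2 → Ed 2} (hψ : Continuous ψ) (hψ1 : ∀ x, ‖ψ x‖ ≤ 1) :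
    loopPair q (fun x => f x • ψ x) ≤ posMass q f := by
  by_cases h : q.1 = 0
  · rw [posMass_of_eq_zero h, loopPair_eq_zero_of_fst_eq_zero hq h]
  · rw [posMass_of_ne_zero h]; exact loopPair_smul_le_loopMass hq hf h0 hψ hψ1

end

section

variable {σ : Measure (Ed 2)} [IsProbabilityMeasure σ] {τ : Ed 2 → Ed 2}
  {ν : Measure LoopData} [IsProbabilityMeasure ν]

lemma integrable_posMass (hν : ∀ᵐ q ∂ν, ∃ N, q ∈ loopSet N) {f : Ed 2 → ℝ} {B : ℝ}
    (hf : Continuous f) (h0 : ∀ x, 0 ≤ f x) (hB : ∀ x, f x ≤ B) :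
    Integrable (fun q => posMass q f) ν :=
  Integrable.of_bound (measurable_posMass hf).aestronglyMeasurable B (by
    filter_upwards [hν] with q hq
    rw [Real.norm_of_nonneg (posMass_nonneg h0)]
    exact posMass_le hq.choose_spec h0 hB)

lemma integral_le_integral_posMass (hτ : Measurable τ) (hτ1 : ∀ x, ‖τ x‖ ≤ 1)
    (hτe : ∀ᵐ x ∂σ, ‖τ x‖ = 1) (hν : ∀ᵐ q ∂ν, ∃ N, q ∈ loopSet N)
    (hp : ∀ Φ, Continuous Φ → HasCompactSupport Φ →
      Integrable (fun q => loopPair q Φ) ν ∧ ∫ q, loopPair q Φ ∂ν = ∫ x, ⟪Φ x, τ x⟫ ∂σ)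
    {f : Ed 2 → ℝ} {B : ℝ} (hf : Continuous f) (h0 : ∀ x, 0 ≤ f x) (hB : ∀ x, f x ≤ B) :
    ∫ x, f x ∂σ ≤ ∫ q, posMass q f ∂ν := by
  have hB0 : 0 ≤ B := (h0 0).trans (hB 0)
  refine le_of_forall_pos_le_add fun e he => ?_
  obtain ⟨ψ, Λ, r, hψ, hψ1, -, hψ0, hψe⟩ :=
    exists_lipschitz_approx hτ hτ1 (σ := σ) (e := e / (B + 1)) (by positivity)
  have hs : HasCompactSupport fun x => f x • ψ x :=
    HasCompactSupport.intro (isCompact_closedBall (0 : Ed 2) r) fun x hx => by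
      rw [hψ0 x (by simpa using hx), smul_zero]
  have hc : Continuous fun x => f x • ψ x := hf.smul hψ.continuous
  obtain ⟨h1, h2⟩ := hp _ hc hs
  have h3 : ∫ x, ⟪f x • ψ x, τ x⟫ ∂σ ≤ ∫ q, posMass q f ∂ν := by
    rw [← h2]
    refine integral_mono_ae h1 (integrable_posMass hν hf h0 hB) ?_
    filter_upwards [hν] with q hq
    exact loopPair_smul_le_posMass hq.choose_spec hf h0 hψ.continuous hψ1
  have hi1 : Integrable (fun x => ⟪f x • ψ x, τ x⟫) σ :=
    integrable_inner_of_bounded hτ hτ1 hc (b := B) fun x => by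
      rw [norm_smul, Real.norm_of_nonneg (h0 x)]
      exact (mul_le_of_le_one_right (h0 x) (hψ1 x)).trans (hB x)
  have hi2 : Integrable (fun x => ‖τ x - ψ x‖) σ :=
    Integrable.of_bound (hτ.sub hψ.continuous.measurable).norm.aestronglyMeasurable 2
      (ae_of_all _ fun x => by
        rw [norm_norm]
        exact (norm_sub_le _ _).trans (by linarith [hτ1 x, hψ1 x]))
  have hif : Integrable f σ := Integrable.of_bound hf.aestronglyMeasurable B
    (ae_of_all _ fun x => by rw [Real.norm_of_nonneg (h0 x)]; exact hB x)
  have h4 : ∫ x, f x ∂σ ≤ ∫ x, (⟪f x • ψ x, τ x⟫ + B * ‖τ x - ψ x‖) ∂σ := by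
    refine integral_mono_ae hif (hi1.add (hi2.const_mul B)) ?_
    filter_upwards [hτe] with x hx
    have h5 : ⟪ψ x, τ x⟫ = 1 - ⟪τ x - ψ x, τ x⟫ := by
      rw [inner_sub_left, real_inner_self_eq_norm_sq, hx]; ring
    have h6 : ⟪τ x - ψ x, τ x⟫ ≤ ‖τ x - ψ x‖ := by
      simpa [hx] using real_inner_le_norm (τ x - ψ x) (τ x)
    have h7 : f x * ⟪τ x - ψ x, τ x⟫ ≤ B * ‖τ x - ψ x‖ :=
      (mul_le_mul_of_nonneg_left h6 (h0 x)).trans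
        (mul_le_mul_of_nonneg_right (hB x) (norm_nonneg _))
    simp only [inner_smul_left, h5, conj_trivial]
    linarith
  rw [integral_add hi1 (hi2.const_mul B), integral_const_mul] at h4
  have h8 : B * ∫ x, ‖τ x - ψ x‖ ∂σ ≤ e := by
    refine (mul_le_mul_of_nonneg_left hψe hB0).trans ?_
    rw [mul_div_assoc', div_le_iff₀ (by positivity)]
    nlinarith
  linarith

/-- The loops do not produce any cancellation. -/
lemma integral_eq_integral_posMass (hτ : Measurable τ) (hτ1 : ∀ x, ‖τ x‖ ≤ 1)
    (hτe : ∀ᵐ x ∂σ, ‖τ x‖ = 1) (hν : ∀ᵐ q ∂ν, ∃ N, q ∈ loopSet N)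
    (hp : ∀ Φ, Continuous Φ → HasCompactSupport Φ →
      Integrable (fun q => loopPair q Φ) ν ∧ ∫ q, loopPair q Φ ∂ν = ∫ x, ⟪Φ x, τ x⟫ ∂σ)
    {f : Ed 2 → ℝ} {B : ℝ} (hf : Continuous f) (h0 : ∀ x, 0 ≤ f x) (hB : ∀ x, f x ≤ B) :
    ∫ x, f x ∂σ = ∫ q, posMass q f ∂ν := by
  refine le_antisymm (integral_le_integral_posMass hτ hτ1 hτe hν hp hf h0 hB) ?_
  have hg : Continuous fun x => B - f x := continuous_const.sub hf
  have hg0 : ∀ x, 0 ≤ B - f x := fun x => sub_nonneg.2 (hB x)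
  have hgB : ∀ x, B - f x ≤ B := fun x => sub_le_self _ (h0 x)
  have h1 := integral_le_integral_posMass hτ hτ1 hτe hν hp hg hg0 hgB
  have hif : Integrable f σ := Integrable.of_bound hf.aestronglyMeasurable B
    (ae_of_all _ fun x => by rw [Real.norm_of_nonneg (h0 x)]; exact hB x)
  rw [integral_sub (integrable_const B) hif, integral_const, probReal_univ, one_smul] at h1
  have h2 : ∫ q, posMass q f + posMass q (fun x => B - f x) ∂ν ≤ B := by
    have : ∫ _ : LoopData, B ∂ν = B := by rw [integral_const, probReal_univ, one_smul]
    refine le_trans ?_ this.le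
    refine integral_mono_ae ((integrable_posMass hν hf h0 hB).add
      (integrable_posMass hν hg hg0 hgB)) (integrable_const B) ?_
    filter_upwards [hν] with q hq
    obtain ⟨N, hq⟩ := hq
    rw [← posMass_add hq hf hg]
    exact posMass_le hq (fun x => by simpa using (h0 0).trans (hB 0)) fun x => by simp
  rw [integral_add (integrable_posMass hν hf h0 hB) (integrable_posMass hν hg hg0 hgB)] at h2
  linarith

end

instance : BorelSpace (Curve 2) := ⟨rfl⟩

lemma continuous_curveRestrict : Continuous (curveRestrict (d := 2)) := continuous_induced_dom

lemma measurable_of_curveRestrict {α : Type*} [MeasurableSpace α] {f : α → Curve 2}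
    (hf : Measurable fun a => curveRestrict (f a)) : Measurable f := by
  have e : (inferInstance : MeasurableSpace (Curve 2)) =
      (borel C(Set.Icc (0:ℝ) 1, Ed 2)).comap curveRestrict := borel_comap
  change @Measurable _ _ _ (inferInstance : MeasurableSpace (Curve 2)) f
  rw [e]
  exact measurable_comap_iff.2 hf

lemma hat_curveRestrict (γ : Curve 2) {t : ℝ} (ht : t ∈ Set.Icc (0:ℝ) 1) :
    hat (curveRestrict γ) t = γ.1 t := hat_coe (curveRestrict γ) ⟨t, ht⟩

lemma deriv_hat_curveRestrict (γ : Curve 2) {t : ℝ} (ht : t ∈ Set.Ioo (0:ℝ) 1) :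
    deriv (hat (curveRestrict γ)) t = deriv γ.1 t := by
  refine EventuallyEq.deriv_eq ?_
  filter_upwards [isOpen_Ioo.mem_nhds ht] with s hs
  exact hat_curveRestrict γ (Set.Ioo_subset_Icc_self hs)

/-- The pairings only depend on the restriction of the curve to the unit interval. -/
lemma integral_curve_eq_integral_hat (γ : Curve 2) (F : Ed 2 → Ed 2 → ℝ) :
    ∫ t in (0:ℝ)..1, F (γ.1 t) (deriv γ.1 t) =
      ∫ t in (0:ℝ)..1, F (hat (curveRestrict γ) t) (deriv (hat (curveRestrict γ)) t) := by
  simp only [intervalIntegral.integral_of_le zero_le_one, integral_Ioc_eq_integral_Ioo]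
  refine setIntegral_congr_fun measurableSet_Ioo fun t ht => ?_
  simp only [hat_curveRestrict γ (Set.Ioo_subset_Icc_self ht), deriv_hat_curveRestrict γ ht]

lemma measurable_integral_curve {F : Ed 2 → Ed 2 → ℝ} (hF : Measurable (Function.uncurry F)) :
    Measurable fun γ : Curve 2 => ∫ t in (0:ℝ)..1, F (γ.1 t) (deriv γ.1 t) := by
  simp only [integral_curve_eq_integral_hat]
  have hp := continuous_projIcc (h := zero_le_one (α := ℝ))
  have h1 : Continuous fun p : C(Set.Icc (0:ℝ) 1, Ed 2) × ℝ => hat p.1 p.2 := by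
    unfold hat
    fun_prop
  have h2 : Measurable fun p : C(Set.Icc (0:ℝ) 1, Ed 2) × ℝ => deriv (hat p.1) p.2 :=
    measurable_deriv_with_param (f := fun c : C(Set.Icc (0:ℝ) 1, Ed 2) => hat c) h1
  have h3 : Measurable fun p : C(Set.Icc (0:ℝ) 1, Ed 2) × ℝ =>
      F (hat p.1 p.2) (deriv (hat p.1) p.2) := hF.comp (h1.measurable.prodMk h2)
  have h4 : Measurable fun c : C(Set.Icc (0:ℝ) 1, Ed 2) =>
      ∫ t in (0:ℝ)..1, F (hat c t) (deriv (hat c) t) := by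
    simp only [intervalIntegral.integral_of_le zero_le_one]
    exact (h3.stronglyMeasurable.integral_prod_right').measurable
  exact h4.comp continuous_curveRestrict.measurable

lemma measurable_curvePair {Φ : Ed 2 → Ed 2} (hΦ : Continuous Φ) :
    Measurable fun γ : Curve 2 => curvePair γ.1 Φ :=
  measurable_integral_curve (F := fun x v => ⟪Φ x, v⟫)
    ((hΦ.measurable.comp measurable_fst).inner measurable_snd)

lemma measurable_curveMass {f : Ed 2 → ℝ} (hf : Continuous f) :
    Measurable fun γ : Curve 2 => curveMass γ.1 f :=
  measurable_integral_curve (F := fun x v => f x * ‖v‖)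
    ((hf.measurable.comp measurable_fst).mul measurable_snd.norm)

/-- Closed simple curves. -/
def simpleClosed : Set (Curve 2) :=
  {γ | Set.InjOn γ.1 (Set.Ico (0:ℝ) 1) ∧ γ.1 0 = γ.1 1}

lemma measurableSet_simpleClosed : MeasurableSet simpleClosed := by
  have e : simpleClosed = curveRestrict ⁻¹' ({c | Set.InjOn (hat c) (Set.Ico 0 1)} ∩
      {c | c 0 = c 1}) := by
    ext γ
    refine and_congr (Set.EqOn.injOn_iff fun t ht => ?_) Iff.rfl
    exact (hat_curveRestrict γ (Set.Ico_subset_Icc_self ht)).symm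
  rw [e]
  exact continuous_curveRestrict.measurable (measurableSet_injOn_Ico.inter
    (isClosed_eq (continuous_eval_const _) (continuous_eval_const _)).measurableSet)

lemma sigmaFinite_of_lintegral_ne_top {α : Type*} [MeasurableSpace α] {μ : Measure α}
    {F : α → ℝ≥0∞} (hF : Measurable F) (h0 : ∀ᵐ x ∂μ, F x ≠ 0) (ht : ∀ᵐ x ∂μ, F x ≠ ∞)
    (hi : ∫⁻ x, F x ∂μ ≠ ∞) : SigmaFinite μ := by
  have := isFiniteMeasure_withDensity hi
  rw [← withDensity_inv_same hF h0 ht]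
  refine SigmaFinite.withDensity_of_ne_top ?_
  filter_upwards [(withDensity_absolutelyContinuous μ F).ae_le h0] with x hx
  exact ENNReal.inv_ne_top.2 hx

lemma isLip_loopCurve {q : LoopData} (h : LipschitzWith 1 q.2.2) : IsLip (loopCurve q) := by
  refine ⟨‖q.1‖₊, LipschitzWith.of_dist_le_mul fun s t => ?_⟩
  have := (lipschitz_hat h).dist_le_mul s t
  rw [NNReal.coe_one, one_mul] at this
  rw [loopCurve, loopCurve, dist_add_left, dist_smul₀, coe_nnnorm]
  gcongr

lemma isLip_zero : IsLip fun _ : ℝ => (0 : Ed 2) := ⟨0, LipschitzWith.const 0⟩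

/-- Bundling of a Lipschitz map. -/
def mkCurve (γ : ℝ → Ed 2) (h : IsLip γ) : Curve 2 := ⟨γ, h⟩

open scoped Classical in
/-- A loop viewed as a Lipschitz curve. -/
def toCurve (q : LoopData) : Curve 2 :=
  if h : LipschitzWith 1 q.2.2 then mkCurve _ (isLip_loopCurve h) else mkCurve _ isLip_zero

lemma toCurve_val {N : ℝ} {q : LoopData} (hq : q ∈ loopSet N) :
    (toCurve q).1 = loopCurve q := by
  rw [toCurve, dif_pos hq.2.2.1]; rfl

lemma measurable_toCurve : Measurable toCurve := by
  classical
  refine measurable_of_curveRestrict ?_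
  have hc : MeasurableSet {q : LoopData | LipschitzWith 1 q.2.2} := by
    have : {q : LoopData | LipschitzWith 1 q.2.2} =
        ⋂ (s) (t), {q : LoopData | dist (q.2.2 s) (q.2.2 t) ≤ (1 : ℝ≥0) * dist s t} := by
      ext q; simp only [Set.mem_iInter]; exact lipschitzWith_iff_dist_le_mul
    rw [this]
    refine (isClosed_iInter fun x => isClosed_iInter fun y =>
      isClosed_le ?_ continuous_const).measurableSet
    fun_prop
  have e : (fun q => curveRestrict (toCurve q)) = fun q =>
      if LipschitzWith 1 q.2.2 then loopPath q else 0 := by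
    ext1 q
    by_cases h : LipschitzWith 1 q.2.2
    · rw [if_pos h, toCurve, dif_pos h]
      ext1 t
      change loopCurve q t = loopPath q t
      rw [← hat_loopPath, hat_coe]
    · rw [if_neg h, toCurve, dif_neg h]
      rfl
  rw [e]
  exact Measurable.ite hc continuous_loopPath.measurable measurable_const

/-- The decomposition for unit measures. -/
lemma exists_curve_measure {σ : Measure (Ed 2)} [IsProbabilityMeasure σ] {τ : Ed 2 → Ed 2}
    (hτ : Measurable τ) (hτ1 : ∀ x, ‖τ x‖ ≤ 1) (hτe : ∀ᵐ x ∂σ, ‖τ x‖ = 1)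
    (hdiv : ∀ φ : Ed 2 → ℝ, ContDiff ℝ (⊤ : ℕ∞) φ → HasCompactSupport φ →
      ∫ x, fderiv ℝ φ x (τ x) ∂σ = 0) :
    ∃ η : Measure (Curve 2), SigmaFinite η ∧
      (∀ Φ : Ed 2 → Ed 2, Continuous Φ → HasCompactSupport Φ →
        ∫ x, ⟪Φ x, τ x⟫ ∂σ = ∫ γ, curvePair γ.1 Φ ∂η) ∧
      (∀ f : Ed 2 → ℝ, Continuous f → HasCompactSupport f → (∀ x, 0 ≤ f x) →
        ∫ x, f x ∂σ = ∫ γ, curveMass γ.1 f ∂η) ∧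
      ∀ᵐ γ ∂η, γ ∈ simpleClosed := by
  obtain ⟨ν, hν, hp, hae⟩ := exists_loop_measure hτ hτ1 hτe hdiv
  have hνN : ∀ᵐ q ∂ν, ∃ N, q ∈ loopSet N := hae.mono fun q h => h.1
  let w : LoopData → ℝ≥0∞ := fun q => ENNReal.ofReal q.1⁻¹
  have hw : Measurable w := measurable_fst.inv.ennreal_ofReal
  let η : Measure (Curve 2) := (ν.withDensity w).map toCurve
  have hinteg : ∀ {G : Curve 2 → ℝ}, Measurable G → ∫ γ, G γ ∂η = ∫ q, q.1⁻¹ * G (toCurve q) ∂ν := by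
    intro G hG
    rw [integral_map measurable_toCurve.aemeasurable hG.aestronglyMeasurable,
      integral_withDensity_eq_integral_toReal_smul hw (ae_of_all _ fun q => ENNReal.ofReal_lt_top)]
    refine integral_congr_ae ?_
    filter_upwards [hνN] with q ⟨N, hq⟩
    rw [ENNReal.toReal_ofReal (inv_nonneg.2 hq.1), smul_eq_mul]
  have hsimple : ∀ᵐ γ ∂η, γ ∈ simpleClosed := by
    refine (ae_map_iff measurable_toCurve.aemeasurable measurableSet_simpleClosed).2
      ((ae_withDensity_iff hw).2 ?_)
    filter_upwards [hae] with q ⟨⟨N, hq⟩, hinj⟩ h0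
    have hpos : 0 < q.1 := by
      rw [← inv_pos]
      exact ENNReal.ofReal_pos.1 (pos_iff_ne_zero.2 h0)
    refine ⟨?_, ?_⟩
    · rw [toCurve_val hq]; exact hinj hpos
    · rw [toCurve_val hq, loopCurve, loopCurve, hat_zero, hat_one, hq.2.2.2.1, hq.2.2.2.2.1]
  refine ⟨η, ?_, fun Φ hΦ hs => ?_, fun f hf hs h0 => ?_, hsimple⟩
  · have hev : ∀ t : Set.Icc (0:ℝ) 1, Continuous fun γ : Curve 2 => curveRestrict γ t := fun t =>
      (continuous_eval_const t).comp continuous_curveRestrict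
    let m : Set.Icc (0:ℝ) 1 := ⟨1/2, by norm_num, by norm_num⟩
    have hF : Measurable fun γ : Curve 2 => ‖curveRestrict γ m - curveRestrict γ 0‖ₑ :=
      ((hev m).sub (hev 0)).measurable.enorm
    refine sigmaFinite_of_lintegral_ne_top hF ?_ (ae_of_all _ fun γ => enorm_ne_top) ?_
    · filter_upwards [hsimple] with γ hγ h
      rw [enorm_eq_zero, sub_eq_zero] at h
      have := hγ.1 (show (1/2:ℝ) ∈ Set.Ico (0:ℝ) 1 by norm_num)
        (show (0:ℝ) ∈ Set.Ico (0:ℝ) 1 by norm_num) h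
      norm_num at this
    · have hFc : Measurable fun q : LoopData =>
          ‖curveRestrict (toCurve q) m - curveRestrict (toCurve q) 0‖ₑ :=
        hF.comp measurable_toCurve
      rw [lintegral_map hF measurable_toCurve, lintegral_withDensity_eq_lintegral_mul _ hw hFc]
      refine ne_top_of_le_ne_top (b := ∫⁻ _ : LoopData, 1 ∂ν) (by simp) (lintegral_mono_ae ?_)
      filter_upwards [hνN] with q ⟨N, hq⟩
      change w q * ‖(toCurve q).1 m - (toCurve q).1 (0 : Set.Icc (0:ℝ) 1)‖ₑ ≤ 1
      rw [toCurve_val hq, loopCurve, loopCurve, add_sub_add_left_eq_sub, ← smul_sub,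
        ← ofReal_norm, ← ENNReal.ofReal_mul (inv_nonneg.2 hq.1), ENNReal.ofReal_le_one,
        norm_smul, Real.norm_of_nonneg hq.1]
      have h1 : ‖hat q.2.2 m - hat q.2.2 (0 : Set.Icc (0:ℝ) 1)‖ ≤ 1 := by
        have := (lipschitz_hat hq.2.2.1).dist_le_mul m (0 : Set.Icc (0:ℝ) 1)
        rw [dist_eq_norm] at this
        refine this.trans ?_
        simp only [m, Real.dist_eq]
        norm_num
      rw [← mul_assoc]
      exact mul_le_one₀ (inv_mul_le_one (a := q.1)) (norm_nonneg _) h1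
  · rw [hinteg (measurable_curvePair hΦ), ← (hp Φ hΦ hs).2]
    refine integral_congr_ae ?_
    filter_upwards [hνN] with q ⟨N, hq⟩
    rw [toCurve_val hq, curvePair_loopCurve]
    by_cases h : q.1 = 0
    · rw [loopPair_eq_zero_of_fst_eq_zero hq h, mul_zero, mul_zero]
    · rw [inv_mul_cancel_left₀ h]
  · obtain ⟨B, hB⟩ := hs.exists_bound_of_continuous hf
    rw [hinteg (measurable_curveMass hf), integral_eq_integral_posMass hτ hτ1 hτe hνN hp hf h0
      fun x => (le_abs_self _).trans (hB x)]
    refine integral_congr_ae ?_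
    filter_upwards [hνN] with q ⟨N, hq⟩
    rw [toCurve_val hq, curveMass_loopCurve q hq.1, posMass]

/-- A divergence-free finite vector measure `μ = τ|μ|` on `ℝ²` is a superposition of measures
induced by closed simple Lipschitz curves. -/
theorem divergence_free_decomposition
    (σμ : Measure (Ed 2)) [IsFiniteMeasure σμ]
    (τ : Ed 2 → Ed 2) (hτm : Measurable τ) (hτ1 : ∀ᵐ x ∂σμ, ‖τ x‖ = 1)
    -- `div μ = 0` in the sense of distributions
    (hdiv : ∀ φ : Ed 2 → ℝ, ContDiff ℝ (⊤ : ℕ∞) φ → HasCompactSupport φ →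
      ∫ x, fderiv ℝ φ x (τ x) ∂σμ = 0) :
    ∃ η : Measure (Curve 2), SigmaFinite η ∧
      -- μ = ∫ μ_γ dη
      (∀ Φ : Ed 2 → Ed 2, Continuous Φ → HasCompactSupport Φ →
        ∫ x, ⟪Φ x, τ x⟫ ∂σμ = ∫ γ, curvePair γ.1 Φ ∂η) ∧
      -- |μ| = ∫ |μ_γ| dη
      (∀ f : Ed 2 → ℝ, Continuous f → HasCompactSupport f → (∀ x, 0 ≤ f x) →
        ∫ x, f x ∂σμ = ∫ γ, curveMass γ.1 f ∂η) ∧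
      -- η-a.e. curve can be replaced by a closed simple one inducing the same measure
      (∀ᵐ γ ∂η, ∃ γt : Curve 2, Set.InjOn γt.1 (Set.Ico (0:ℝ) 1) ∧ γt.1 0 = γt.1 1 ∧
        ∀ Φ : Ed 2 → Ed 2, Continuous Φ → HasCompactSupport Φ →
          curvePair γ.1 Φ = curvePair γt.1 Φ) := by
  rcases eq_or_ne σμ 0 with rfl | h0
  · exact ⟨0, inferInstance, fun Φ _ _ => by simp, fun f _ _ _ => by simp, by simp⟩
  have hM0 : σμ Set.univ ≠ 0 := by simpa using h0
  have hMt : σμ Set.univ ≠ ∞ := measure_ne_top _ _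
  set M := σμ Set.univ with hM
  set σ : Measure (Ed 2) := M⁻¹ • σμ with hσ
  have hP : IsProbabilityMeasure σ := ⟨by
    rw [hσ, Measure.smul_apply, smul_eq_mul, ENNReal.inv_mul_cancel hM0 hMt]⟩
  have hσμ : σμ = M • σ := by
    rw [hσ, smul_smul, ENNReal.mul_inv_cancel hM0 hMt, one_smul]
  have hac : ∀ {p : Ed 2 → Prop}, (∀ᵐ x ∂σμ, p x) → ∀ᵐ x ∂σ, p x := fun h =>
    Measure.ae_smul_measure h _
  let τ' : Ed 2 → Ed 2 := {x | ‖τ x‖ = 1}.indicator τ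
  have hττ : ∀ᵐ x ∂σμ, τ' x = τ x := by
    filter_upwards [hτ1] with x hx
    exact Set.indicator_of_mem (s := {x | ‖τ x‖ = 1}) hx τ
  have hτ' : Measurable τ' :=
    hτm.indicator (measurableSet_eq_fun hτm.norm measurable_const)
  have hb : ∀ x, ‖τ' x‖ ≤ 1 := fun x => by
    by_cases hx : ‖τ x‖ = 1
    · rw [show τ' x = τ x from Set.indicator_of_mem (s := {x | ‖τ x‖ = 1}) hx τ, hx]
    · rw [show τ' x = 0 from Set.indicator_of_notMem (s := {x | ‖τ x‖ = 1}) hx τ, norm_zero]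
      exact zero_le_one
  obtain ⟨η, hη, h1, h2, h3⟩ := exists_curve_measure (σ := σ) hτ' hb
    (hac (by filter_upwards [hττ, hτ1] with x hx h; rw [hx, h])) (fun φ hφ hs => by
      rw [hσ, integral_smul_measure, integral_congr_ae (g := fun x => fderiv ℝ φ x (τ x))
        (by filter_upwards [hττ] with x hx; rw [hx]), hdiv φ hφ hs, smul_zero])
  have hMη : M • η = M.toNNReal • η := by
    conv_lhs => rw [← ENNReal.coe_toNNReal hMt]
    rfl
  refine ⟨M • η, hMη ▸ inferInstance, fun Φ hΦ hs => ?_, fun f hf hs hf0 => ?_, ?_⟩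
  · rw [integral_smul_measure, ← h1 Φ hΦ hs, ← integral_smul_measure, ← hσμ]
    refine integral_congr_ae ?_
    filter_upwards [hττ] with x hx
    rw [hx]
  · rw [integral_smul_measure, ← h2 f hf hs hf0, ← integral_smul_measure, ← hσμ]
  · refine Measure.ae_smul_measure ?_ _
    filter_upwards [h3] with γ hγ
    exact ⟨γ, hγ.1, hγ.2, fun Φ _ _ => rfl⟩
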